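/- Let 1/2 ≤ p < 1 be fixed, and for each n let A_n be the adjacency matrix of a uniformly random simple graph on n vertices with exactly m_n edges, where |m_n − p·binom(n,2)| = O(1). Let (t_n) be a sequence of positive reals with n^{3/4}·t_n → ∞ and t_n → 0. Then the lower-tail probability satisfies Pr(τ(A_n) ≤ p^3 − t_n) = exp(−c_p · t_n^{2/3} n^2 + o(t_n^{2/3} n^2)), where c_p = ln(p/(1−p))/(2(2p−1)) for p > 1/2 and c_{1/2} = 1; equivalently, −ln Pr(τ(A_n) ≤ p^3 − t_n) / (t_n^{2/3} n^2) → c_p as n → ∞. -/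

import Mathlib

open Filter MeasureTheory ProbabilityTheory Matrix
open scoped Topology ENNReal BigOperators

noncomputable section

/-- Extended-real logarithm of a real number: `⊥` for nonpositive inputs. -/
def elogR (x : ℝ) : EReal := if x ≤ 0 then ⊥ else ((Real.log x : ℝ) : EReal)

/-- Legendre transform of `f : ℝ → ℝ`, valued in the extended reals. -/
def legendre (f : ℝ → ℝ) (y : ℝ) : EReal := ⨆ x : ℝ, ((x * y - f x : ℝ) : EReal)

/-- Frobenius inner product of two square matrices. -/
def finner {n : ℕ} (A B : Matrix (Fin n) (Fin n) ℝ) : ℝ := ∑ i, ∑ j, A i j * B i j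

/-- Frobenius norm. -/
def fnorm {n : ℕ} (M : Matrix (Fin n) (Fin n) ℝ) : ℝ := Real.sqrt (finner M M)

open Classical in
/-- `eigDesc A i` is the `(i+1)`-st largest eigenvalue of a symmetric real matrix `A`
(0-indexed, so `eigDesc A 0 = λ_1` is the largest and `eigDesc A (n-1) = λ_n` the smallest);
junk value `0` out of range or for non-symmetric `A`. -/
def eigDesc {n : ℕ} (A : Matrix (Fin n) (Fin n) ℝ) (i : ℕ) : ℝ :=
  if h : i < n then
    (if hA : A.IsHermitian then
      hA.eigenvalues ((Tuple.sort hA.eigenvalues) (Fin.rev ⟨i, h⟩)) else 0)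
  else 0

/-- `singDesc A i` is the `(i+1)`-st largest singular value of `A` (0-indexed). -/
def singDesc {n : ℕ} (A : Matrix (Fin n) (Fin n) ℝ) (i : ℕ) : ℝ :=
  Real.sqrt (eigDesc (Aᵀ * A) i)

/-- Index type for potential edges: ordered pairs `i < j`. -/
abbrev EdgeIdx (n : ℕ) := {p : Fin n × Fin n // p.1 < p.2}

/-- Number of edges of the graph encoded by `g`. -/
def edgeCount {n : ℕ} (g : EdgeIdx n → Bool) : ℕ :=
  (Finset.univ.filter fun p => g p = true).card

/-- Adjacency matrix of the graph encoded by `g`. -/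
def adjOf {n : ℕ} (g : EdgeIdx n → Bool) : Matrix (Fin n) (Fin n) ℝ :=
  Matrix.of fun i j =>
    if h : i < j then (if g ⟨(i, j), h⟩ then 1 else 0)
    else if h' : j < i then (if g ⟨(j, i), h'⟩ then 1 else 0) else 0

open Classical in
/-- Probability, under the uniform distribution `G(n,m)` over simple graphs on `n` labeled
vertices with exactly `m` edges, that the adjacency matrix satisfies `pred`. -/
def grProb (n m : ℕ) (pred : Matrix (Fin n) (Fin n) ℝ → Prop) : ℝ :=
  ((Finset.univ.filter fun g : EdgeIdx n → Bool =>
      edgeCount g = m ∧ pred (adjOf g)).card : ℝ) /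
  ((Finset.univ.filter fun g : EdgeIdx n → Bool => edgeCount g = m).card : ℝ)

open Classical in
/-- Conditional probability of `pred` given `cond` under `G(n,m)`. -/
def condGrProb (n m : ℕ) (pred cond : Matrix (Fin n) (Fin n) ℝ → Prop) : ℝ :=
  ((Finset.univ.filter fun g : EdgeIdx n → Bool =>
      edgeCount g = m ∧ cond (adjOf g) ∧ pred (adjOf g)).card : ℝ) /
  ((Finset.univ.filter fun g : EdgeIdx n → Bool =>
      edgeCount g = m ∧ cond (adjOf g)).card : ℝ)

/-- Triangle density `tr(A³)/(n(n-1)(n-2))`. -/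
def triDensity {n : ℕ} (A : Matrix (Fin n) (Fin n) ℝ) : ℝ :=
  (A * A * A).trace / ((n : ℝ) * ((n : ℝ) - 1) * ((n : ℝ) - 2))

/-- The weight of a bit under the Bernoulli distribution with parameter `p`. -/
def bitWeight (p : ℝ) (b : Bool) : ℝ := if b then p else 1 - p

/-- Expectation of `F` under independent Bernoulli bits with parameter `p`. -/
def bitExp {ι : Type*} [Fintype ι] [DecidableEq ι] (p : ℝ) (F : (ι → Bool) → ℝ) : ℝ :=
  ∑ x : ι → Bool, (∏ i, bitWeight p (x i)) * F x

open Classical in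
/-- Probability of an event under independent Bernoulli bits with parameter `p`. -/
def bitProb {ι : Type*} [Fintype ι] [DecidableEq ι] (p : ℝ) (E : (ι → Bool) → Prop) : ℝ :=
  bitExp p fun x => if E x then 1 else 0

/-- The discrete derivative of `F` in the coordinate `i`. -/
def bitDiff {ι : Type*} [DecidableEq ι] (F : (ι → Bool) → ℝ) (i : ι) (x : ι → Bool) : ℝ :=
  F (Function.update x i true) - F (Function.update x i false)

section BitExp

variable {ι : Type*} [Fintype ι] [DecidableEq ι] {p : ℝ}

lemma bitWeight_pos (h0 : 0 < p) (h1 : p < 1) (b : Bool) : 0 < bitWeight p b := by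
  unfold bitWeight; split_ifs <;> linarith

lemma bitExp_prod (h : ι → Bool → ℝ) :
    bitExp p (fun x => ∏ i, h i (x i)) = ∏ i, (p * h i true + (1 - p) * h i false) := by
  have : ∀ i, p * h i true + (1 - p) * h i false = ∑ b, bitWeight p b * h i b := by
    intro i; simp [bitWeight]
  simp_rw [this, Finset.prod_univ_sum, Fintype.piFinset_univ, bitExp, Finset.prod_mul_distrib]

lemma bitExp_const (c : ℝ) : bitExp (ι := ι) p (fun _ => c) = c := by
  have := bitExp_prod (ι := ι) (p := p) (fun _ _ => 1)
  simp only [Finset.prod_const_one, mul_one, add_sub_cancel] at this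
  unfold bitExp at *
  rw [← Finset.sum_mul]
  simp only [mul_one] at this
  rw [this, one_mul]

lemma bitExp_add (F G : (ι → Bool) → ℝ) :
    bitExp p (fun x => F x + G x) = bitExp p F + bitExp p G := by
  simp [bitExp, mul_add, Finset.sum_add_distrib]

lemma bitExp_sub (F G : (ι → Bool) → ℝ) :
    bitExp p (fun x => F x - G x) = bitExp p F - bitExp p G := by
  simp [bitExp, mul_sub, Finset.sum_sub_distrib]

lemma bitExp_const_mul (c : ℝ) (F : (ι → Bool) → ℝ) :
    bitExp p (fun x => c * F x) = c * bitExp p F := by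
  simp only [bitExp, Finset.mul_sum]
  exact Finset.sum_congr rfl fun x _ => by ring

lemma bitExp_sum {κ : Type*} (s : Finset κ) (F : κ → (ι → Bool) → ℝ) :
    bitExp p (fun x => ∑ k ∈ s, F k x) = ∑ k ∈ s, bitExp p (F k) := by
  simp only [bitExp, Finset.mul_sum]
  exact Finset.sum_comm

lemma bitExp_mono (h0 : 0 < p) (h1 : p < 1) {F G : (ι → Bool) → ℝ} (h : ∀ x, F x ≤ G x) :
    bitExp p F ≤ bitExp p G :=
  Finset.sum_le_sum fun x _ => mul_le_mul_of_nonneg_left (h x)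
    (Finset.prod_nonneg fun _ _ => (bitWeight_pos h0 h1 _).le)

lemma bitExp_exp_pos (h0 : 0 < p) (h1 : p < 1) (F : (ι → Bool) → ℝ) :
    0 < bitExp p (fun x => Real.exp (F x)) :=
  Finset.sum_pos (fun _ _ => mul_pos (Finset.prod_pos fun _ _ => bitWeight_pos h0 h1 _)
    (Real.exp_pos _)) Finset.univ_nonempty

lemma bitProb_mono (h0 : 0 < p) (h1 : p < 1) {E E' : (ι → Bool) → Prop}
    (h : ∀ x, E x → E' x) : bitProb p E ≤ bitProb p E' := by
  classical
  refine bitExp_mono h0 h1 fun x => ?_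
  by_cases hx : E x
  · simp [hx, h x hx]
  · simp only [hx, if_false]; split_ifs <;> norm_num

lemma bitProb_or_le (h0 : 0 < p) (h1 : p < 1) (E E' : (ι → Bool) → Prop) :
    bitProb p (fun x => E x ∨ E' x) ≤ bitProb p E + bitProb p E' := by
  classical
  unfold bitProb
  rw [← bitExp_add]
  refine bitExp_mono h0 h1 fun x => ?_
  by_cases hx : E x <;> by_cases hx' : E' x <;> simp [hx, hx']

lemma bitProb_exists_le (h0 : 0 < p) (h1 : p < 1) {κ : Type*} (s : Finset κ)
    (E : κ → (ι → Bool) → Prop) :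
    bitProb p (fun x => ∃ k ∈ s, E k x) ≤ ∑ k ∈ s, bitProb p (E k) := by
  classical
  unfold bitProb
  rw [← bitExp_sum]
  refine bitExp_mono h0 h1 fun x => ?_
  have hnn : ∀ k ∈ s, (0:ℝ) ≤ if E k x then 1 else 0 := fun k _ => by split_ifs <;> norm_num
  split_ifs with h
  · obtain ⟨k, hk, hE⟩ := h
    calc (1:ℝ) = if E k x then 1 else 0 := by simp [hE]
      _ ≤ _ := Finset.single_le_sum hnn hk
  · exact Finset.sum_nonneg hnn

/-- Exponential Markov inequality. -/
lemma bitProb_le_exp (h0 : 0 < p) (h1 : p < 1) (F : (ι → Bool) → ℝ) (u : ℝ) :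
    bitProb p (fun x => u ≤ F x) ≤ Real.exp (-u) * bitExp p (fun x => Real.exp (F x)) := by
  classical
  rw [← bitExp_const_mul]
  refine bitExp_mono h0 h1 fun x => ?_
  rw [← Real.exp_add]
  split_ifs with h
  · exact Real.one_le_exp (by linarith)
  · positivity

/-- The expectation of a centred bit times a function not depending on that bit vanishes. -/
lemma bitExp_centered_mul (e : ι) (H : (ι → Bool) → ℝ)
    (hH : ∀ x b, H (Function.update x e b) = H x) :
    bitExp p (fun x => ((if x e then 1 else 0) - p) * H x) = 0 := by
  set T : (ι → Bool) → ℝ := fun x =>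
    (∏ i, bitWeight p (x i)) * (((if x e then 1 else 0) - p) * H x) with hT
  let φ : (ι → Bool) → (ι → Bool) := fun x => Function.update x e (!x e)
  have hφ : Function.Involutive φ := by
    intro x; funext i
    by_cases hi : i = e
    · subst hi; simp [φ]
    · simp [φ, hi]
  have h1 : ∑ x, T x = ∑ x, T (φ x) := (Equiv.sum_comp hφ.toPerm T).symm
  have h2 : ∀ x, T (φ x) = - T x := by
    intro x
    simp only [hT, φ]
    rw [hH, ← Finset.mul_prod_erase _ _ (Finset.mem_univ e),
      ← Finset.mul_prod_erase _ (fun i => bitWeight p (x i)) (Finset.mem_univ e)]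
    have : ∏ i ∈ Finset.univ.erase e, bitWeight p (Function.update x e (!x e) i) =
        ∏ i ∈ Finset.univ.erase e, bitWeight p (x i) :=
      Finset.prod_congr rfl fun i hi => by
        rw [Function.update_of_ne (Finset.ne_of_mem_erase hi)]
    rw [this]
    cases hx : x e <;> simp [bitWeight] <;> ring
  have h3 : ∑ x, T x = -∑ x, T x := by
    conv_lhs => rw [h1]
    simp [h2]
  change ∑ x, T x = 0
  linarith

lemma bitExp_reindex {κ : Type*} [Fintype κ] [DecidableEq κ] (e : ι ≃ κ)
    (F : (κ → Bool) → ℝ) :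
    bitExp p F = bitExp p (fun x : ι → Bool => F (x ∘ e.symm)) := by
  unfold bitExp
  refine (Fintype.sum_equiv (e.arrowCongr (Equiv.refl Bool)) _ _ fun x => ?_).symm
  have h : (e.arrowCongr (Equiv.refl Bool)) x = x ∘ e.symm := by
    funext i; simp [Equiv.arrowCongr]
  rw [h]
  congr 1
  exact Fintype.prod_equiv e _ _ fun i => by simp

lemma bitExp_fin_succ {N : ℕ} (F : (Fin (N + 1) → Bool) → ℝ) :
    bitExp p F = p * bitExp p (fun y : Fin N → Bool => F (Fin.cons true y)) +
      (1 - p) * bitExp p (fun y : Fin N → Bool => F (Fin.cons false y)) := by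
  have hc : ∀ (b : Bool) (y : Fin N → Bool),
      Fin.consEquiv (fun _ : Fin (N + 1) => Bool) (b, y) = Fin.cons b y := fun _ _ => rfl
  unfold bitExp
  rw [← Equiv.sum_comp (Fin.consEquiv fun _ : Fin (N + 1) => Bool), Fintype.sum_prod_type]
  simp only [Fintype.sum_bool, hc, Fin.prod_univ_succ, Fin.cons_zero,
    Fin.cons_succ, Finset.mul_sum]
  congr 1 <;> exact Finset.sum_congr rfl fun x _ => by simp [bitWeight, mul_assoc]

end BitExp

lemma log_tangent {a m A M : ℝ} (ha : 0 < a) (hm : 0 < m) (hA : 0 < A) (hM : 0 < M) :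
    a * (Real.log A - Real.log M) + a - m * (A / M) ≤ a * (Real.log a - Real.log m) := by
  have h := Real.log_le_sub_one_of_pos (show 0 < m * A / (M * a) by positivity)
  rw [Real.log_div (by positivity) (by positivity), Real.log_mul hm.ne' hA.ne',
    Real.log_mul hM.ne' ha.ne'] at h
  have h2 : a * (m * A / (M * a) - 1) = m * (A / M) - a := by field_simp
  nlinarith [mul_le_mul_of_nonneg_left h ha.le]

lemma two_point_entropy_le {p : ℝ} (h0 : 0 < p) (h1 : p < 1) (x y : ℝ) :
    p * (Real.exp x * x) + (1 - p) * (Real.exp y * y) -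
      (p * Real.exp x + (1 - p) * Real.exp y) * Real.log (p * Real.exp x + (1 - p) * Real.exp y)
      ≤ (p * Real.exp x + (1 - p) * Real.exp y) * (x - y) ^ 2 := by
  have hq : 0 < 1 - p := by linarith
  set m := p * Real.exp x + (1 - p) * Real.exp y with hm
  have hmpos : 0 < m := by positivity
  have hJ : p * x + (1 - p) * y ≤ Real.log m := by
    rw [Real.le_log_iff_exp_le hmpos]
    have := convexOn_exp.2 (Set.mem_univ x) (Set.mem_univ y) h0.le hq.le (by ring)
    simpa using this
  have h3 : p * (Real.exp x * x) + (1 - p) * (Real.exp y * y) - m * Real.log m ≤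
      p * (1 - p) * ((x - y) * (Real.exp x - Real.exp y)) := by
    have := mul_le_mul_of_nonneg_left hJ hmpos.le
    rw [hm] at this ⊢
    nlinarith
  refine h3.trans ?_
  have key : ∀ u v : ℝ, Real.exp u - Real.exp v ≤ (u - v) * Real.exp u := by
    intro u v
    have := Real.add_one_le_exp (v - u)
    have h := mul_le_mul_of_nonneg_left this (Real.exp_pos u).le
    rw [← Real.exp_add] at h
    ring_nf at h ⊢
    linarith
  have hx := Real.exp_pos x
  have hy := Real.exp_pos y
  have hpp : p * (1 - p) ≤ p := by nlinarith
  have hpp' : p * (1 - p) ≤ 1 - p := by nlinarith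
  have hp0 : 0 ≤ p * (1 - p) := by positivity
  rcases le_total y x with h | h
  · have h4 := mul_le_mul_of_nonneg_left (key x y) (sub_nonneg.2 h)
    have h5 := mul_le_mul_of_nonneg_left h4 hp0
    have h6 : p * (1 - p) * ((x - y) ^ 2 * Real.exp x) ≤ p * ((x - y) ^ 2 * Real.exp x) :=
      mul_le_mul_of_nonneg_right hpp (by positivity)
    have h7 : 0 ≤ (1 - p) * Real.exp y * (x - y) ^ 2 := by positivity
    rw [hm]; nlinarith
  · have h4 := mul_le_mul_of_nonneg_left (key y x) (sub_nonneg.2 h)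
    have h5 := mul_le_mul_of_nonneg_left h4 hp0
    have h6 : p * (1 - p) * ((x - y) ^ 2 * Real.exp y) ≤ (1 - p) * ((x - y) ^ 2 * Real.exp y) :=
      mul_le_mul_of_nonneg_right hpp' (by positivity)
    have h7 : 0 ≤ p * Real.exp x * (x - y) ^ 2 := by positivity
    rw [hm]; nlinarith

/-- A modified logarithmic Sobolev inequality for independent bits. -/
theorem entropy_exp_le {p : ℝ} (h0 : 0 < p) (h1 : p < 1) {N : ℕ} (F : (Fin N → Bool) → ℝ) :
    bitExp p (fun x => Real.exp (F x) * F x) -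
      bitExp p (fun x => Real.exp (F x)) * Real.log (bitExp p fun x => Real.exp (F x)) ≤
    bitExp p (fun x => Real.exp (F x) * ∑ i, bitDiff F i x ^ 2) := by
  have hq : 0 < 1 - p := by linarith
  induction N with
  | zero => simp [bitExp]
  | succ N ih =>
    rw [bitExp_fin_succ, bitExp_fin_succ (fun x => Real.exp (F x)),
      bitExp_fin_succ (fun x => _ * _)]
    set F1 : (Fin N → Bool) → ℝ := fun y => F (Fin.cons true y) with hF1
    set F0 : (Fin N → Bool) → ℝ := fun y => F (Fin.cons false y) with hF0
    set a := bitExp p (fun y => Real.exp (F1 y)) with ha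
    set b := bitExp p (fun y => Real.exp (F0 y)) with hb
    have hapos : 0 < a := bitExp_exp_pos h0 h1 _
    have hbpos : 0 < b := bitExp_exp_pos h0 h1 _
    set M := p * a + (1 - p) * b with hM
    have hMpos : 0 < M := by positivity
    have ih1 := ih F1
    have ih0 := ih F0
    have hd1 : ∀ y, ∑ i, bitDiff F i (Fin.cons true y) ^ 2 =
        (F1 y - F0 y) ^ 2 + ∑ i, bitDiff F1 i y ^ 2 := by
      intro y
      rw [Fin.sum_univ_succ]
      simp [bitDiff, hF1, hF0, Fin.cons_update]
    have hd0 : ∀ y, ∑ i, bitDiff F i (Fin.cons false y) ^ 2 =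
        (F1 y - F0 y) ^ 2 + ∑ i, bitDiff F0 i y ^ 2 := by
      intro y
      rw [Fin.sum_univ_succ]
      simp [bitDiff, hF1, hF0, Fin.cons_update]
    simp only [hd1, hd0, mul_add, bitExp_add]
    let m : (Fin N → Bool) → ℝ := fun y => p * Real.exp (F1 y) + (1 - p) * Real.exp (F0 y)
    have hmpos : ∀ y, 0 < m y := fun y => by positivity
    have hpt : bitExp p (fun y =>
        p * (Real.exp (F1 y) * (Real.log a - Real.log M) + Real.exp (F1 y) - m y * (a / M)) +
        (1 - p) * (Real.exp (F0 y) * (Real.log b - Real.log M) + Real.exp (F0 y) - m y * (b / M)))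
        ≤ bitExp p (fun y => p * (Real.exp (F1 y) * (F1 y - F0 y) ^ 2) +
          (1 - p) * (Real.exp (F0 y) * (F1 y - F0 y) ^ 2)) := by
      refine bitExp_mono h0 h1 fun y => ?_
      have t1 := log_tangent (Real.exp_pos (F1 y)) (hmpos y) hapos hMpos
      have t0 := log_tangent (Real.exp_pos (F0 y)) (hmpos y) hbpos hMpos
      have t := two_point_entropy_le h0 h1 (F1 y) (F0 y)
      rw [Real.log_exp] at t1 t0
      have t1' := mul_le_mul_of_nonneg_left t1 h0.le
      have t0' := mul_le_mul_of_nonneg_left t0 hq.le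
      simp only [m] at *
      nlinarith
    simp only [bitExp_add, bitExp_sub, bitExp_const_mul, mul_comm _ (a / M), mul_comm _ (b / M),
      mul_comm _ (Real.log a - Real.log M), mul_comm _ (Real.log b - Real.log M), m,
      ← ha, ← hb, ← hM] at hpt
    have e1 : a / M * M = a := by field_simp
    have e2 : b / M * M = b := by field_simp
    rw [e1, e2] at hpt
    have h3 := mul_le_mul_of_nonneg_left ih1 h0.le
    have h4 := mul_le_mul_of_nonneg_left ih0 hq.le
    have e3 : M * Real.log M = p * a * Real.log M + (1-p) * b * Real.log M := by rw [hM]; ring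
    rw [e3]
    nlinarith

/-- Herbst's argument: a bound on the sum of squared discrete derivatives gives a sub-Gaussian
moment generating function. -/
theorem bitExp_exp_le_fin {p : ℝ} (h0 : 0 < p) (h1 : p < 1) {N : ℕ} (F : (Fin N → Bool) → ℝ)
    {V : ℝ} (hV : ∀ x, ∑ i, bitDiff F i x ^ 2 ≤ V) {l : ℝ} (hl : 0 < l) :
    bitExp p (fun x => Real.exp (l * F x)) ≤ Real.exp (l * bitExp p F + l ^ 2 * V) := by
  set Z : ℝ → ℝ := fun s => bitExp p (fun x => Real.exp (s * F x)) with hZ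
  have hZpos : ∀ s, 0 < Z s := fun s => bitExp_exp_pos h0 h1 _
  have hZd : ∀ s, HasDerivAt Z (bitExp p (fun x => Real.exp (s * F x) * F x)) s := by
    intro s
    simp only [hZ, bitExp]
    refine HasDerivAt.fun_sum fun x _ => ?_
    have := ((hasDerivAt_id s).mul_const (F x)).exp.const_mul (∏ i, bitWeight p (x i))
    simpa using this
  have hent : ∀ s, s * bitExp p (fun x => Real.exp (s * F x) * F x) - Z s * Real.log (Z s) ≤
      s ^ 2 * V * Z s := by
    intro s
    have h := entropy_exp_le h0 h1 (fun x => s * F x)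
    have e1 : bitExp p (fun x => Real.exp (s * F x) * (s * F x)) =
        s * bitExp p (fun x => Real.exp (s * F x) * F x) := by
      rw [← bitExp_const_mul]; congr 1; funext x; ring
    rw [e1] at h
    refine h.trans ?_
    rw [hZ, ← bitExp_const_mul]
    refine bitExp_mono h0 h1 fun x => ?_
    have e2 : ∑ i, bitDiff (fun x => s * F x) i x ^ 2 = s ^ 2 * ∑ i, bitDiff F i x ^ 2 := by
      rw [Finset.mul_sum]; refine Finset.sum_congr rfl fun i _ => ?_
      simp only [bitDiff]; ring
    rw [e2]
    have := mul_le_mul_of_nonneg_left (hV x) (show 0 ≤ s ^ 2 * Real.exp (s * F x) by positivity)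
    nlinarith
  set ψ : ℝ → ℝ := fun s => Real.log (Z s) with hψ
  have hψd : ∀ s, HasDerivAt ψ (bitExp p (fun x => Real.exp (s * F x) * F x) / Z s) s :=
    fun s => (hZd s).log (hZpos s).ne'
  have hψ0 : ψ 0 = 0 := by simp [hψ, hZ, bitExp_const]
  have hd0 : HasDerivAt ψ (bitExp p F) 0 := by
    have := hψd 0
    have e : Z 0 = 1 := by simp [hZ, bitExp_const]
    simpa [e] using this
  let H : ℝ → ℝ := fun s => ψ s / s - s * V
  have hH : AntitoneOn H (Set.Ioi 0) := by
    have hder : ∀ s ∈ Set.Ioi (0:ℝ), HasDerivAt H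
        ((bitExp p (fun x => Real.exp (s * F x) * F x) / Z s * s - ψ s * 1) / s ^ 2 - 1 * V) s := by
      intro s hs
      exact ((hψd s).div (hasDerivAt_id s) (ne_of_gt hs)).sub ((hasDerivAt_id s).mul_const V)
    refine antitoneOn_of_deriv_nonpos (convex_Ioi 0)
      (fun s hs => (hder s hs).continuousAt.continuousWithinAt) ?_ ?_
    · intro s hs
      rw [interior_Ioi] at hs
      exact (hder s hs).differentiableAt.differentiableWithinAt
    · intro s hs
      rw [interior_Ioi] at hs
      rw [(hder s hs).deriv]
      have hs' : (0:ℝ) < s := hs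
      have h := hent s
      have hz := hZpos s
      rw [sub_nonpos, div_le_iff₀ (by positivity)]
      have e : bitExp p (fun x => Real.exp (s * F x) * F x) / Z s * s - ψ s * 1 =
          (s * bitExp p (fun x => Real.exp (s * F x) * F x) - Z s * Real.log (Z s)) / Z s := by
        simp only [hψ]; field_simp
      rw [e, div_le_iff₀ hz]
      nlinarith
  have hlim : Tendsto H (𝓝[>] 0) (𝓝 (bitExp p F)) := by
    have h1 : Tendsto (fun s => ψ s / s) (𝓝[>] 0) (𝓝 (bitExp p F)) := by
      have := hd0.tendsto_slope_zero_right
      refine this.congr' ?_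
      filter_upwards with s
      simp [hψ0, div_eq_inv_mul]
    have h2 : Tendsto (fun s : ℝ => s * V) (𝓝[>] 0) (𝓝 0) := by
      have : Tendsto (fun s : ℝ => s * V) (𝓝 0) (𝓝 (0 * V)) := tendsto_id.mul_const V
      rw [zero_mul] at this
      exact this.mono_left nhdsWithin_le_nhds
    simpa using h1.sub h2
  have hfin : H l ≤ bitExp p F := by
    refine ge_of_tendsto hlim ?_
    filter_upwards [Ioo_mem_nhdsGT hl] with s hs
    exact hH hs.1 hl hs.2.le
  have : ψ l ≤ l * bitExp p F + l ^ 2 * V := by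
    have h5 : ψ l / l ≤ bitExp p F + l * V := by simp only [H] at hfin; linarith
    rw [div_le_iff₀ hl] at h5
    nlinarith
  exact (Real.log_le_iff_le_exp (hZpos l)).1 this

theorem bitExp_exp_le {ι : Type*} [Fintype ι] [DecidableEq ι] {p : ℝ} (h0 : 0 < p) (h1 : p < 1)
    (F : (ι → Bool) → ℝ) {V : ℝ} (hV : ∀ x, ∑ i, bitDiff F i x ^ 2 ≤ V) {l : ℝ} (hl : 0 < l) :
    bitExp p (fun x => Real.exp (l * F x)) ≤ Real.exp (l * bitExp p F + l ^ 2 * V) := by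
  let e := (Fintype.equivFin ι).symm
  rw [bitExp_reindex e F, bitExp_reindex e (fun x => Real.exp (l * F x))]
  refine bitExp_exp_le_fin h0 h1 (fun x => F (x ∘ e.symm)) (fun x => ?_) hl
  refine le_trans (le_of_eq ?_) (hV (x ∘ e.symm))
  refine Fintype.sum_equiv e _ _ fun i => ?_
  simp only [bitDiff]
  congr 3 <;> · funext j; simp [Function.update_apply, Equiv.symm_apply_eq]

/-- Sub-Gaussian lower tail for functions of independent bits with bounded gradient. -/
theorem bitProb_lower_tail {ι : Type*} [Fintype ι] [DecidableEq ι] {p : ℝ} (h0 : 0 < p)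
    (h1 : p < 1) (F : (ι → Bool) → ℝ) {V : ℝ} (hVpos : 0 < V)
    (hV : ∀ x, ∑ i, bitDiff F i x ^ 2 ≤ V) {u : ℝ} (hu : 0 < u) :
    bitProb p (fun x => F x ≤ bitExp p F - u) ≤ Real.exp (-(u ^ 2 / (4 * V))) := by
  set l := u / (2 * V) with hl
  have hlpos : 0 < l := by positivity
  have hV' : ∀ x, ∑ i, bitDiff (fun x => -F x) i x ^ 2 ≤ V := by
    intro x
    refine le_trans (le_of_eq ?_) (hV x)
    refine Finset.sum_congr rfl fun i _ => ?_
    simp only [bitDiff]; ring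
  have h2 := bitExp_exp_le h0 h1 (fun x => -F x) hV' hlpos
  have h3 := bitProb_le_exp h0 h1 (fun x => l * -F x) (l * (u - bitExp p F))
  have e : bitExp p (fun x => -F x) = - bitExp p F := by
    have := bitExp_const_mul (p := p) (-1) F
    simpa using this
  rw [e] at h2
  refine (bitProb_mono h0 h1 fun x hx => ?_).trans (h3.trans
    ((mul_le_mul_of_nonneg_left h2 (Real.exp_pos _).le).trans (le_of_eq ?_)))
  · exact mul_le_mul_of_nonneg_left (by linarith) hlpos.le
  · rw [← Real.exp_add]
    congr 1
    rw [hl]; field_simp; ring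

/-- The rate constant of the lower tail. -/
def rateConst (p : ℝ) : ℝ :=
  if p = 1 / 2 then 1 else Real.log (p / (1 - p)) / (2 * (2 * p - 1))

/-- Relative entropy between Bernoulli distributions with parameters `r` and `p`. -/
def bitKL (r p : ℝ) : ℝ :=
  r * (Real.log r - Real.log p) + (1 - r) * (Real.log (1 - r) - Real.log (1 - p))

lemma mul_sinh_le_mul_sinh {u v : ℝ} (hu : 0 ≤ u) (huv : u ≤ v) :
    v * Real.sinh u ≤ u * Real.sinh v := by
  let h : ℝ → ℝ := fun x => u * Real.sinh x - x * Real.sinh u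
  have hd : ∀ x, HasDerivAt h (u * Real.cosh x - 1 * Real.sinh u) x := fun x =>
    ((Real.hasDerivAt_sinh x).const_mul u).sub ((hasDerivAt_id x).mul_const _)
  have hbase : Real.sinh u ≤ u * Real.cosh u := by
    let g : ℝ → ℝ := fun x => x * Real.cosh x - Real.sinh x
    have hg : ∀ x, HasDerivAt g (1 * Real.cosh x + x * Real.sinh x - Real.cosh x) x := fun x =>
      ((hasDerivAt_id x).mul (Real.hasDerivAt_cosh x)).sub (Real.hasDerivAt_sinh x)
    have hm : MonotoneOn g (Set.Ici 0) := by
      refine monotoneOn_of_deriv_nonneg (convex_Ici 0)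
        (fun x _ => (hg x).continuousAt.continuousWithinAt)
        (fun x _ => (hg x).differentiableAt.differentiableWithinAt) fun x hx => ?_
      rw [interior_Ici] at hx
      rw [(hg x).deriv]
      have := mul_nonneg (le_of_lt hx) (Real.sinh_nonneg_iff.2 (le_of_lt hx))
      linarith
    have := hm Set.self_mem_Ici hu hu
    simp only [g, zero_mul, Real.sinh_zero] at this
    linarith
  have hm : MonotoneOn h (Set.Ici u) := by
    refine monotoneOn_of_deriv_nonneg (convex_Ici u)
      (fun x _ => (hd x).continuousAt.continuousWithinAt)
      (fun x _ => (hd x).differentiableAt.differentiableWithinAt) fun x hx => ?_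
    rw [interior_Ici] at hx
    rw [(hd x).deriv]
    have hx' : u < x := hx
    have h1 : Real.cosh u ≤ Real.cosh x := by
      rw [Real.cosh_le_cosh, abs_of_nonneg hu, abs_of_nonneg (hu.trans hx'.le)]; exact hx'.le
    have := mul_le_mul_of_nonneg_left h1 hu
    linarith
  have := hm Set.self_mem_Ici huv huv
  simp only [h] at this
  linarith

/-- `log (cosh √y)` lies below its tangent line at `y = b ^ 2`. -/
lemma cosh_le_cosh_mul_exp {b : ℝ} (hb : 0 < b) (x : ℝ) :
    Real.cosh x ≤ Real.cosh b *
      Real.exp (Real.sinh b / (2 * b * Real.cosh b) * (x ^ 2 - b ^ 2)) := by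
  set κ := Real.sinh b / (2 * b * Real.cosh b) with hκ
  have hcb := Real.cosh_pos b
  let φ : ℝ → ℝ := fun x => Real.log (Real.cosh x) - κ * x ^ 2
  have hd : ∀ x, HasDerivAt φ (Real.sinh x / Real.cosh x - κ * (2 * x)) x := by
    intro x
    have h1 := (Real.hasDerivAt_cosh x).log (Real.cosh_pos x).ne'
    have h2 := (hasDerivAt_pow 2 x).const_mul κ
    exact (h1.sub h2).congr_deriv (by simp)
  have hform : ∀ x, Real.sinh x / Real.cosh x - κ * (2 * x) =
      ((b - x) * Real.sinh (b + x) - (b + x) * Real.sinh (b - x)) /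
        (2 * b * Real.cosh b * Real.cosh x) := by
    intro x
    have hcx := Real.cosh_pos x
    rw [hκ, Real.sinh_add, Real.sinh_sub]
    field_simp
    ring
  have hmain : ∀ y, 0 ≤ y → φ y ≤ φ b := by
    intro y hy
    rcases le_total y b with h | h
    · have hm : MonotoneOn φ (Set.Icc 0 b) := by
        refine monotoneOn_of_deriv_nonneg (convex_Icc 0 b)
          (fun x _ => (hd x).continuousAt.continuousWithinAt)
          (fun x _ => (hd x).differentiableAt.differentiableWithinAt) fun x hx => ?_
        rw [interior_Icc] at hx
        rw [(hd x).deriv, hform]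
        have hcx := Real.cosh_pos x
        refine div_nonneg ?_ (by positivity)
        have := mul_sinh_le_mul_sinh (u := b - x) (v := b + x) (by linarith [hx.2])
          (by linarith [hx.1])
        linarith
      exact hm ⟨hy, h⟩ ⟨hb.le, le_rfl⟩ h
    · have hm : AntitoneOn φ (Set.Ici b) := by
        refine antitoneOn_of_deriv_nonpos (convex_Ici b)
          (fun x _ => (hd x).continuousAt.continuousWithinAt)
          (fun x _ => (hd x).differentiableAt.differentiableWithinAt) fun x hx => ?_
        rw [interior_Ici] at hx
        have hx' : b < x := hx
        rw [(hd x).deriv, hform]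
        have hcx := Real.cosh_pos x
        refine div_nonpos_of_nonpos_of_nonneg ?_ (by positivity)
        have := mul_sinh_le_mul_sinh (u := x - b) (v := b + x) (by linarith)
          (by linarith)
        rw [← neg_sub x b, Real.sinh_neg]
        linarith
      exact hm Set.self_mem_Ici h h
  have h := hmain |x| (abs_nonneg x)
  simp only [φ, Real.cosh_abs, sq_abs] at h
  rw [← Real.log_le_log_iff (Real.cosh_pos x) (by positivity),
    Real.log_mul hcb.ne' (Real.exp_pos _).ne', Real.log_exp]
  linarith

lemma rateConst_pos {p : ℝ} (h0 : 1 / 2 ≤ p) (h1 : p < 1) : 0 < rateConst p := by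
  unfold rateConst
  split_ifs with h
  · norm_num
  · have : 1 / 2 < p := lt_of_le_of_ne h0 (Ne.symm h)
    have h2 : 1 < p / (1 - p) := by rw [one_lt_div (by linarith)]; linarith
    exact div_pos (Real.log_pos h2) (by linarith)

/-- The Kearns–Saul inequality: the optimal sub-Gaussian bound for a centred Bernoulli bit. -/
theorem kearns_saul {p : ℝ} (h0 : 1 / 2 ≤ p) (h1 : p < 1) (θ : ℝ) :
    p * Real.exp (θ * (1 - p)) + (1 - p) * Real.exp (θ * (0 - p)) ≤
      Real.exp (θ ^ 2 / (8 * rateConst p)) := by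
  unfold rateConst
  split_ifs with h
  · subst h
    have := Real.cosh_le_exp_half_sq (θ / 2)
    rw [Real.cosh_eq] at this
    convert this using 1
    · ring_nf
    · congr 1; ring
  · have hp : 1 / 2 < p := lt_of_le_of_ne h0 (Ne.symm h)
    have hq : 0 < 1 - p := by linarith
    have h2 : 1 < p / (1 - p) := by rw [one_lt_div hq]; linarith
    set b := Real.log (p / (1 - p)) / 2 with hb
    have hbpos : 0 < b := by have := Real.log_pos h2; positivity
    have hcb := Real.cosh_pos b
    have he2 : Real.exp b * Real.exp b = p / (1 - p) := by
      rw [← Real.exp_add, hb, add_halves, Real.exp_log (by linarith)]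
    have hepos := Real.exp_pos b
    have hpb : p * (2 * Real.cosh b) = Real.exp b := by
      have e : p = Real.exp b * Real.exp b * (1 - p) := by rw [he2]; field_simp
      rw [Real.cosh_eq, Real.exp_neg]
      field_simp
      nlinarith
    have hqb : (1 - p) * (2 * Real.cosh b) = Real.exp (-b) := by
      have : 2 * Real.cosh b = Real.exp b + Real.exp (-b) := by rw [Real.cosh_eq]; ring
      linarith
    have htanh : (2 * p - 1) * Real.cosh b = Real.sinh b := by
      rw [Real.sinh_eq]; linarith
    set x := θ / 2 + b with hx
    have hθ : θ = 2 * (x - b) := by rw [hx]; ring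
    have key := cosh_le_cosh_mul_exp hbpos x
    have hlhs : p * Real.exp (θ * (1 - p)) + (1 - p) * Real.exp (θ * (0 - p)) =
        Real.exp (-((2 * p - 1) * (x - b))) * (Real.cosh x / Real.cosh b) := by
      have e1 : p = Real.exp b / (2 * Real.cosh b) := by rw [← hpb]; field_simp
      have e2 : 1 - p = Real.exp (-b) / (2 * Real.cosh b) := by rw [← hqb]; field_simp
      have : p * Real.exp (θ * (1 - p)) + (1 - p) * Real.exp (θ * (0 - p)) =
        (Real.exp b * Real.exp (θ * (1 - p)) + Real.exp (-b) * Real.exp (θ * (0 - p))) /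
          (2 * Real.cosh b) := by
        rw [← hpb, ← hqb]; field_simp
      rw [this, Real.cosh_eq x, ← Real.exp_add, ← Real.exp_add, hθ]
      have e3 : b + 2 * (x - b) * (1 - p) = -((2 * p - 1) * (x - b)) + x := by ring
      have e4 : -b + 2 * (x - b) * (0 - p) = -((2 * p - 1) * (x - b)) + -x := by ring
      rw [e3, e4, Real.exp_add (-((2 * p - 1) * (x - b))) x,
        Real.exp_add (-((2 * p - 1) * (x - b))) (-x)]
      field_simp
    rw [hlhs]
    have hdiv : Real.cosh x / Real.cosh b ≤
        Real.exp (Real.sinh b / (2 * b * Real.cosh b) * (x ^ 2 - b ^ 2)) := by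
      rw [div_le_iff₀ hcb]; linarith
    refine (mul_le_mul_of_nonneg_left hdiv (Real.exp_pos _).le).trans (le_of_eq ?_)
    rw [← Real.exp_add]
    congr 1
    have hlog : Real.log (p / (1 - p)) = 2 * b := by rw [hb]; ring
    have h2p : 2 * p - 1 ≠ 0 := by linarith
    rw [hlog, ← htanh, hθ]
    field_simp
    ring

lemma bitKL_antitone {p q r : ℝ} (hq : 0 < q) (hqr : q ≤ r) (hrp : r ≤ p) (hp : p < 1) :
    bitKL r p ≤ bitKL q p := by
  have t1 := log_tangent hq one_pos (hq.trans_le hqr) one_pos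
  have t2 := log_tangent (a := 1 - q) (A := 1 - r) (by linarith) one_pos (by linarith) one_pos
  simp only [Real.log_one, sub_zero, div_one, one_mul] at t1 t2
  have h1 : Real.log r ≤ Real.log p := Real.log_le_log (by linarith) hrp
  have h2 : Real.log (1 - p) ≤ Real.log (1 - r) := Real.log_le_log (by linarith) (by linarith)
  unfold bitKL
  nlinarith

lemma bitKL_le_sq {p r : ℝ} (h0 : 0 < p) (h1 : p < 1) (hr0 : 0 ≤ r) (hr1 : r ≤ 1) :
    bitKL r p ≤ (r - p) ^ 2 / (p * (1 - p)) := by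
  have hq : 0 < 1 - p := by linarith
  have key : ∀ x y : ℝ, 0 ≤ x → 0 < y → x * (Real.log x - Real.log y) ≤ x * (x / y - 1) := by
    intro x y hx hy
    rcases hx.eq_or_lt with rfl | hx
    · simp
    · rw [← Real.log_div hx.ne' hy.ne']
      exact mul_le_mul_of_nonneg_left (Real.log_le_sub_one_of_pos (by positivity)) hx.le
  have k1 := key r p hr0 h0
  have k2 := key (1 - r) (1 - p) (by linarith) hq
  unfold bitKL
  refine (add_le_add k1 k2).trans (le_of_eq ?_)
  field_simp
  ring

/-- The rate constant is approached by optimizing over the density of a planted clique-like set. -/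
lemma exists_bitKL_le {p : ℝ} (h0 : 1 / 2 ≤ p) (h1 : p < 1) {ε : ℝ} (hε : 0 < ε) :
    ∃ q, 0 < q ∧ q < p ∧ bitKL q p ≤ 2 * (p - q) ^ 2 * (rateConst p + ε) := by
  unfold rateConst
  split_ifs with h
  · subst h
    set x := min (1 / 2) (ε / 4) with hx
    have hx0 : 0 < x := by positivity
    have hx1 : x ≤ 1 / 2 := min_le_left _ _
    have hx2 : x ≤ ε / 4 := min_le_right _ _
    refine ⟨1 / 2 - x / 2, by linarith, by linarith, ?_⟩
    have b1 := Real.abs_log_sub_add_sum_range_le (x := x) (by rw [abs_of_pos hx0]; linarith) 2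
    have b2 := Real.abs_log_sub_add_sum_range_le (x := -x)
      (by rw [abs_neg, abs_of_pos hx0]; linarith) 2
    rw [abs_neg, abs_of_pos hx0] at b2
    rw [abs_of_pos hx0] at b1
    have hdiv : x ^ (2 + 1) / (1 - x) ≤ 2 * x ^ 3 := by
      rw [div_le_iff₀ (by linarith)]
      have := mul_le_mul_of_nonneg_left (show 1 ≤ 2 * (1 - x) by linarith) (pow_pos hx0 3).le
      norm_num
      linarith
    have c1 := (abs_le.1 (b1.trans hdiv)).2
    have c2 := (abs_le.1 (b2.trans hdiv)).2
    simp only [Finset.sum_range_succ, Finset.sum_range_zero] at c1 c2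
    norm_num at c1 c2
    have e1 : Real.log (1 / 2 - x / 2) - Real.log (1 / 2) = Real.log (1 - x) := by
      rw [← Real.log_div (by linarith) (by norm_num)]; congr 1; ring
    have e2 : Real.log (1 - (1 / 2 - x / 2)) - Real.log (1 - 1 / 2) = Real.log (1 + x) := by
      rw [← Real.log_div (by linarith) (by norm_num)]; congr 1; ring
    unfold bitKL
    rw [e1, e2]
    have d1 := mul_le_mul_of_nonneg_left (show Real.log (1 - x) ≤ 2 * x ^ 3 - (x + x ^ 2 / 2) by
      linarith) (show 0 ≤ 1 / 2 - x / 2 by linarith)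
    have d2 := mul_le_mul_of_nonneg_left (show Real.log (1 + x) ≤ 2 * x ^ 3 - (-x + x ^ 2 / 2) by
      linarith) (show 0 ≤ 1 - (1 / 2 - x / 2) by linarith)
    have d3 := mul_le_mul_of_nonneg_left hx2 (show 0 ≤ 2 * x ^ 2 by positivity)
    nlinarith
  · have hp : 1 / 2 < p := lt_of_le_of_ne h0 (Ne.symm h)
    refine ⟨1 - p, by linarith, by linarith, ?_⟩
    have e : bitKL (1 - p) p = (2 * p - 1) * Real.log (p / (1 - p)) := by
      rw [Real.log_div (by linarith) (by linarith)]
      unfold bitKL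
      rw [sub_sub_cancel]; ring
    have h2p : 0 < 2 * p - 1 := by linarith
    rw [e]
    have : 2 * (p - (1 - p)) ^ 2 * (Real.log (p / (1 - p)) / (2 * (2 * p - 1)) + ε) =
        (2 * p - 1) * Real.log (p / (1 - p)) + 2 * (2 * p - 1) ^ 2 * ε := by
      field_simp; ring
    rw [this]
    have : 0 < 2 * (2 * p - 1) ^ 2 * ε := by positivity
    linarith

open Nat in
lemma factorial_mul_pow_le (a j : ℕ) : a ! * a ^ j ≤ j ! * a ^ a := by
  rcases le_total a j with h | h
  · obtain ⟨i, rfl⟩ := Nat.exists_eq_add_of_le h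
    have h1 : a ! * a ^ i ≤ (a + i)! :=
      (Nat.mul_le_mul_left _ (Nat.pow_le_pow_left (Nat.le_succ a) i)).trans
        Nat.factorial_mul_pow_le_factorial
    calc a ! * a ^ (a + i) = a ! * a ^ i * a ^ a := by ring
      _ ≤ _ := Nat.mul_le_mul_right _ h1
  · obtain ⟨i, rfl⟩ := Nat.exists_eq_add_of_le h
    have h1 := Nat.factorial_mul_descFactorial (n := j + i) (k := i) (by omega)
    rw [Nat.add_sub_cancel] at h1
    have h2 := Nat.descFactorial_le_pow (j + i) i
    calc (j + i)! * (j + i) ^ j = j ! * (j + i).descFactorial i * (j + i) ^ j := by rw [h1]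
      _ ≤ j ! * (j + i) ^ i * (j + i) ^ j := by gcongr
      _ = _ := by ring

/-- The mode of a binomial distribution has probability at least `1 / (N + 1)`. -/
lemma add_pow_le_choose (a b : ℕ) :
    (a + b) ^ (a + b) ≤ (a + b + 1) * ((a + b).choose a * a ^ a * b ^ b) := by
  rw [add_pow]
  refine (Finset.sum_le_card_nsmul _ _ ((a + b).choose a * a ^ a * b ^ b) ?_).trans (by simp)
  intro j hj
  have hj' : j ≤ a + b := by simpa [Nat.lt_succ_iff] using hj
  obtain ⟨l, hl⟩ := Nat.exists_eq_add_of_le hj'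
  have hl' : a + b - j = l := by omega
  rw [hl']
  have h1 := Nat.choose_mul_factorial_mul_factorial (n := a + b) (k := a) (by omega)
  have h2 := Nat.choose_mul_factorial_mul_factorial (n := a + b) (k := j) hj'
  rw [Nat.add_sub_cancel_left] at h1
  rw [hl'] at h2
  have h3 := Nat.mul_le_mul (factorial_mul_pow_le a j) (factorial_mul_pow_le b l)
  have hpos : 0 < j.factorial * l.factorial * (a.factorial * b.factorial) := by positivity
  refine Nat.le_of_mul_le_mul_left ?_ hpos
  calc j.factorial * l.factorial * (a.factorial * b.factorial) *
      (a ^ j * b ^ l * (a + b).choose j)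
      = ((a + b).choose j * j.factorial * l.factorial) *
        (a.factorial * a ^ j * (b.factorial * b ^ l)) := by ring
    _ ≤ ((a + b).choose j * j.factorial * l.factorial) *
        (j.factorial * a ^ a * (l.factorial * b ^ b)) := Nat.mul_le_mul_left _ h3
    _ = ((a + b).choose a * a.factorial * b.factorial) *
        (j.factorial * a ^ a * (l.factorial * b ^ b)) := by rw [h2, h1]
    _ = _ := by ring

lemma exp_mul_log_pow {a : ℕ} {N p : ℝ} (hN : 0 < N) (hp : 0 < p) :
    Real.exp (-(N * ((a / N) * (Real.log (a / N) - Real.log p)))) * (a : ℝ) ^ a =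
      N ^ a * p ^ a := by
  rcases Nat.eq_zero_or_pos a with rfl | ha
  · simp
  · have ha' : (0:ℝ) < a := by exact_mod_cast ha
    have e : -(N * ((a / N) * (Real.log (a / N) - Real.log p))) = a * Real.log (N * p / a) := by
      rw [Real.log_div (by positivity) (by positivity), Real.log_div (by positivity)
        (by positivity), Real.log_mul (by positivity) (by positivity)]
      field_simp
      ring
    rw [e, ← Real.log_pow, Real.exp_log (by positivity), ← mul_pow, ← mul_pow]
    congr 1
    field_simp

/-- A lower bound on binomial probabilities in terms of relative entropy. -/
lemma exp_bitKL_le_choose {p : ℝ} (h0 : 0 < p) (h1 : p < 1) {N a : ℕ} (hN : 0 < N)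
    (ha : a ≤ N) :
    Real.exp (-(N * bitKL (a / N) p)) ≤
      (N + 1) * (N.choose a * p ^ a * (1 - p) ^ (N - a)) := by
  obtain ⟨b, rfl⟩ := Nat.exists_eq_add_of_le ha
  rw [Nat.add_sub_cancel_left]
  have hN' : (0:ℝ) < ((a + b : ℕ) : ℝ) := by exact_mod_cast hN
  set N : ℝ := ((a + b : ℕ) : ℝ) with hNdef
  have hb : 1 - (a:ℝ) / N = b / N := by
    field_simp; rw [hNdef]; push_cast; ring
  have ea := exp_mul_log_pow (a := a) hN' h0
  have eb := exp_mul_log_pow (a := b) hN' (show 0 < 1 - p by linarith)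
  have hm : N ^ (a + b) ≤ (N + 1) * ((a + b).choose a * (a:ℝ) ^ a * (b:ℝ) ^ b) := by
    rw [hNdef]; exact_mod_cast add_pow_le_choose a b
  have hab : (0:ℝ) < (a:ℝ) ^ a * (b:ℝ) ^ b := by
    have hx : ∀ c : ℕ, (0:ℝ) < (c:ℝ) ^ c := by
      intro c; rcases Nat.eq_zero_or_pos c with rfl | hc
      · simp
      · have : (0:ℝ) < c := by exact_mod_cast hc
        positivity
    exact mul_pos (hx a) (hx b)
  refine le_of_mul_le_mul_right ?_ hab
  have e1 : Real.exp (-(N * bitKL (a / N) p)) * ((a:ℝ) ^ a * (b:ℝ) ^ b) =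
      (N ^ a * p ^ a) * (N ^ b * (1 - p) ^ b) := by
    rw [← ea, ← eb]
    unfold bitKL
    rw [hb, mul_add, neg_add, Real.exp_add]
    ring
  rw [e1]
  calc N ^ a * p ^ a * (N ^ b * (1 - p) ^ b) = N ^ (a + b) * (p ^ a * (1 - p) ^ b) := by ring
    _ ≤ (N + 1) * ((a + b).choose a * (a:ℝ) ^ a * (b:ℝ) ^ b) * (p ^ a * (1 - p) ^ b) :=
      mul_le_mul_of_nonneg_right hm (mul_nonneg (pow_nonneg h0.le _)
        (pow_nonneg (by linarith) _))
    _ = _ := by ring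

/-- The potential edge joining two distinct vertices. -/
def edge {n : ℕ} (a b : Fin n) (h : a ≠ b) : EdgeIdx n :=
  if h' : a < b then ⟨(a, b), h'⟩ else ⟨(b, a), lt_of_le_of_ne (not_lt.1 h') h.symm⟩

/-- The symmetric matrix with zero diagonal and given entries on the edges. -/
def edgeMatrix {n : ℕ} (w : EdgeIdx n → ℝ) : Matrix (Fin n) (Fin n) ℝ :=
  Matrix.of fun a b => if h : a = b then 0 else w (edge a b h)

/-- The adjacency matrix of `g`, centred at density `p`. -/
def centered {n : ℕ} (p : ℝ) (g : EdgeIdx n → Bool) : Matrix (Fin n) (Fin n) ℝ :=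
  edgeMatrix fun e => (if g e then 1 else 0) - p

section EdgeMatrix

variable {n : ℕ}

lemma edge_comm (a b : Fin n) (h : a ≠ b) : edge a b h = edge b a h.symm := by
  unfold edge
  rcases lt_or_gt_of_ne h with h' | h'
  · simp [h', h'.not_gt]
  · simp [h', h'.not_gt]

lemma edge_of_lt (e : EdgeIdx n) : edge e.1.1 e.1.2 e.2.ne = e := by
  unfold edge
  simp [e.2]

lemma edge_val (a b : Fin n) (h : a ≠ b) :
    (edge a b h).1 = (a, b) ∨ (edge a b h).1 = (b, a) := by
  unfold edge
  split_ifs <;> simp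

lemma edge_inj {a b c d : Fin n} {h : a ≠ b} {h' : c ≠ d} (he : edge a b h = edge c d h') :
    (a = c ∧ b = d) ∨ (a = d ∧ b = c) := by
  have he' := congrArg Subtype.val he
  rcases edge_val a b h with h1 | h1 <;> rcases edge_val c d h' with h2 | h2 <;>
    rw [h1, h2] at he' <;> simp only [Prod.mk.injEq] at he' <;> tauto

lemma edge_ne {a b c : Fin n} (hab : a ≠ b) (hbc : b ≠ c) (hca : c ≠ a) :
    edge a b hab ≠ edge b c hbc := by
  intro h
  rcases edge_inj h with ⟨h1, _⟩ | ⟨h1, _⟩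
  · exact hab h1
  · exact hca h1.symm

lemma edgeMatrix_self (w : EdgeIdx n → ℝ) (a : Fin n) : edgeMatrix w a a = 0 := by
  simp [edgeMatrix]

lemma edgeMatrix_apply (w : EdgeIdx n → ℝ) {a b : Fin n} (h : a ≠ b) :
    edgeMatrix w a b = w (edge a b h) := by
  simp [edgeMatrix, h]

lemma edgeMatrix_comm (w : EdgeIdx n → ℝ) (a b : Fin n) :
    edgeMatrix w a b = edgeMatrix w b a := by
  rcases eq_or_ne a b with rfl | h
  · rfl
  · rw [edgeMatrix_apply w h, edgeMatrix_apply w h.symm, edge_comm]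

lemma edgeMatrix_isHermitian (w : EdgeIdx n → ℝ) : (edgeMatrix w).IsHermitian := by
  ext a b
  simpa using edgeMatrix_comm w b a

lemma adjOf_eq_edgeMatrix (g : EdgeIdx n → Bool) :
    adjOf g = edgeMatrix fun e => if g e then 1 else 0 := by
  ext a b
  rcases lt_trichotomy a b with h | rfl | h
  · simp [adjOf, edgeMatrix, edge, h, h.ne]
  · simp [adjOf, edgeMatrix]
  · simp [adjOf, edgeMatrix, edge, h, h.ne', h.not_gt]

lemma sum_sum_eq_sum_edge (H : Fin n → Fin n → ℝ) (hH : ∀ a, H a a = 0) :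
    ∑ a, ∑ b, H a b = ∑ e : EdgeIdx n, (H e.1.1 e.1.2 + H e.1.2 e.1.1) := by
  have h1 : ∀ K : Fin n → Fin n → ℝ, ∑ e : EdgeIdx n, K e.1.1 e.1.2 =
      ∑ a, ∑ b, if a < b then K a b else 0 := by
    intro K
    rw [← Fintype.sum_prod_type' (f := fun a b => if a < b then K a b else 0),
      ← Finset.sum_filter]
    exact (Finset.sum_subtype (Finset.univ.filter fun q : Fin n × Fin n => q.1 < q.2) (by simp)
      (fun q => K q.1 q.2)).symm
  rw [Finset.sum_add_distrib, h1, h1 (fun a b => H b a)]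
  conv_rhs => rw [add_comm, Finset.sum_comm]
  rw [← Finset.sum_add_distrib]
  refine Finset.sum_congr rfl fun a _ => ?_
  rw [← Finset.sum_add_distrib]
  refine Finset.sum_congr rfl fun b _ => ?_
  rcases lt_trichotomy a b with h | rfl | h
  · simp [h, h.not_gt]
  · simp [hH]
  · simp [h, h.not_gt]

lemma sum_edgeMatrix_mul (w : EdgeIdx n → ℝ) (B : Matrix (Fin n) (Fin n) ℝ) :
    ∑ a, ∑ b, edgeMatrix w a b * B a b = ∑ e, w e * (B e.1.1 e.1.2 + B e.1.2 e.1.1) := by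
  rw [sum_sum_eq_sum_edge _ (fun a => by simp [edgeMatrix_self])]
  refine Finset.sum_congr rfl fun e _ => ?_
  rw [edgeMatrix_comm w e.1.2, edgeMatrix_apply w e.2.ne, edge_of_lt]
  ring

lemma sum_edgeMatrix (w : EdgeIdx n → ℝ) :
    ∑ a, ∑ b, edgeMatrix w a b = 2 * ∑ e, w e := by
  have := sum_edgeMatrix_mul w (Matrix.of fun _ _ => 1)
  simp only [Matrix.of_apply, mul_one] at this
  rw [this, Finset.mul_sum]
  exact Finset.sum_congr rfl fun e _ => by ring

lemma card_edgeIdx (n : ℕ) : (Fintype.card (EdgeIdx n) : ℝ) = n * (n - 1) / 2 := by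
  have h := sum_edgeMatrix (n := n) (fun _ => 1)
  simp only [Finset.sum_const, Finset.card_univ, nsmul_eq_mul, mul_one] at h
  have h2 : ∀ a b : Fin n, edgeMatrix (fun _ => (1:ℝ)) a b = 1 - if a = b then 1 else 0 := by
    intro a b; by_cases hab : a = b <;> simp [edgeMatrix, hab]
  simp only [h2, Finset.sum_sub_distrib, Finset.sum_ite_eq, Finset.mem_univ, if_true,
    Finset.sum_const, Finset.card_univ, Fintype.card_fin, nsmul_eq_mul, mul_one] at h
  linarith

lemma trace_cube (A : Matrix (Fin n) (Fin n) ℝ) :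
    (A * A * A).trace = ∑ a, ∑ b, ∑ c, A a b * A b c * A c a := by
  simp only [Matrix.trace, Matrix.diag, Matrix.mul_apply, Finset.sum_mul]
  exact Finset.sum_congr rfl fun a _ => Finset.sum_comm

/-- Expansion of the triangle count of a weighted graph around the constant density `p`. -/
lemma trace_cube_expand (w : EdgeIdx n → ℝ) (p : ℝ) :
    (edgeMatrix w * edgeMatrix w * edgeMatrix w).trace =
      p ^ 3 * (n * (n - 1) * (n - 2)) +
      3 * p ^ 2 * (n - 2) * (∑ a, ∑ b, edgeMatrix (fun e => w e - p) a b) +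
      3 * p * ((∑ a, (∑ b, edgeMatrix (fun e => w e - p) a b) ^ 2) -
        ∑ a, ∑ b, edgeMatrix (fun e => w e - p) a b ^ 2) +
      (edgeMatrix (fun e => w e - p) * edgeMatrix (fun e => w e - p) *
        edgeMatrix (fun e => w e - p)).trace := by
  set Y := edgeMatrix (fun e => w e - p) with hY
  let J : Matrix (Fin n) (Fin n) ℝ := Matrix.of fun _ _ => 1
  have hYs : ∀ a b, Y a b = Y b a := edgeMatrix_comm _
  have hX : edgeMatrix w = Y + p • (J - 1) := by
    ext a b
    rcases eq_or_ne a b with rfl | h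
    · simp [hY, edgeMatrix_self, J]
    · simp [hY, edgeMatrix_apply _ h, J, h]
  have hJJ : J * J = (n : ℝ) • J := by
    ext a b; simp [J, Matrix.mul_apply]
  have hJ : J.trace = n := by simp [J, Matrix.trace]
  have hY0 : Y.trace = 0 := by simp [Matrix.trace, hY, edgeMatrix_self]
  have hJY : (J * Y).trace = ∑ a, ∑ b, Y a b := by
    simp only [Matrix.trace, Matrix.diag, Matrix.mul_apply, J, Matrix.of_apply, one_mul]
    exact Finset.sum_comm
  have hJYY : (J * (Y * Y)).trace = ∑ a, (∑ b, Y a b) ^ 2 := by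
    simp only [Matrix.trace, Matrix.diag, Matrix.mul_apply, J, Matrix.of_apply, one_mul, sq,
      Finset.sum_mul_sum]
    rw [Finset.sum_comm]
    rw [Finset.sum_comm_cycle]
    refine Finset.sum_congr rfl fun a _ => ?_
    refine Finset.sum_congr rfl fun b _ => ?_
    refine Finset.sum_congr rfl fun c _ => ?_
    rw [hYs]
  have hYY : (Y * Y).trace = ∑ a, ∑ b, Y a b ^ 2 := by
    simp only [Matrix.trace, Matrix.diag, Matrix.mul_apply]
    refine Finset.sum_congr rfl fun a _ => Finset.sum_congr rfl fun b _ => ?_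
    rw [hYs b a]; ring
  have hYJ : (Y * J).trace = (J * Y).trace := Matrix.trace_mul_comm _ _
  have hYJY : (Y * (J * Y)).trace = (J * (Y * Y)).trace := by
    rw [Matrix.trace_mul_comm, Matrix.mul_assoc]
  have hYYJ : (Y * (Y * J)).trace = (J * (Y * Y)).trace := by
    rw [← Matrix.mul_assoc, Matrix.trace_mul_comm]
  have hJYJ : (J * (Y * J)).trace = n * (J * Y).trace := by
    rw [Matrix.trace_mul_comm, Matrix.mul_assoc, hJJ, Matrix.mul_smul, Matrix.trace_smul,
      hYJ, smul_eq_mul]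
  have hJJY : (J * (J * Y)).trace = n * (J * Y).trace := by
    rw [← Matrix.mul_assoc, hJJ, Matrix.smul_mul, Matrix.trace_smul, smul_eq_mul]
  have hYJJ : (Y * (J * J)).trace = n * (J * Y).trace := by
    rw [hJJ, Matrix.mul_smul, Matrix.trace_smul, hYJ, smul_eq_mul]
  have hJJJ : (J * (J * J)).trace = n * (n * n) := by
    rw [hJJ, Matrix.mul_smul, hJJ, Matrix.trace_smul, Matrix.trace_smul, hJ]; simp
  have hJJt : (J * J).trace = n * n := by rw [hJJ, Matrix.trace_smul, hJ, smul_eq_mul]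
  have h1 : (1 : Matrix (Fin n) (Fin n) ℝ).trace = n := by simp
  rw [hX]
  simp only [Matrix.mul_assoc, add_mul, mul_add, sub_mul, mul_sub, Matrix.smul_mul,
    Matrix.mul_smul, smul_sub, Matrix.one_mul, Matrix.mul_one, Matrix.trace_add,
    Matrix.trace_sub, Matrix.trace_smul, smul_eq_mul, hYJY, hYYJ, hJYJ, hJJY, hYJJ, hJJJ,
    hJJt, h1, hYJ, hJ, hY0, hJY, hJYY, hYY]
  ring

/-- The expected value of the cubic trace of the centred adjacency matrix is zero. -/
lemma bitExp_trace_cube_centered (p : ℝ) :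
    bitExp p (fun g : EdgeIdx n → Bool =>
      (centered p g * centered p g * centered p g).trace) = 0 := by
  simp only [trace_cube, bitExp_sum]
  refine Finset.sum_eq_zero fun a _ => Finset.sum_eq_zero fun b _ =>
    Finset.sum_eq_zero fun c _ => ?_
  by_cases hab : a = b
  · subst hab; simp [centered, edgeMatrix_self, bitExp]
  by_cases hbc : b = c
  · subst hbc; simp [centered, edgeMatrix_self, bitExp]
  by_cases hca : c = a
  · subst hca; simp [centered, edgeMatrix_self, bitExp]
  have h := bitExp_centered_mul (p := p) (edge a b hab)
    (fun g => centered p g b c * centered p g c a) (fun x t => by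
      have h1 : edge b c hbc ≠ edge a b hab := (edge_ne hab hbc hca).symm
      have h2 : edge c a hca ≠ edge a b hab := edge_ne hca hab hbc
      simp [centered, edgeMatrix_apply _ hbc, edgeMatrix_apply _ hca, h1, h2])
  rw [← h]
  congr 1
  funext g
  simp [centered, edgeMatrix_apply _ hab, mul_assoc]

end EdgeMatrix

/-- The matrix obtained from a Hermitian matrix by applying `φ` to its eigenvalues. -/
def funMat {n : ℕ} {A : Matrix (Fin n) (Fin n) ℝ} (hA : A.IsHermitian) (φ : ℝ → ℝ) :
    Matrix (Fin n) (Fin n) ℝ :=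
  (hA.eigenvectorUnitary : Matrix (Fin n) (Fin n) ℝ) *
    Matrix.diagonal (fun i => φ (hA.eigenvalues i)) *
    (hA.eigenvectorUnitary : Matrix (Fin n) (Fin n) ℝ)ᵀ

section FunMat

variable {n : ℕ} {A B : Matrix (Fin n) (Fin n) ℝ} (hA : A.IsHermitian) (hB : B.IsHermitian)

lemma eigenvectorUnitary_transpose_mul :
    (hA.eigenvectorUnitary : Matrix (Fin n) (Fin n) ℝ)ᵀ *
      (hA.eigenvectorUnitary : Matrix (Fin n) (Fin n) ℝ) = 1 := by
  have := Unitary.coe_star_mul_self hA.eigenvectorUnitary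
  rwa [Matrix.star_eq_conjTranspose, Matrix.conjTranspose_eq_transpose_of_trivial] at this

lemma eigenvectorUnitary_mul_transpose :
    (hA.eigenvectorUnitary : Matrix (Fin n) (Fin n) ℝ) *
      (hA.eigenvectorUnitary : Matrix (Fin n) (Fin n) ℝ)ᵀ = 1 :=
  mul_eq_one_comm.1 (eigenvectorUnitary_transpose_mul hA)

lemma funMat_id : funMat hA (fun x => x) = A := by
  have := hA.spectral_theorem
  rw [Unitary.conjStarAlgAut_apply] at this
  conv_rhs => rw [this]
  unfold funMat
  rw [Matrix.star_eq_conjTranspose, Matrix.conjTranspose_eq_transpose_of_trivial]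
  rfl

lemma funMat_one : funMat hA (fun _ => 1) = 1 := by
  simp [funMat, eigenvectorUnitary_mul_transpose]

lemma funMat_mul (φ ψ : ℝ → ℝ) :
    funMat hA φ * funMat hA ψ = funMat hA (fun x => φ x * ψ x) := by
  unfold funMat
  set U := (hA.eigenvectorUnitary : Matrix (Fin n) (Fin n) ℝ)
  have hU : Uᵀ * U = 1 := eigenvectorUnitary_transpose_mul hA
  calc _ = U * Matrix.diagonal (fun i => φ (hA.eigenvalues i)) * (Uᵀ * U) *
        Matrix.diagonal (fun i => ψ (hA.eigenvalues i)) * Uᵀ := by simp only [Matrix.mul_assoc]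
    _ = _ := by rw [hU, Matrix.mul_one, Matrix.mul_assoc U, Matrix.diagonal_mul_diagonal]

lemma trace_funMat (φ : ℝ → ℝ) : (funMat hA φ).trace = ∑ i, φ (hA.eigenvalues i) := by
  unfold funMat
  rw [Matrix.trace_mul_comm, ← Matrix.mul_assoc, eigenvectorUnitary_transpose_mul, Matrix.one_mul,
    Matrix.trace_diagonal]

lemma funMat_transpose (φ : ℝ → ℝ) : (funMat hA φ)ᵀ = funMat hA φ := by
  simp [funMat, Matrix.transpose_mul, Matrix.mul_assoc]

lemma funMat_comm (φ : ℝ → ℝ) (a b : Fin n) : funMat hA φ a b = funMat hA φ b a := by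
  conv_lhs => rw [← funMat_transpose]
  rfl

/-- Squared overlaps between the eigenbases of two Hermitian matrices. -/
def overlap (i j : Fin n) : ℝ :=
  ((hA.eigenvectorUnitary : Matrix (Fin n) (Fin n) ℝ)ᵀ *
    (hB.eigenvectorUnitary : Matrix (Fin n) (Fin n) ℝ)) i j ^ 2

lemma trace_funMat_mul_funMat (φ ψ : ℝ → ℝ) :
    (funMat hA φ * funMat hB ψ).trace =
      ∑ i, ∑ j, overlap hA hB i j * (φ (hA.eigenvalues i) * ψ (hB.eigenvalues j)) := by
  unfold funMat overlap
  set U := (hA.eigenvectorUnitary : Matrix (Fin n) (Fin n) ℝ)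
  set V := (hB.eigenvectorUnitary : Matrix (Fin n) (Fin n) ℝ)
  set D := Matrix.diagonal (fun i => φ (hA.eigenvalues i))
  set D' := Matrix.diagonal (fun i => ψ (hB.eigenvalues i))
  have : (U * D * Uᵀ * (V * D' * Vᵀ)).trace = (D * (Uᵀ * V) * (D' * (Uᵀ * V)ᵀ)).trace := by
    rw [Matrix.transpose_mul, Matrix.transpose_transpose, Matrix.mul_assoc U, Matrix.mul_assoc U,
      Matrix.trace_mul_comm]
    simp only [Matrix.mul_assoc]
  rw [this]
  generalize Uᵀ * V = W
  simp only [Matrix.trace, Matrix.diag, Matrix.mul_apply, D, D',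
    Matrix.transpose_apply, Matrix.diagonal_apply, Finset.sum_ite_eq, Finset.mem_univ, if_true,
    ite_mul, zero_mul]
  exact Finset.sum_congr rfl fun i _ => Finset.sum_congr rfl fun j _ => by ring

/-- Second-order Taylor bound for spectral functions. -/
lemma trace_funMat_taylor {f f' : ℝ → ℝ} {K : ℝ}
    (hf : ∀ x y, |f y - f x - f' x * (y - x)| ≤ K * (y - x) ^ 2) :
    |(funMat hB f).trace - (funMat hA f).trace - (funMat hA f' * (B - A)).trace| ≤
      K * ((B - A) * (B - A)).trace := by
  have e1 : (funMat hB f).trace = ∑ i, ∑ j, overlap hA hB i j * f (hB.eigenvalues j) := by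
    have := trace_funMat_mul_funMat hA hB (fun _ => 1) f
    rw [funMat_one, Matrix.one_mul] at this
    simpa only [one_mul] using this
  have e2 : ∀ φ : ℝ → ℝ, (funMat hA φ).trace =
      ∑ i, ∑ j, overlap hA hB i j * φ (hA.eigenvalues i) := by
    intro φ
    have := trace_funMat_mul_funMat hA hB φ (fun _ => 1)
    rw [funMat_one, Matrix.mul_one] at this
    simpa only [mul_one] using this
  have e3 : (funMat hA f' * (B - A)).trace = ∑ i, ∑ j, overlap hA hB i j *
      (f' (hA.eigenvalues i) * (hB.eigenvalues j - hA.eigenvalues i)) := by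
    have h1 := trace_funMat_mul_funMat hA hB f' (fun x => x)
    rw [funMat_id] at h1
    have h2 : funMat hA f' * A = funMat hA (fun x => f' x * x) := by
      have h := funMat_mul hA f' (fun x => x)
      rwa [funMat_id] at h
    rw [Matrix.mul_sub, Matrix.trace_sub, h1, h2, e2]
    simp only [← Finset.sum_sub_distrib]
    exact Finset.sum_congr rfl fun i _ => Finset.sum_congr rfl fun j _ => by ring
  have e4 : ((B - A) * (B - A)).trace = ∑ i, ∑ j, overlap hA hB i j *
      (hB.eigenvalues j - hA.eigenvalues i) ^ 2 := by
    have h1 := trace_funMat_mul_funMat hA hB (fun x => x) (fun x => x)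
    rw [funMat_id, funMat_id] at h1
    have h2 : A * A = funMat hA (fun x => x * x) := by
      rw [← funMat_mul, funMat_id]
    have h3 : (B * B).trace = ∑ i, ∑ j, overlap hA hB i j *
        (hB.eigenvalues j * hB.eigenvalues j) := by
      have h4 : B * B = funMat hB (fun x => x * x) := by
        rw [← funMat_mul, funMat_id]
      have := trace_funMat_mul_funMat hA hB (fun _ => 1) (fun x => x * x)
      rw [funMat_one, Matrix.one_mul] at this
      rw [h4, this]
      simp only [one_mul]
    rw [Matrix.mul_sub, Matrix.sub_mul, Matrix.sub_mul, Matrix.trace_sub, Matrix.trace_sub,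
      Matrix.trace_sub, Matrix.trace_mul_comm B A, h1, h3, h2, e2]
    simp only [← Finset.sum_sub_distrib]
    exact Finset.sum_congr rfl fun i _ => Finset.sum_congr rfl fun j _ => by ring
  rw [e1, e2, e3, e4, Finset.mul_sum]
  simp only [← Finset.sum_sub_distrib, Finset.mul_sum]
  refine (Finset.abs_sum_le_sum_abs _ _).trans (Finset.sum_le_sum fun i _ => ?_)
  refine (Finset.abs_sum_le_sum_abs _ _).trans (Finset.sum_le_sum fun j _ => ?_)
  have h0 : 0 ≤ overlap hA hB i j := sq_nonneg _
  rw [← mul_sub, ← mul_sub, abs_mul, abs_of_nonneg h0]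
  calc _ ≤ overlap hA hB i j * (K * (hB.eigenvalues j - hA.eigenvalues i) ^ 2) :=
        mul_le_mul_of_nonneg_left (hf _ _) h0
    _ = _ := by ring

lemma sum_sq_funMat (φ : ℝ → ℝ) :
    ∑ a, ∑ b, funMat hA φ a b ^ 2 = ∑ i, φ (hA.eigenvalues i) ^ 2 := by
  have h : (funMat hA φ * funMat hA φ).trace = ∑ i, φ (hA.eigenvalues i) ^ 2 := by
    rw [funMat_mul, trace_funMat]
    exact Finset.sum_congr rfl fun i _ => by ring
  rw [← h]
  simp only [Matrix.trace, Matrix.diag, Matrix.mul_apply]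
  refine Finset.sum_congr rfl fun a _ => Finset.sum_congr rfl fun b _ => ?_
  rw [sq]
  congr 1
  exact funMat_comm hA φ a b

end FunMat

/-- Truncation of `x` to `[-R, R]`. -/
def clamp (R x : ℝ) : ℝ := max (-R) (min x R)

/-- The cubic function, extended linearly outside `[-R, R]`. -/
def cubeTrunc (R x : ℝ) : ℝ := 3 * clamp R x ^ 2 * x - 2 * clamp R x ^ 3

lemma clamp_cases {R : ℝ} (hR : 0 ≤ R) (x : ℝ) :
    (|x| ≤ R ∧ clamp R x = x) ∨ (R < x ∧ clamp R x = R) ∨ (x < -R ∧ clamp R x = -R) := by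
  unfold clamp
  rcases le_or_gt x R with h | h
  · rcases le_or_gt (-R) x with h' | h'
    · left; exact ⟨abs_le.2 ⟨h', h⟩, by rw [min_eq_left h, max_eq_right h']⟩
    · right; right; exact ⟨h', by rw [min_eq_left h, max_eq_left h'.le]⟩
  · right; left; exact ⟨h, by rw [min_eq_right h.le, max_eq_right (by linarith)]⟩

lemma abs_clamp_le {R : ℝ} (hR : 0 ≤ R) (x : ℝ) : |clamp R x| ≤ R := by
  rcases clamp_cases hR x with ⟨h, h'⟩ | ⟨h, h'⟩ | ⟨h, h'⟩ <;> rw [h']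
  · exact h
  · rw [abs_of_nonneg hR]
  · rw [abs_neg, abs_of_nonneg hR]

lemma cubeTrunc_taylor {R : ℝ} (hR : 0 ≤ R) (x y : ℝ) :
    |cubeTrunc R y - cubeTrunc R x - 3 * clamp R x ^ 2 * (y - x)| ≤ 3 * R * (y - x) ^ 2 := by
  have hx := abs_le.1 (abs_clamp_le hR x)
  have hy := abs_le.1 (abs_clamp_le hR y)
  set u := clamp R x with hu
  set v := clamp R y with hv
  have key : cubeTrunc R y - cubeTrunc R x - 3 * u ^ 2 * (y - x) =
      (v - u) ^ 2 * (v + 2 * u) + 3 * ((v - u) * (v + u) * (y - v)) := by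
    simp only [cubeTrunc, ← hu, ← hv]; ring
  have h1 : |(v - u) ^ 2 * (v + 2 * u)| ≤ 3 * R * (v - u) ^ 2 := by
    rw [abs_mul, abs_of_nonneg (sq_nonneg _), mul_comm]
    refine mul_le_mul_of_nonneg_right (abs_le.2 ⟨?_, ?_⟩) (sq_nonneg _) <;> linarith
  have h2 : 0 ≤ (v - u) * (y - v) ∧
      |(v - u) * (v + u) * (y - v)| ≤ 2 * R * ((v - u) * (y - v)) := by
    have h3 : 0 ≤ (v - u) * (y - v) := by
      rcases clamp_cases hR y with ⟨_, h'⟩ | ⟨h, h'⟩ | ⟨h, h'⟩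
      · rw [hv, h']; simp
      · apply mul_nonneg <;> rw [hv, h'] <;> linarith
      · apply mul_nonneg_of_nonpos_of_nonpos <;> rw [hv, h'] <;> linarith
    refine ⟨h3, ?_⟩
    rw [show (v - u) * (v + u) * (y - v) = (v + u) * ((v - u) * (y - v)) by ring, abs_mul,
      abs_of_nonneg h3]
    refine mul_le_mul_of_nonneg_right (abs_le.2 ⟨?_, ?_⟩) h3 <;> linarith
  have h4 : (v - u) ^ 2 + 2 * ((v - u) * (y - v)) ≤ (y - x) ^ 2 := by
    have h5 : 0 ≤ (v - u) * (u - x) := by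
      rcases clamp_cases hR x with ⟨_, h'⟩ | ⟨h, h'⟩ | ⟨h, h'⟩
      · rw [hu, h']; simp
      · apply mul_nonneg_of_nonpos_of_nonpos <;> rw [hu, h'] <;> linarith
      · apply mul_nonneg <;> rw [hu, h'] <;> linarith
    nlinarith [sq_nonneg ((y - v) + (u - x)), h2.1]
  rw [key]
  calc _ ≤ 3 * R * (v - u) ^ 2 + 3 * (2 * R * ((v - u) * (y - v))) := by
        refine (abs_add_le _ _).trans (add_le_add h1 ?_)
        rw [abs_mul, abs_of_nonneg (by norm_num : (0:ℝ) ≤ 3)]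
        linarith [h2.2]
    _ = 3 * R * ((v - u) ^ 2 + 2 * ((v - u) * (y - v))) := by ring
    _ ≤ _ := mul_le_mul_of_nonneg_left h4 (by positivity)

lemma cubeTrunc_sub_cube_le {R : ℝ} (hR : 0 ≤ R) (x : ℝ) :
    |cubeTrunc R x - x ^ 3| ≤ if R < |x| then |x| ^ 3 else 0 := by
  rcases clamp_cases hR x with ⟨h, h'⟩ | ⟨h, h'⟩ | ⟨h, h'⟩
  · rw [if_neg (not_lt.2 h), cubeTrunc, h']
    apply le_of_eq
    rw [abs_eq_zero]; ring
  · have hx : |x| = x := abs_of_pos (by linarith)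
    rw [hx, if_pos h, cubeTrunc, h', abs_le]
    have h1 := mul_nonneg (sq_nonneg (x - R)) (show 0 ≤ x + 2 * R by linarith)
    have h2 := mul_nonneg (sq_nonneg R) (show 0 ≤ 3 * x - 2 * R by linarith)
    have h3 : 0 ≤ x ^ 3 := by have : 0 ≤ x := by linarith
                              positivity
    constructor <;> nlinarith
  · have hx : |x| = -x := abs_of_neg (by linarith)
    rw [hx, if_pos (by linarith), cubeTrunc, h', abs_le]
    have h1 := mul_nonneg (sq_nonneg (x + R)) (show 0 ≤ -x + 2 * R by linarith)
    have h2 := mul_nonneg (sq_nonneg R) (show 0 ≤ -3 * x - 2 * R by linarith)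
    have h3 : 0 ≤ (-x) ^ 3 := by have : 0 ≤ -x := by linarith
                                 positivity
    constructor <;> nlinarith

lemma centered_isHermitian {n : ℕ} (p : ℝ) (g : EdgeIdx n → Bool) :
    (centered p g).IsHermitian := edgeMatrix_isHermitian _

/-- The trace of the truncated cube of the centred adjacency matrix. -/
def cubeStat {n : ℕ} (p R : ℝ) (g : EdgeIdx n → Bool) : ℝ :=
  ∑ i, cubeTrunc R ((centered_isHermitian p g).eigenvalues i)

lemma bitDiff_cubeStat_sq_le {n : ℕ} (p : ℝ) {R : ℝ} (hR : 0 ≤ R) (g : EdgeIdx n → Bool)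
    (e : EdgeIdx n) :
    bitDiff (cubeStat p R) e g ^ 2 ≤
      8 * funMat (centered_isHermitian p g) (fun x => 3 * clamp R x ^ 2) e.1.1 e.1.2 ^ 2 +
        72 * R ^ 2 := by
  set Q := funMat (centered_isHermitian p g) (fun x => 3 * clamp R x ^ 2) with hQ
  let E : Matrix (Fin n) (Fin n) ℝ := edgeMatrix (fun e' => if e' = e then 1 else 0)
  have hE : ∀ H : Matrix (Fin n) (Fin n) ℝ, (H * E).trace = H e.1.1 e.1.2 + H e.1.2 e.1.1 := by
    intro H
    have := sum_edgeMatrix_mul (fun e' => if e' = e then (1:ℝ) else 0) H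
    simp only [ite_mul, one_mul, zero_mul, Finset.sum_ite_eq', Finset.mem_univ, if_true] at this
    rw [← this, Matrix.trace_mul_comm]
    simp only [Matrix.trace, Matrix.diag, Matrix.mul_apply]
    rw [Finset.sum_comm]
    exact Finset.sum_congr rfl fun a _ => Finset.sum_congr rfl fun b _ => by
      rw [edgeMatrix_comm]
  have hEE : (E * E).trace = 2 := by
    have h1 : E e.1.1 e.1.2 = 1 := by
      refine (edgeMatrix_apply _ e.2.ne).trans ?_
      rw [edge_of_lt, if_pos rfl]
    have h2 : E e.1.2 e.1.1 = 1 := (edgeMatrix_comm _ _ _).trans h1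
    rw [hE, h1, h2]; norm_num
  have hQE : (Q * E).trace = 2 * Q e.1.1 e.1.2 := by
    have h : Q e.1.2 e.1.1 = Q e.1.1 e.1.2 :=
      funMat_comm _ _ _ _
    rw [hE, h]
    ring
  have hstat : ∀ g' : EdgeIdx n → Bool,
      cubeStat p R g' = (funMat (centered_isHermitian p g') (cubeTrunc R)).trace :=
    fun g' => (trace_funMat _ _).symm
  have hmain : |bitDiff (cubeStat p R) e g| ≤ 2 * |Q e.1.1 e.1.2| + 6 * R := by
    have hbound : ∀ (g' : EdgeIdx n → Bool) (σ : ℝ), σ ^ 2 = 1 →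
        centered p g' - centered p g = σ • E →
        |cubeStat p R g' - cubeStat p R g| ≤ 2 * |Q e.1.1 e.1.2| + 6 * R := by
      intro g' σ hσ hg'
      have h := trace_funMat_taylor (centered_isHermitian p g) (centered_isHermitian p g')
        (cubeTrunc_taylor hR)
      rw [← hstat, ← hstat, hg', Matrix.mul_smul, Matrix.mul_smul, Matrix.smul_mul,
        Matrix.trace_smul, Matrix.trace_smul, Matrix.trace_smul, hEE, hQE] at h
      simp only [smul_eq_mul] at h
      have h2 : |σ| = 1 := by rwa [← sq_eq_sq₀ (abs_nonneg _) zero_le_one, sq_abs, one_pow]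
      have h3 : |σ * (2 * Q e.1.1 e.1.2)| = 2 * |Q e.1.1 e.1.2| := by
        rw [abs_mul, h2, abs_mul]; norm_num
      have h4 := abs_sub_abs_le_abs_sub (cubeStat p R g' - cubeStat p R g)
        (σ * (2 * Q e.1.1 e.1.2))
      nlinarith
    have hdiff : centered p (Function.update g e true) -
        centered p (Function.update g e false) = E := by
      ext a b
      rcases eq_or_ne a b with rfl | hab
      · simp [centered, E, edgeMatrix_self]
      · simp only [centered, E, Matrix.sub_apply, edgeMatrix_apply _ hab, Function.update_apply]
        by_cases h : edge a b hab = e <;> simp [h]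
    unfold bitDiff
    cases hge : g e with
    | true =>
      have : Function.update g e true = g := by rw [← hge, Function.update_eq_self]
      rw [this] at hdiff ⊢
      rw [abs_sub_comm]
      refine hbound _ (-1) (by norm_num) ?_
      rw [← hdiff]; simp
    | false =>
      have : Function.update g e false = g := by rw [← hge, Function.update_eq_self]
      rw [this] at hdiff ⊢
      refine hbound _ 1 (by norm_num) ?_
      rw [← hdiff]; simp
  calc bitDiff (cubeStat p R) e g ^ 2 = |bitDiff (cubeStat p R) e g| ^ 2 := (sq_abs _).symm
    _ ≤ (2 * |Q e.1.1 e.1.2| + 6 * R) ^ 2 := by gcongr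
    _ ≤ _ := by nlinarith [sq_nonneg (2 * |Q e.1.1 e.1.2| - 6 * R), sq_abs (Q e.1.1 e.1.2)]

lemma sum_bitDiff_cubeStat_sq_le {n : ℕ} (p : ℝ) {R : ℝ} (hR : 0 ≤ R) (g : EdgeIdx n → Bool) :
    ∑ e, bitDiff (cubeStat p R) e g ^ 2 ≤ 36 * n * R ^ 4 + 36 * R ^ 2 * n ^ 2 := by
  set Q := funMat (centered_isHermitian p g) (fun x => 3 * clamp R x ^ 2) with hQ
  have h1 : ∑ e : EdgeIdx n, 2 * Q e.1.1 e.1.2 ^ 2 ≤ 9 * n * R ^ 4 := by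
    calc ∑ e : EdgeIdx n, 2 * Q e.1.1 e.1.2 ^ 2
        = ∑ a, ∑ b, (if a = b then 0 else Q a b ^ 2) := by
          rw [sum_sum_eq_sum_edge (fun a b => if a = b then 0 else Q a b ^ 2)
            (fun a => if_pos rfl)]
          refine Finset.sum_congr rfl fun e _ => ?_
          have : Q e.1.2 e.1.1 = Q e.1.1 e.1.2 :=
            funMat_comm _ _ _ _
          simp only [if_neg e.2.ne, if_neg e.2.ne', this]
          ring
      _ ≤ ∑ a, ∑ b, Q a b ^ 2 := by
          refine Finset.sum_le_sum fun a _ => Finset.sum_le_sum fun b _ => ?_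
          split_ifs
          exacts [sq_nonneg _, le_rfl]
      _ = ∑ i, (3 * clamp R ((centered_isHermitian p g).eigenvalues i) ^ 2) ^ 2 :=
          sum_sq_funMat _ _
      _ ≤ ∑ _i : Fin n, 9 * R ^ 4 := by
          refine Finset.sum_le_sum fun i _ => ?_
          have := abs_clamp_le hR ((centered_isHermitian p g).eigenvalues i)
          have h2 : clamp R ((centered_isHermitian p g).eigenvalues i) ^ 2 ≤ R ^ 2 :=
            sq_le_sq' (abs_le.1 this).1 (abs_le.1 this).2
          nlinarith [sq_nonneg (clamp R ((centered_isHermitian p g).eigenvalues i))]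
      _ = _ := by simp; ring
  calc _ ≤ ∑ e : EdgeIdx n, (8 * Q e.1.1 e.1.2 ^ 2 + 72 * R ^ 2) :=
        Finset.sum_le_sum fun e _ => bitDiff_cubeStat_sq_le p hR g e
    _ = 4 * (∑ e : EdgeIdx n, 2 * Q e.1.1 e.1.2 ^ 2) +
        (Fintype.card (EdgeIdx n) : ℝ) * (72 * R ^ 2) := by
          rw [Finset.sum_add_distrib, Finset.mul_sum]
          simp only [Finset.sum_const, Finset.card_univ, nsmul_eq_mul]
          congr 1
          exact Finset.sum_congr rfl fun e _ => by ring
    _ ≤ _ := by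
          rw [card_edgeIdx]
          nlinarith [mul_nonneg (Nat.cast_nonneg (α := ℝ) n) (sq_nonneg R)]

/-- Lower-tail concentration of the truncated cubic trace. -/
lemma bitProb_cubeStat_lower_tail {n : ℕ} {p : ℝ} (h0 : 0 < p) (h1 : p < 1) (hn : 0 < n)
    {R : ℝ} (hR : 0 < R) {u : ℝ} (hu : 0 < u) :
    bitProb p (fun g : EdgeIdx n → Bool => cubeStat p R g ≤ bitExp p (cubeStat (n := n) p R) - u) ≤
      Real.exp (-(u ^ 2 / (4 * (36 * n * R ^ 4 + 36 * R ^ 2 * n ^ 2)))) := by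
  have : (0:ℝ) < n := by exact_mod_cast hn
  exact bitProb_lower_tail h0 h1 _ (by positivity) (sum_bitDiff_cubeStat_sq_le p hR.le) hu

section Nets

variable {E : Type*} [NormedAddCommGroup E] [NormedSpace ℝ E] [FiniteDimensional ℝ E]

/-- A separated subset of the unit ball has at most `(1 + 2 / ε) ^ dim` elements. -/
lemma card_le_of_separated_unitBall {ε : ℝ} (hε : 0 < ε) (s : Finset E)
    (hs : ∀ c ∈ s, ‖c‖ ≤ 1) (h : ∀ c ∈ s, ∀ d ∈ s, c ≠ d → ε ≤ ‖c - d‖) :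
    (s.card : ℝ) ≤ (1 + 2 / ε) ^ Module.finrank ℝ E := by
  borelize E
  let μ : Measure E := Measure.addHaar
  let δ : ℝ := ε / 2
  let ρ : ℝ := 1 + ε / 2
  have δpos : 0 < δ := by positivity
  have ρpos : 0 < ρ := by positivity
  set A := ⋃ c ∈ s, Metric.ball (c : E) δ with hA
  have D : Set.Pairwise (s : Set E) (Function.onFun Disjoint fun c => Metric.ball (c : E) δ) := by
    rintro c hc d hd hcd
    apply Metric.ball_disjoint_ball
    rw [dist_eq_norm]
    have := h c hc d hd hcd
    simp only [δ]; linarith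
  have A_subset : A ⊆ Metric.ball (0 : E) ρ := by
    refine Set.iUnion₂_subset fun x hx => ?_
    apply Metric.ball_subset_ball'
    rw [dist_zero_right]
    have := hs x hx
    simp only [δ, ρ]; linarith
  have I : (s.card : ℝ≥0∞) * ENNReal.ofReal (δ ^ Module.finrank ℝ E) * μ (Metric.ball 0 1) ≤
      ENNReal.ofReal (ρ ^ Module.finrank ℝ E) * μ (Metric.ball 0 1) :=
    calc _ = μ A := by
          rw [hA, measure_biUnion_finset D fun c _ => measurableSet_ball]
          simp only [μ.addHaar_ball_of_pos _ δpos]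
          simp only [Finset.sum_const, nsmul_eq_mul, mul_assoc]
      _ ≤ μ (Metric.ball (0 : E) ρ) := measure_mono A_subset
      _ = _ := by simp only [μ.addHaar_ball_of_pos _ ρpos]
  have J : (s.card : ℝ≥0∞) * ENNReal.ofReal (δ ^ Module.finrank ℝ E) ≤
      ENNReal.ofReal (ρ ^ Module.finrank ℝ E) :=
    (ENNReal.mul_le_mul_iff_left (Metric.measure_ball_pos _ _ zero_lt_one).ne'
      measure_ball_lt_top.ne).1 I
  have K : (s.card : ℝ) * δ ^ Module.finrank ℝ E ≤ ρ ^ Module.finrank ℝ E := by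
    have := ENNReal.toReal_le_of_le_ofReal (pow_nonneg ρpos.le _) J
    rwa [ENNReal.toReal_mul, ENNReal.toReal_natCast,
      ENNReal.toReal_ofReal (pow_nonneg δpos.le _)] at this
  rw [← le_div_iff₀ (pow_pos δpos _), ← div_pow] at K
  have hρδ : ρ / δ = 1 + 2 / ε := by simp only [ρ, δ]; field_simp; ring
  rwa [hρδ] at K

/-- The unit ball has an `ε`-net with at most `(1 + 2 / ε) ^ dim` elements. -/
lemma exists_net_unitBall (E : Type*) [NormedAddCommGroup E] [NormedSpace ℝ E]
    [FiniteDimensional ℝ E] {ε : ℝ} (hε : 0 < ε) :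
    ∃ s : Finset E, (∀ c ∈ s, ‖c‖ ≤ 1) ∧
      (s.card : ℝ) ≤ (1 + 2 / ε) ^ Module.finrank ℝ E ∧
      ∀ x : E, ‖x‖ ≤ 1 → ∃ c ∈ s, ‖x - c‖ ≤ ε := by
  classical
  let P : Finset E → Prop := fun s =>
    (∀ c ∈ s, ‖c‖ ≤ 1) ∧ ∀ c ∈ s, ∀ d ∈ s, c ≠ d → ε ≤ ‖c - d‖
  have hcard : ∀ s, P s → s.card ≤ ⌊(1 + 2 / ε) ^ Module.finrank ℝ E⌋₊ := fun s hs =>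
    Nat.le_floor (card_le_of_separated_unitBall hε s hs.1 hs.2)
  have hex : ∃ N, ∃ s, P s ∧ s.card = N := ⟨0, ∅, by simp [P], rfl⟩
  obtain ⟨s, hs, hmax⟩ : ∃ s, P s ∧ ∀ s', P s' → s'.card ≤ s.card := by
    obtain ⟨s, hs, hN⟩ := Nat.findGreatest_spec (P := fun N => ∃ s, P s ∧ s.card = N)
      (Nat.zero_le (⌊(1 + 2 / ε) ^ Module.finrank ℝ E⌋₊)) ⟨∅, by simp [P], rfl⟩
    exact ⟨s, hs, fun s' hs' => hN ▸ Nat.le_findGreatest (hcard s' hs') ⟨s', hs', rfl⟩⟩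
  refine ⟨s, hs.1, card_le_of_separated_unitBall hε s hs.1 hs.2, fun x hx => ?_⟩
  by_contra! hno
  have hxs : x ∉ s := fun hxs => by
    have := hno x hxs
    rw [sub_self, norm_zero] at this
    linarith
  have := hmax (insert x s) ⟨?_, ?_⟩
  · rw [Finset.card_insert_of_notMem hxs] at this
    omega
  · intro c hc
    rcases Finset.mem_insert.1 hc with rfl | hc
    exacts [hx, hs.1 c hc]
  · intro c hc d hd hcd
    rcases Finset.mem_insert.1 hc with rfl | hc' <;>
      rcases Finset.mem_insert.1 hd with rfl | hd'
    · exact absurd rfl hcd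
    · exact (hno d hd').le
    · rw [norm_sub_rev]; exact (hno c hc').le
    · exact hs.2 c hc' d hd' hcd

/-- A bilinear form on two unit balls is controlled by its values on nets. -/
lemma exists_net_bilinear_le {F : Type*} [NormedAddCommGroup F] [NormedSpace ℝ F]
    [FiniteDimensional ℝ F] (B : E →ₗ[ℝ] F →ₗ[ℝ] ℝ) {ε : ℝ} (hε : 0 < ε)
    {s : Finset E} {s' : Finset F} (hs' : ∀ d ∈ s', ‖d‖ ≤ 1)
    (hnet : ∀ x : E, ‖x‖ ≤ 1 → ∃ c ∈ s, ‖x - c‖ ≤ ε)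
    (hnet' : ∀ y : F, ‖y‖ ≤ 1 → ∃ d ∈ s', ‖y - d‖ ≤ ε)
    {x : E} {y : F} (hx : ‖x‖ ≤ 1) (hy : ‖y‖ ≤ 1) (hε2 : 2 * ε ≤ 1) :
    ∃ c ∈ s, ∃ d ∈ s', (1 - 2 * ε) * B x y ≤ B c d := by
  have hcont : Continuous fun z : E × F => B z.1 z.2 := by
    have h1 : Continuous fun z : E × F => (LinearMap.toContinuousLinearMap
        (LinearMap.toContinuousLinearMap.toLinearMap ∘ₗ B)) z.1 z.2 := by fun_prop
    exact h1
  have hcomp : IsCompact (Metric.closedBall (0 : E) 1 ×ˢ Metric.closedBall (0 : F) 1) :=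
    (isCompact_closedBall _ _).prod (isCompact_closedBall _ _)
  obtain ⟨⟨x₀, y₀⟩, hmem, hmax⟩ := hcomp.exists_isMaxOn ⟨(0, 0), by simp⟩ hcont.continuousOn
  simp only [Set.mem_prod, mem_closedBall_zero_iff] at hmem
  have hM : ∀ x y, ‖x‖ ≤ 1 → ‖y‖ ≤ 1 → B x y ≤ B x₀ y₀ := fun x y hx hy =>
    hmax (show (x, y) ∈ _ by simp [hx, hy])
  set S := B x₀ y₀ with hS
  obtain ⟨c, hc, hxc⟩ := hnet x₀ hmem.1
  obtain ⟨d, hd, hyd⟩ := hnet' y₀ hmem.2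
  refine ⟨c, hc, d, hd, ?_⟩
  have h1 : B (x₀ - c) d ≤ ε * S := by
    have := hM (ε⁻¹ • (x₀ - c)) d (by
      rw [norm_smul, norm_inv, Real.norm_of_nonneg hε.le, inv_mul_le_iff₀ hε]; linarith) (hs' d hd)
    rw [map_smul, LinearMap.smul_apply, smul_eq_mul, inv_mul_le_iff₀ hε] at this
    exact this
  have h2 : B x₀ (y₀ - d) ≤ ε * S := by
    have := hM x₀ (ε⁻¹ • (y₀ - d)) hmem.1 (by
      rw [norm_smul, norm_inv, Real.norm_of_nonneg hε.le, inv_mul_le_iff₀ hε]; linarith)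
    rw [map_smul, smul_eq_mul, inv_mul_le_iff₀ hε] at this
    exact this
  have h3 : S = B c d + B (x₀ - c) d + B x₀ (y₀ - d) := by
    simp only [map_sub, LinearMap.sub_apply, hS]; ring
  have h4 := mul_le_mul_of_nonneg_left (hM x y hx hy) (show 0 ≤ 1 - 2 * ε by linarith)
  linarith

end Nets

/-- Sharp Gaussian tail bound for linear functionals of the centred adjacency matrix. -/
lemma bitProb_linear_le {n : ℕ} {p : ℝ} (h0 : 1 / 2 ≤ p) (h1 : p < 1)
    (W : Matrix (Fin n) (Fin n) ℝ) (hW : ∑ a, ∑ b, W a b ^ 2 ≤ 1) {u : ℝ} (hu : 0 ≤ u) :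
    bitProb p (fun g : EdgeIdx n → Bool => u ≤ ∑ a, ∑ b, centered p g a b * W a b) ≤
      Real.exp (-(rateConst p * u ^ 2)) := by
  have hp : 0 < p := by linarith
  have hc := rateConst_pos h0 h1
  set θ := 2 * rateConst p * u with hθ
  have hθ0 : 0 ≤ θ := by positivity
  let w : EdgeIdx n → ℝ := fun e => W e.1.1 e.1.2 + W e.1.2 e.1.1
  have hw : ∑ e, w e ^ 2 ≤ 2 := by
    calc ∑ e, w e ^ 2 ≤ ∑ e : EdgeIdx n,
          2 * ((if e.1.1 = e.1.2 then 0 else W e.1.1 e.1.2 ^ 2) +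
            (if e.1.2 = e.1.1 then 0 else W e.1.2 e.1.1 ^ 2)) := by
          refine Finset.sum_le_sum fun e _ => ?_
          rw [if_neg e.2.ne, if_neg e.2.ne']
          nlinarith [sq_nonneg (W e.1.1 e.1.2 - W e.1.2 e.1.1)]
      _ = 2 * ∑ a, ∑ b, (if a = b then 0 else W a b ^ 2) := by
          rw [sum_sum_eq_sum_edge (fun a b => if a = b then 0 else W a b ^ 2)
            (fun a => if_pos rfl), Finset.mul_sum]
      _ ≤ 2 * ∑ a, ∑ b, W a b ^ 2 := by
          refine mul_le_mul_of_nonneg_left (Finset.sum_le_sum fun a _ =>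
            Finset.sum_le_sum fun b _ => ?_) zero_le_two
          split_ifs
          exacts [sq_nonneg _, le_rfl]
      _ ≤ 2 := by linarith
  have hmgf : bitExp p (fun g : EdgeIdx n → Bool =>
      Real.exp (θ * ∑ a, ∑ b, centered p g a b * W a b)) ≤
      Real.exp (θ ^ 2 / (4 * rateConst p)) := by
    have h2 : ∀ g : EdgeIdx n → Bool, Real.exp (θ * ∑ a, ∑ b, centered p g a b * W a b) =
        ∏ e, Real.exp (θ * w e * ((if g e then 1 else 0) - p)) := by
      intro g
      rw [← Real.exp_sum, centered, sum_edgeMatrix_mul, Finset.mul_sum]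
      congr 1
      exact Finset.sum_congr rfl fun e _ => by simp only [w]; ring
    simp only [h2]
    rw [bitExp_prod (fun e b => Real.exp (θ * w e * ((if b then 1 else 0) - p)))]
    calc _ ≤ ∏ e, Real.exp ((θ * w e) ^ 2 / (8 * rateConst p)) := by
          refine Finset.prod_le_prod (fun e _ => ?_) fun e _ => ?_
          · have : 0 < 1 - p := by linarith
            positivity
          · simpa using kearns_saul h0 h1 (θ * w e)
      _ = Real.exp (θ ^ 2 / (8 * rateConst p) * ∑ e, w e ^ 2) := by
          rw [← Real.exp_sum, Finset.mul_sum]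
          congr 1
          exact Finset.sum_congr rfl fun e _ => by ring
      _ ≤ _ := by
          rw [Real.exp_le_exp]
          calc _ ≤ θ ^ 2 / (8 * rateConst p) * 2 := mul_le_mul_of_nonneg_left hw (by positivity)
            _ = _ := by field_simp; ring
  calc _ ≤ bitProb p (fun g : EdgeIdx n → Bool =>
        θ * u ≤ θ * ∑ a, ∑ b, centered p g a b * W a b) :=
        bitProb_mono hp h1 fun g hg => mul_le_mul_of_nonneg_left hg hθ0
    _ ≤ Real.exp (-(θ * u)) * Real.exp (θ ^ 2 / (4 * rateConst p)) :=
        (bitProb_le_exp hp h1 _ _).trans (mul_le_mul_of_nonneg_left hmgf (Real.exp_pos _).le)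
    _ = _ := by
        rw [← Real.exp_add, hθ]
        congr 1
        field_simp; ring

/-- The rows of an `n × k` array. -/
def rowMap (n k : ℕ) (a : Fin n) :
    EuclideanSpace ℝ (Fin n × Fin k) →ₗ[ℝ] EuclideanSpace ℝ (Fin k) where
  toFun X := WithLp.toLp 2 fun j => X (a, j)
  map_add' X Y := by ext j; simp
  map_smul' r X := by ext j; simp

/-- The pairing of `A` with the product of an `n × k` array and a linear map. -/
def factorForm {n : ℕ} (k : ℕ) (A : Matrix (Fin n) (Fin n) ℝ) :
    EuclideanSpace ℝ (Fin n × Fin k) →ₗ[ℝ]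
      (EuclideanSpace ℝ (Fin k) →L[ℝ] EuclideanSpace ℝ (Fin n)) →ₗ[ℝ] ℝ :=
  LinearMap.mk₂ ℝ (fun X U => ∑ a, ∑ b, A a b * U (rowMap n k a X) b)
    (fun X Y U => by
      simp only [map_add, PiLp.add_apply, mul_add, Finset.sum_add_distrib])
    (fun r X U => by
      simp only [map_smul, PiLp.smul_apply, smul_eq_mul, Finset.mul_sum]
      exact Finset.sum_congr rfl fun a _ => Finset.sum_congr rfl fun b _ => by ring)
    (fun X U V => by
      simp only [_root_.add_apply, PiLp.add_apply, mul_add, Finset.sum_add_distrib])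
    (fun r X U => by
      simp only [_root_.smul_apply, PiLp.smul_apply, smul_eq_mul, Finset.mul_sum]
      exact Finset.sum_congr rfl fun a _ => Finset.sum_congr rfl fun b _ => by ring)

lemma factorForm_apply {n : ℕ} (k : ℕ) (A : Matrix (Fin n) (Fin n) ℝ)
    (X : EuclideanSpace ℝ (Fin n × Fin k))
    (U : EuclideanSpace ℝ (Fin k) →L[ℝ] EuclideanSpace ℝ (Fin n)) :
    factorForm k A X U = ∑ a, ∑ b, A a b * U (rowMap n k a X) b := rfl

lemma sum_sq_factor_le {n k : ℕ} {X : EuclideanSpace ℝ (Fin n × Fin k)}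
    {U : EuclideanSpace ℝ (Fin k) →L[ℝ] EuclideanSpace ℝ (Fin n)}
    (hX : ‖X‖ ≤ 1) (hU : ‖U‖ ≤ 1) :
    ∑ a, ∑ b, U (rowMap n k a X) b ^ 2 ≤ 1 := by
  calc ∑ a, ∑ b, U (rowMap n k a X) b ^ 2 = ∑ a, ‖U (rowMap n k a X)‖ ^ 2 := by
        simp only [EuclideanSpace.real_norm_sq_eq]
    _ ≤ ∑ a, ‖rowMap n k a X‖ ^ 2 := by
        refine Finset.sum_le_sum fun a _ => ?_
        gcongr
        exact (U.le_opNorm _).trans (mul_le_of_le_one_left (norm_nonneg _) hU)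
    _ = ‖X‖ ^ 2 := by
        simp only [EuclideanSpace.real_norm_sq_eq, Fintype.sum_prod_type]
        rfl
    _ ≤ 1 := by
        rw [sq_le_one_iff_abs_le_one, abs_of_nonneg (norm_nonneg _)]; exact hX

/-- Tail bound for the supremum of the pairing over matrices of rank at most `k`. -/
lemma bitProb_factorForm_le {n : ℕ} {p : ℝ} (h0 : 1 / 2 ≤ p) (h1 : p < 1) (k : ℕ)
    {ε : ℝ} (hε : 0 < ε) (hε2 : 2 * ε ≤ 1) {u : ℝ} (hu : 0 ≤ u) :
    bitProb p (fun g : EdgeIdx n → Bool => ∃ X U, ‖X‖ ≤ 1 ∧ ‖U‖ ≤ 1 ∧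
        u ≤ factorForm k (centered p g) X U) ≤
      (1 + 2 / ε) ^ (2 * (n * k)) * Real.exp (-(rateConst p * ((1 - 2 * ε) * u) ^ 2)) := by
  have hp : 0 < p := by linarith
  obtain ⟨s, hs, hcard, hnet⟩ := exists_net_unitBall (EuclideanSpace ℝ (Fin n × Fin k)) hε
  obtain ⟨s', hs', hcard', hnet'⟩ :=
    exists_net_unitBall (EuclideanSpace ℝ (Fin k) →L[ℝ] EuclideanSpace ℝ (Fin n)) hε
  have hd : Module.finrank ℝ (EuclideanSpace ℝ (Fin n × Fin k)) = n * k := by simp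
  have hd' : Module.finrank ℝ (EuclideanSpace ℝ (Fin k) →L[ℝ] EuclideanSpace ℝ (Fin n)) =
      n * k := by
    rw [← (LinearMap.toContinuousLinearMap (𝕜 := ℝ) (E := EuclideanSpace ℝ (Fin k))
      (F' := EuclideanSpace ℝ (Fin n))).finrank_eq, Module.finrank_linearMap]
    simp [mul_comm]
  rw [hd] at hcard
  rw [hd'] at hcard'
  calc _ ≤ bitProb p (fun g : EdgeIdx n → Bool => ∃ q ∈ s ×ˢ s',
        (1 - 2 * ε) * u ≤ ∑ a, ∑ b, centered p g a b * q.2 (rowMap n k a q.1) b) := by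
        refine bitProb_mono hp h1 fun g ⟨X, U, hX, hU, hle⟩ => ?_
        obtain ⟨c, hc, d, hd, h⟩ := exists_net_bilinear_le (factorForm k (centered p g)) hε hs'
          hnet hnet' hX hU hε2
        refine ⟨(c, d), Finset.mem_product.2 ⟨hc, hd⟩, le_trans ?_ h⟩
        exact mul_le_mul_of_nonneg_left hle (by linarith)
    _ ≤ ∑ q ∈ s ×ˢ s', Real.exp (-(rateConst p * ((1 - 2 * ε) * u) ^ 2)) := by
        refine (bitProb_exists_le hp h1 _ _).trans (Finset.sum_le_sum fun q hq => ?_)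
        rw [Finset.mem_product] at hq
        exact bitProb_linear_le h0 h1 (Matrix.of fun a b => q.2 (rowMap n k a q.1) b)
          (sum_sq_factor_le (hs _ hq.1) (hs' _ hq.2)) (mul_nonneg (by linarith) hu)
    _ = (s.card : ℝ) * s'.card * Real.exp (-(rateConst p * ((1 - 2 * ε) * u) ^ 2)) := by
        rw [Finset.sum_const, Finset.card_product, nsmul_eq_mul]; push_cast; ring
    _ ≤ _ := by
        refine mul_le_mul_of_nonneg_right ?_ (Real.exp_pos _).le
        rw [two_mul, pow_add]
        gcongr

/-- `k` large eigenvalues are witnessed by a matrix of rank `k`. -/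
lemma exists_factorForm_of_eigenvalues {n : ℕ} {A : Matrix (Fin n) (Fin n) ℝ}
    (hA : A.IsHermitian) (T : Finset (Fin n)) {u : ℝ} (hu : 0 < u)
    (hT : u ^ 2 ≤ ∑ i ∈ T, hA.eigenvalues i ^ 2) :
    ∃ X U, ‖X‖ ≤ 1 ∧ ‖U‖ ≤ 1 ∧ u ≤ factorForm T.card A X U := by
  set Q := (hA.eigenvectorUnitary : Matrix (Fin n) (Fin n) ℝ) with hQ
  have hQQ : ∀ i j, ∑ a, Q a i * Q a j = if i = j then 1 else 0 := by
    intro i j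
    have := congrFun (congrFun (eigenvectorUnitary_transpose_mul hA) i) j
    rwa [Matrix.mul_apply, Matrix.one_apply] at this
  have hAQ : ∀ a i, ∑ b, A a b * Q b i = hA.eigenvalues i * Q a i := by
    intro a i
    have h1 : A * Q = Q * Matrix.diagonal hA.eigenvalues := by
      conv_lhs => rw [← funMat_id hA]
      rw [funMat, Matrix.mul_assoc, eigenvectorUnitary_transpose_mul, Matrix.mul_one]
    have := congrFun (congrFun h1 a) i
    rw [Matrix.mul_apply, Matrix.mul_diagonal] at this
    rw [this, mul_comm]
  set l := hA.eigenvalues with hl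
  set L := Real.sqrt (∑ i ∈ T, l i ^ 2) with hL
  have hLu : u ≤ L := Real.le_sqrt_of_sq_le hT
  have hL0 : 0 < L := hu.trans_le hLu
  have hL2 : L ^ 2 = ∑ i ∈ T, l i ^ 2 :=
    Real.sq_sqrt (Finset.sum_nonneg fun _ _ => sq_nonneg _)
  let σ : Fin T.card ≃ T := T.equivFin.symm
  have hσ : ∀ i j, (σ i : Fin n) = σ j ↔ i = j := fun i j =>
    Subtype.coe_injective.eq_iff.trans σ.injective.eq_iff
  have hsum : ∀ φ : Fin n → ℝ, ∑ j, φ (σ j) = ∑ i ∈ T, φ i := fun φ => by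
    rw [Equiv.sum_comp σ (fun i : T => φ i), Finset.sum_coe_sort]
  let X : EuclideanSpace ℝ (Fin n × Fin T.card) :=
    WithLp.toLp 2 fun q => l (σ q.2) * Q q.1 (σ q.2) / L
  let U : EuclideanSpace ℝ (Fin T.card) →L[ℝ] EuclideanSpace ℝ (Fin n) :=
    LinearMap.toContinuousLinearMap
      (Matrix.toLpLin 2 2 (Matrix.of fun (b : Fin n) (j : Fin T.card) => Q b (σ j)))
  have hUap : ∀ z b, U z b = ∑ j, Q b (σ j) * z j := by
    intro z b
    simp [U, Matrix.toLpLin_apply, Matrix.mulVec, dotProduct]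
  refine ⟨X, U, ?_, ?_, ?_⟩
  · rw [← abs_of_nonneg (norm_nonneg X), ← sq_le_one_iff_abs_le_one,
      EuclideanSpace.real_norm_sq_eq, Fintype.sum_prod_type, Finset.sum_comm]
    have : ∀ j, ∑ a, X (a, j) ^ 2 = l (σ j) ^ 2 / L ^ 2 := by
      intro j
      calc ∑ a, X (a, j) ^ 2 = ∑ a, l (σ j) ^ 2 / L ^ 2 * (Q a (σ j) * Q a (σ j)) :=
            Finset.sum_congr rfl fun a _ => by simp only [X]; ring
        _ = _ := by rw [← Finset.mul_sum, hQQ]; simp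
    simp only [this]
    rw [← Finset.sum_div, hsum (fun i => l i ^ 2), ← hL2, div_self (by positivity)]
  · refine ContinuousLinearMap.opNorm_le_bound _ zero_le_one fun z => ?_
    rw [one_mul, ← sq_le_sq₀ (norm_nonneg _) (norm_nonneg _), EuclideanSpace.real_norm_sq_eq,
      EuclideanSpace.real_norm_sq_eq]
    apply le_of_eq
    simp only [hUap, sq, Finset.sum_mul_sum]
    rw [Finset.sum_comm]
    refine Finset.sum_congr rfl fun i _ => ?_
    rw [Finset.sum_comm]
    calc _ = ∑ j, z i * z j * ∑ a, Q a (σ i) * Q a (σ j) := by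
          refine Finset.sum_congr rfl fun j _ => ?_
          rw [Finset.mul_sum]
          exact Finset.sum_congr rfl fun a _ => by ring
      _ = z i * z i := by simp [hQQ, hσ]
  · refine hLu.trans (le_of_eq ?_)
    rw [factorForm_apply]
    have h1 : ∀ a b, U (rowMap n T.card a X) b = ∑ i ∈ T, l i / L * Q a i * Q b i := by
      intro a b
      rw [hUap, ← hsum (fun i => l i / L * Q a i * Q b i)]
      refine Finset.sum_congr rfl fun j _ => ?_
      change Q b (σ j) * (l (σ j) * Q a (σ j) / L) = _
      ring
    calc L = L ^ 2 / L := by field_simp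
      _ = ∑ i ∈ T, l i ^ 2 / L * ∑ a, Q a i * Q a i := by
          rw [hL2, Finset.sum_div]
          exact Finset.sum_congr rfl fun i _ => by rw [hQQ]; simp
      _ = ∑ i ∈ T, l i / L * ∑ a, Q a i * ∑ b, A a b * Q b i := by
          refine Finset.sum_congr rfl fun i _ => ?_
          simp only [hAQ, Finset.mul_sum]
          exact Finset.sum_congr rfl fun a _ => by ring
      _ = ∑ a, ∑ b, ∑ i ∈ T, A a b * (l i / L * Q a i * Q b i) := by
          simp only [Finset.mul_sum]
          rw [Finset.sum_comm]
          refine Finset.sum_congr rfl fun a _ => ?_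
          rw [Finset.sum_comm]
          exact Finset.sum_congr rfl fun b _ => Finset.sum_congr rfl fun i _ => by ring
      _ = _ := by simp only [h1, Finset.mul_sum]

/-- Tail bound for the sum of squares of `k` eigenvalues of the centred adjacency matrix. -/
lemma bitProb_eigenvalues_le {n : ℕ} {p : ℝ} (h0 : 1 / 2 ≤ p) (h1 : p < 1) (k : ℕ)
    {ε : ℝ} (hε : 0 < ε) (hε2 : 2 * ε ≤ 1) {u : ℝ} (hu : 0 < u) :
    bitProb p (fun g : EdgeIdx n → Bool => ∃ T : Finset (Fin n), T.card = k ∧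
        u ^ 2 ≤ ∑ i ∈ T, (centered_isHermitian p g).eigenvalues i ^ 2) ≤
      (1 + 2 / ε) ^ (2 * (n * k)) * Real.exp (-(rateConst p * ((1 - 2 * ε) * u) ^ 2)) := by
  refine le_trans (bitProb_mono (by linarith) h1 ?_) (bitProb_factorForm_le h0 h1 k hε hε2 hu.le)
  rintro g ⟨T, rfl, hT⟩
  exact exists_factorForm_of_eigenvalues _ T hu hT

lemma bitProb_nonneg {ι : Type*} [Fintype ι] [DecidableEq ι] {p : ℝ} (h0 : 0 < p) (h1 : p < 1)
    (E : (ι → Bool) → Prop) : 0 ≤ bitProb p E :=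
  Finset.sum_nonneg fun _ _ => mul_nonneg
    (Finset.prod_nonneg fun _ _ => (bitWeight_pos h0 h1 _).le)
    (by dsimp only; split_ifs <;> norm_num)

lemma card_filter_card_true (ι : Type*) [Fintype ι] [DecidableEq ι] (m : ℕ) :
    (Finset.univ.filter fun x : ι → Bool =>
      (Finset.univ.filter fun i => x i = true).card = m).card = (Fintype.card ι).choose m := by
  rw [← Finset.card_univ, ← Finset.card_powersetCard]
  refine Finset.card_nbij' (fun x => Finset.univ.filter fun i => x i = true)
    (fun s i => decide (i ∈ s)) ?_ ?_ ?_ ?_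
  · intro x hx; simpa [Finset.mem_powersetCard] using hx
  · intro s hs; simpa [Finset.mem_powersetCard] using hs
  · intro x hx; funext i; simp
  · intro s hs; ext i; simp

section Conversion

variable {n : ℕ} {p : ℝ}

lemma prod_bitWeight_eq (g : EdgeIdx n → Bool) :
    ∏ e, bitWeight p (g e) =
      p ^ edgeCount g * (1 - p) ^ (Fintype.card (EdgeIdx n) - edgeCount g) := by
  simp only [bitWeight, Finset.prod_ite, Finset.prod_const]
  congr 2
  have := Finset.card_filter_add_card_filter_not (s := (Finset.univ : Finset (EdgeIdx n)))
    (fun e => g e = true)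
  rw [Finset.card_univ] at this
  unfold edgeCount
  omega

open Classical in
lemma bitProb_edgeCount (m : ℕ) (E : (EdgeIdx n → Bool) → Prop) :
    bitProb p (fun g => edgeCount g = m ∧ E g) =
      ((Finset.univ.filter fun g : EdgeIdx n → Bool => edgeCount g = m ∧ E g).card : ℝ) *
        (p ^ m * (1 - p) ^ (Fintype.card (EdgeIdx n) - m)) := by
  unfold bitProb bitExp
  simp only [mul_ite, mul_one, mul_zero, ← Finset.sum_filter]
  rw [← nsmul_eq_mul, ← Finset.sum_const]
  refine Finset.sum_congr (by ext; simp) fun g hg => ?_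
  rw [prod_bitWeight_eq, (Finset.mem_filter.1 hg).2.1]

lemma card_edgeCount_eq (m : ℕ) :
    (Finset.univ.filter fun g : EdgeIdx n → Bool => edgeCount g = m).card =
      (Fintype.card (EdgeIdx n)).choose m :=
  card_filter_card_true _ _

/-- Comparison of the uniform model with the Bernoulli model. -/
lemma grProb_le_bitProb (h0 : 0 < p) (h1 : p < 1) (m : ℕ) (hN : 0 < Fintype.card (EdgeIdx n))
    (pred : Matrix (Fin n) (Fin n) ℝ → Prop) {C : ℝ}
    (hC : |(m : ℝ) - p * Fintype.card (EdgeIdx n)| ≤ C) :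
    grProb n m pred ≤ (Fintype.card (EdgeIdx n) + 1) * Real.exp (C ^ 2 / (p * (1 - p))) *
      bitProb p (fun g : EdgeIdx n → Bool => edgeCount g = m ∧ pred (adjOf g)) := by
  classical
  set N := Fintype.card (EdgeIdx n) with hNdef
  have hq : 0 < 1 - p := by linarith
  have hNr : (1:ℝ) ≤ N := by exact_mod_cast hN
  rcases le_or_gt m N with hm | hm
  · have hch : (0:ℝ) < N.choose m := by exact_mod_cast Nat.choose_pos hm
    have hw : 0 < p ^ m * (1 - p) ^ (N - m) := by positivity
    have h2 := exp_bitKL_le_choose h0 h1 hN hm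
    have h3 : N * bitKL (m / N) p ≤ C ^ 2 / (p * (1 - p)) := by
      have h4 := bitKL_le_sq (r := (m:ℝ) / N) h0 h1 (by positivity)
        ((div_le_one (by linarith)).2 (by exact_mod_cast hm))
      have h5 : ((m:ℝ) / N - p) = (m - p * N) / N := by field_simp
      calc N * bitKL (m / N) p ≤ N * (((m:ℝ) / N - p) ^ 2 / (p * (1 - p))) :=
            mul_le_mul_of_nonneg_left h4 (by linarith)
        _ = ((m:ℝ) - p * N) ^ 2 / N / (p * (1 - p)) := by rw [h5]; field_simp
        _ ≤ C ^ 2 / (p * (1 - p)) := by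
            gcongr
            rw [div_le_iff₀ (by linarith)]
            have : ((m:ℝ) - p * N) ^ 2 ≤ C ^ 2 := sq_le_sq' (by linarith [(abs_le.1 hC).1])
              (abs_le.1 hC).2
            nlinarith [sq_nonneg C]
    rw [bitProb_edgeCount, grProb, card_edgeCount_eq, div_le_iff₀ hch]
    set K := ((Finset.univ.filter fun g : EdgeIdx n → Bool =>
      edgeCount g = m ∧ pred (adjOf g)).card : ℝ) with hK
    have hK0 : 0 ≤ K := by positivity
    have h6 : Real.exp (-(C ^ 2 / (p * (1 - p)))) ≤
        (N + 1) * (N.choose m * p ^ m * (1 - p) ^ (N - m)) :=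
      (Real.exp_le_exp.2 (neg_le_neg h3)).trans h2
    rw [Real.exp_neg, inv_le_iff_one_le_mul₀ (Real.exp_pos _)] at h6
    calc K = K * 1 := (mul_one _).symm
      _ ≤ K * _ := mul_le_mul_of_nonneg_left h6 hK0
      _ = _ := by ring
  · have : grProb n m pred = 0 := by
      unfold grProb
      rw [card_edgeCount_eq, Nat.choose_eq_zero_of_lt hm]
      simp
    rw [this]
    exact mul_nonneg (by positivity) (bitProb_nonneg h0 h1 _)

end Conversion

section UpperBound

variable {n : ℕ} {p : ℝ}

lemma sum_edge_centered (g : EdgeIdx n → Bool) :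
    ∑ e, ((if g e then (1:ℝ) else 0) - p) = edgeCount g - p * Fintype.card (EdgeIdx n) := by
  rw [Finset.sum_sub_distrib, Finset.sum_boole, Finset.sum_const, Finset.card_univ, nsmul_eq_mul]
  unfold edgeCount
  ring

lemma abs_centered_le (h0 : 0 < p) (h1 : p < 1) (g : EdgeIdx n → Bool) (a b : Fin n) :
    |centered p g a b| ≤ 1 := by
  rcases eq_or_ne a b with rfl | h
  · simp [centered, edgeMatrix_self]
  · rw [centered, edgeMatrix_apply _ h, abs_le]
    split_ifs <;> constructor <;> linarith

lemma sum_sq_centered_le (h0 : 0 < p) (h1 : p < 1) (g : EdgeIdx n → Bool) :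
    ∑ a, ∑ b, centered p g a b ^ 2 ≤ (n:ℝ) ^ 2 := by
  calc ∑ a, ∑ b, centered p g a b ^ 2 ≤ ∑ _a : Fin n, ∑ _b : Fin n, (1:ℝ) := by
        refine Finset.sum_le_sum fun a _ => Finset.sum_le_sum fun b _ => ?_
        rw [sq_le_one_iff_abs_le_one]
        exact abs_centered_le h0 h1 g a b
    _ = _ := by simp; ring

/-- Few triangles and the right number of edges force a negative centred cubic trace. -/
lemma trace_cube_centered_le (h0 : 0 < p) (h1 : p < 1) (hn : 3 ≤ n) (g : EdgeIdx n → Bool)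
    {C t : ℝ} (hC : |(edgeCount g : ℝ) - p * Fintype.card (EdgeIdx n)| ≤ C)
    (ht : triDensity (adjOf g) ≤ p ^ 3 - t) :
    (centered p g * centered p g * centered p g).trace ≤
      -(t * (n * (n - 1) * (n - 2))) + 6 * n * C + 3 * n ^ 2 := by
  have hnr : (3:ℝ) ≤ n := by exact_mod_cast hn
  have hpos : (0:ℝ) < n * (n - 1) * (n - 2) :=
    mul_pos (mul_pos (by linarith) (by linarith)) (by linarith)
  rw [triDensity, div_le_iff₀ hpos, adjOf_eq_edgeMatrix, trace_cube_expand _ p] at ht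
  change _ + _ * (∑ a, ∑ b, centered p g a b) + _ * ((∑ a, (∑ b, centered p g a b) ^ 2) -
    ∑ a, ∑ b, centered p g a b ^ 2) + (centered p g * centered p g * centered p g).trace ≤ _ at ht
  have h2 : ∑ a, ∑ b, centered p g a b = 2 * (edgeCount g - p * Fintype.card (EdgeIdx n)) := by
    rw [centered, sum_edgeMatrix, sum_edge_centered]
  rw [h2] at ht
  have h3 := sum_sq_centered_le h0 h1 g
  have h4 : 0 ≤ ∑ a, (∑ b, centered p g a b) ^ 2 := Finset.sum_nonneg fun _ _ => sq_nonneg _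
  have hC0 : 0 ≤ C := (abs_nonneg _).trans hC
  set d := (edgeCount g : ℝ) - p * Fintype.card (EdgeIdx n)
  have hd := (abs_le.1 hC).1
  have hp2 : p ^ 2 ≤ 1 := by nlinarith
  have h5 : -(6 * n * C) ≤ 3 * p ^ 2 * (n - 2) * (2 * d) := by
    have h6 : 3 * p ^ 2 * (n - 2) * 2 * (-C) ≤ 3 * p ^ 2 * (n - 2) * 2 * d :=
      mul_le_mul_of_nonneg_left hd
        (mul_nonneg (mul_nonneg (by positivity) (by linarith)) (by norm_num))
    have h7 : p ^ 2 * ((n - 2) * C) ≤ 1 * ((n - 2) * C) :=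
      mul_le_mul_of_nonneg_right hp2 (mul_nonneg (by linarith) hC0)
    nlinarith
  have h6 : -(3 * (n:ℝ) ^ 2) ≤ 3 * p * ((∑ a, (∑ b, centered p g a b) ^ 2) -
      ∑ a, ∑ b, centered p g a b ^ 2) := by
    have : -(n:ℝ)^2 ≤ (∑ a, (∑ b, centered p g a b) ^ 2) - ∑ a, ∑ b, centered p g a b ^ 2 := by
      linarith
    have h8 := mul_le_mul_of_nonneg_left this (show 0 ≤ 3 * p by positivity)
    nlinarith [sq_nonneg (n:ℝ)]
  nlinarith

lemma trace_cube_eq_sum_eigenvalues {A : Matrix (Fin n) (Fin n) ℝ} (hA : A.IsHermitian) :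
    (A * A * A).trace = ∑ i, hA.eigenvalues i ^ 3 := by
  have h : A * A * A = funMat hA (fun x => x * x * x) := by
    rw [← funMat_mul hA (fun x => x * x) (fun x => x), ← funMat_mul hA (fun x => x) (fun x => x),
      funMat_id]
  rw [h, trace_funMat]
  exact Finset.sum_congr rfl fun i _ => by ring

lemma abs_eigenvalue_le (h0 : 0 < p) (h1 : p < 1) (g : EdgeIdx n → Bool) (i : Fin n) :
    |(centered_isHermitian p g).eigenvalues i| ≤ n := by
  have h2 : ∑ j, (centered_isHermitian p g).eigenvalues j ^ 2 ≤ (n:ℝ) ^ 2 := by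
    rw [← sum_sq_funMat (centered_isHermitian p g) (fun x => x), funMat_id]
    exact sum_sq_centered_le h0 h1 g
  have h3 := Finset.single_le_sum (f := fun j => (centered_isHermitian p g).eigenvalues j ^ 2)
    (fun _ _ => sq_nonneg _) (Finset.mem_univ i)
  rw [← abs_of_nonneg (Nat.cast_nonneg (α := ℝ) n), ← sq_le_sq]
  exact h3.trans h2

/-- The mean of the truncated cubic trace is almost nonnegative. -/
lemma neg_le_bitExp_cubeStat (h0 : 0 < p) (h1 : p < 1) {R : ℝ} (hR : 0 ≤ R) :
    -((n:ℝ) ^ 4 * bitProb p (fun g : EdgeIdx n → Bool =>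
      ∃ i, R < |(centered_isHermitian p g).eigenvalues i|)) ≤ bitExp p (cubeStat (n := n) p R) := by
  classical
  have h2 : bitExp p (cubeStat (n := n) p R) = bitExp p (fun g => cubeStat (n := n) p R g -
      (centered p g * centered p g * centered p g).trace) := by
    rw [bitExp_sub, bitExp_trace_cube_centered, sub_zero]
  rw [h2, ← neg_mul]
  unfold bitProb
  rw [← bitExp_const_mul]
  refine bitExp_mono h0 h1 fun g => ?_
  rw [trace_cube_eq_sum_eigenvalues (centered_isHermitian p g), cubeStat, ← Finset.sum_sub_distrib]
  set l := (centered_isHermitian p g).eigenvalues with hl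
  have h3 : ∀ i, -(if R < |l i| then |l i| ^ 3 else 0) ≤ cubeTrunc R (l i) - l i ^ 3 := fun i =>
    (abs_le.1 (cubeTrunc_sub_cube_le hR (l i))).1
  refine le_trans ?_ (Finset.sum_le_sum fun i _ => h3 i)
  split_ifs with h
  · calc -(n:ℝ) ^ 4 * 1 = ∑ _i : Fin n, -((n:ℝ) ^ 3) := by simp; ring
      _ ≤ _ := by
        refine Finset.sum_le_sum fun i _ => neg_le_neg ?_
        split_ifs
        · exact pow_le_pow_left₀ (abs_nonneg _) (abs_eigenvalue_le h0 h1 g i) 3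
        · positivity
  · push Not at h
    rw [mul_zero]
    apply le_of_eq
    symm
    exact Finset.sum_eq_zero fun i _ => by rw [if_neg (not_lt.2 (h i)), neg_zero]

/-- Extraction of `k` eigenvalues with large square sum. -/
lemma exists_eigenvalue_subset (l : Fin n → ℝ) {R s r : ℝ} (hR : 0 < R) (hr : 0 ≤ r) (hrs : r ≤ s)
    {k : ℕ} (hk : k ≤ n) (hks : s ^ 2 ≤ k * R ^ 2)
    (hsum : r ^ 3 ≤ ∑ i, if R < |l i| then |l i| ^ 3 else 0) :
    ∃ T : Finset (Fin n), T.card = k ∧ r ^ 2 ≤ ∑ i ∈ T, l i ^ 2 := by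
  classical
  set S := Finset.univ.filter fun i => R < |l i| with hS
  rw [← Finset.sum_filter] at hsum
  rcases le_or_gt k S.card with h | h
  · obtain ⟨T, hTS, hT⟩ := Finset.exists_subset_card_eq h
    refine ⟨T, hT, ?_⟩
    calc r ^ 2 ≤ s ^ 2 := by gcongr
      _ ≤ k * R ^ 2 := hks
      _ = ∑ _i ∈ T, R ^ 2 := by rw [Finset.sum_const, hT, nsmul_eq_mul]
      _ ≤ _ := by
        refine Finset.sum_le_sum fun i hi => ?_
        have := (Finset.mem_filter.1 (hTS hi)).2
        rw [← sq_abs (l i)]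
        gcongr
  · obtain ⟨T, hST, -, hT⟩ := Finset.exists_subsuperset_card_eq (Finset.subset_univ S) h.le
      (by simpa using hk)
    refine ⟨T, hT, ?_⟩
    set L := Real.sqrt (∑ i ∈ T, l i ^ 2) with hL
    have hL2 : L ^ 2 = ∑ i ∈ T, l i ^ 2 :=
      Real.sq_sqrt (Finset.sum_nonneg fun _ _ => sq_nonneg _)
    have hL0 : 0 ≤ L := Real.sqrt_nonneg _
    have h2 : ∑ i ∈ T, |l i| ^ 3 ≤ L ^ 3 := by
      calc ∑ i ∈ T, |l i| ^ 3 ≤ ∑ i ∈ T, L * l i ^ 2 := by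
            refine Finset.sum_le_sum fun i hi => ?_
            have h3 : |l i| ≤ L := by
              rw [← abs_of_nonneg hL0, ← sq_le_sq, hL2]
              exact Finset.single_le_sum (f := fun i => l i ^ 2) (fun _ _ => sq_nonneg _) hi
            rw [← sq_abs (l i)]
            nlinarith [sq_nonneg (|l i|)]
        _ = L ^ 3 := by rw [← Finset.mul_sum, ← hL2]; ring
    have h3 : r ^ 3 ≤ L ^ 3 := (hsum.trans
      (Finset.sum_le_sum_of_subset_of_nonneg hST fun _ _ _ => by positivity)).trans h2
    have h4 : r ≤ L := le_of_pow_le_pow_left₀ three_ne_zero hL0 h3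
    rw [← hL2]
    gcongr

lemma bitProb_exists_eigenvalue_le (h0 : 1 / 2 ≤ p) (h1 : p < 1) {M : ℝ}
    (hM : 24 ≤ rateConst p * M ^ 2) (hM0 : 0 < M) (hn : 0 < n) :
    bitProb p (fun g : EdgeIdx n → Bool =>
      ∃ i, M * Real.sqrt n < |(centered_isHermitian p g).eigenvalues i|) ≤ Real.exp (-n) := by
  have hnr : (0:ℝ) < n := by exact_mod_cast hn
  have h2 := bitProb_eigenvalues_le (n := n) h0 h1 1 (ε := 1 / 4) (by norm_num) (by norm_num)
    (u := M * Real.sqrt n) (by positivity)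
  calc _ ≤ _ := bitProb_mono (by linarith) h1 ?_
    _ ≤ _ := h2
    _ ≤ _ := ?_
  · rintro g ⟨i, hi⟩
    refine ⟨{i}, by simp, ?_⟩
    rw [Finset.sum_singleton, ← sq_abs ((centered_isHermitian p g).eigenvalues i)]
    gcongr
  · have h9 : (1 + 2 / (1 / 4) : ℝ) ≤ Real.exp (5 / 2) := by
      have h3 : (3:ℝ) ≤ Real.exp (5 / 4) := by
        have := Real.quadratic_le_exp_of_nonneg (show (0:ℝ) ≤ 5 / 4 by norm_num)
        norm_num at this ⊢; linarith
      calc (1 + 2 / (1 / 4) : ℝ) = 3 * 3 := by norm_num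
        _ ≤ Real.exp (5 / 4) * Real.exp (5 / 4) := by gcongr
        _ = _ := by rw [← Real.exp_add]; norm_num
    calc _ ≤ Real.exp (5 / 2) ^ (2 * (n * 1)) *
          Real.exp (-(rateConst p * ((1 - 2 * (1 / 4)) * (M * Real.sqrt n)) ^ 2)) := by gcongr
      _ = Real.exp (5 * n - (rateConst p * M ^ 2) * n / 4) := by
          rw [← Real.exp_nat_mul, ← Real.exp_add]
          congr 1
          rw [mul_pow, mul_pow, Real.sq_sqrt hnr.le]
          push_cast; ring
      _ ≤ _ := by rw [Real.exp_le_exp]; nlinarith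

end UpperBound

section UpperAsymptotics

variable {n : ℕ} {p : ℝ}

/-- Lower-tail bound for the triangle density in the Bernoulli model. -/
lemma bitProb_triDensity_le (h0 : 1 / 2 ≤ p) (h1 : p < 1) (hn : 3 ≤ n) {m : ℕ} {C t s η M : ℝ}
    (hC : |(m : ℝ) - p * Fintype.card (EdgeIdx n)| ≤ C) (hs : 0 < s) (hsn : s ≤ n)
    (hη : 0 < η) (hη1 : 2 * η < 1) (hM1 : 1 ≤ M) (hM : 24 ≤ rateConst p * M ^ 2)
    (htr : -(t * (n * (n - 1) * (n - 2))) + 6 * n * C + 3 * n ^ 2 ≤ -((1 - η) * s ^ 3))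
    (hexp : (n : ℝ) ^ 4 * Real.exp (-n) ≤ η / 2 * s ^ 3) :
    bitProb p (fun g : EdgeIdx n → Bool => edgeCount g = m ∧ triDensity (adjOf g) ≤ p ^ 3 - t) ≤
      Real.exp (-(η ^ 2 * s ^ 6 / (576 * (M ^ 4 + M ^ 2) * n ^ 3))) +
      Real.exp (-(rateConst p * (1 - 2 * η) ^ 4 * s ^ 2) +
        2 * Real.log (1 + 2 / η) * (s ^ 2 / M ^ 2 + n)) := by
  have hp : 0 < p := by linarith
  have hnr : (3:ℝ) ≤ n := by exact_mod_cast hn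
  have hn0 : (0:ℝ) < n := by linarith
  have hM0 : 0 < M := by linarith
  set R := M * Real.sqrt n with hR
  have hR0 : 0 < R := by positivity
  have hR2 : R ^ 2 = M ^ 2 * n := by rw [hR, mul_pow, Real.sq_sqrt hn0.le]
  set k := ⌈s ^ 2 / R ^ 2⌉₊ with hk
  have hkn : k ≤ n := by
    rw [hk, Nat.ceil_le, div_le_iff₀ (by positivity), hR2]
    have : s ^ 2 ≤ n ^ 2 := by gcongr
    nlinarith [mul_nonneg hn0.le hn0.le, one_le_pow₀ (n := 2) hM1]
  have hks : s ^ 2 ≤ k * R ^ 2 := by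
    rw [← div_le_iff₀ (by positivity)]; exact Nat.le_ceil _
  have hnk : (n:ℝ) * k ≤ s ^ 2 / M ^ 2 + n := by
    have : (k:ℝ) ≤ s ^ 2 / R ^ 2 + 1 := (Nat.ceil_lt_add_one (by positivity)).le
    calc (n:ℝ) * k ≤ n * (s ^ 2 / R ^ 2 + 1) := mul_le_mul_of_nonneg_left this hn0.le
      _ = _ := by rw [hR2]; field_simp
  have hbad := bitProb_exists_eigenvalue_le (n := n) h0 h1 hM hM0 (by omega)
  have hmean := neg_le_bitExp_cubeStat (n := n) hp h1 hR0.le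
  have hmean2 : -(η / 2 * s ^ 3) ≤ bitExp p (cubeStat (n := n) p R) := by
    refine le_trans (neg_le_neg ?_) hmean
    exact (mul_le_mul_of_nonneg_left hbad (by positivity)).trans hexp
  calc _ ≤ bitProb p (fun g : EdgeIdx n → Bool =>
        cubeStat p R g ≤ bitExp p (cubeStat (n := n) p R) - η / 2 * s ^ 3 ∨
        ∃ T : Finset (Fin n), T.card = k ∧ ((1 - 2 * η) * s) ^ 2 ≤
          ∑ i ∈ T, (centered_isHermitian p g).eigenvalues i ^ 2) := by
        refine bitProb_mono hp h1 fun g ⟨hgm, hg⟩ => ?_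
        rw [or_iff_not_imp_left, not_le]
        intro hF
        have h2 := (trace_cube_centered_le hp h1 hn g (by rwa [hgm]) hg).trans htr
        rw [trace_cube_eq_sum_eigenvalues (centered_isHermitian p g)] at h2
        have h3 : cubeStat p R g ≤ ∑ i, (centered_isHermitian p g).eigenvalues i ^ 3 +
            ∑ i, if R < |(centered_isHermitian p g).eigenvalues i| then
              |(centered_isHermitian p g).eigenvalues i| ^ 3 else 0 := by
          rw [cubeStat, ← Finset.sum_add_distrib]
          refine Finset.sum_le_sum fun i _ => ?_
          linarith [(abs_le.1 (cubeTrunc_sub_cube_le hR0.le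
            ((centered_isHermitian p g).eigenvalues i))).2]
        have h4 : (1 - 2 * η) ^ 3 ≤ 1 - 2 * η :=
          pow_le_of_le_one (by linarith) (by linarith) three_ne_zero
        have h5 : ((1 - 2 * η) * s) ^ 3 ≤ (1 - 2 * η) * s ^ 3 := by
          rw [mul_pow]
          exact mul_le_mul_of_nonneg_right h4 (by positivity)
        refine exists_eigenvalue_subset _ hR0 (mul_nonneg (by linarith) hs.le) ?_ hkn hks
          (h5.trans ?_)
        · exact mul_le_of_le_one_left hs.le (by linarith)
        · linarith
    _ ≤ _ := bitProb_or_le hp h1 _ _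
    _ ≤ _ := by
        refine add_le_add ?_ ?_
        · refine (bitProb_cubeStat_lower_tail hp h1 (by omega) hR0
            (show 0 < η / 2 * s ^ 3 by positivity)).trans (le_of_eq ?_)
          rw [show R ^ 4 = (R ^ 2) ^ 2 by ring, hR2]
          congr 2
          field_simp; ring
        · refine (bitProb_eigenvalues_le h0 h1 k hη (by linarith)
            (show 0 < (1 - 2 * η) * s from mul_pos (by linarith) hs)).trans ?_
          have hpos : 0 < 1 + 2 / η := by positivity
          have hlog : 0 ≤ Real.log (1 + 2 / η) := Real.log_nonneg (by
            have : 0 < 2 / η := by positivity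
            linarith)
          rw [← Real.exp_log hpos, ← Real.exp_nat_mul, ← Real.exp_add, Real.exp_le_exp,
            Real.log_exp]
          have := mul_le_mul_of_nonneg_left hnk hlog
          push_cast
          nlinarith

set_option maxHeartbeats 1000000 in
/-- Asymptotic upper bound for the lower-tail probability. -/
lemma eventually_grProb_le (h0 : 1 / 2 ≤ p) (h1 : p < 1) {m : ℕ → ℕ} {C : ℝ}
    (hm : ∀ n, |(m n : ℝ) - p * Fintype.card (EdgeIdx n)| ≤ C) {s t : ℕ → ℝ}
    (hs0 : ∀ᶠ n in atTop, 0 < s n) (hsn : ∀ ε > 0, ∀ᶠ n : ℕ in atTop, s n ≤ ε * n)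
    (hs4 : ∀ K : ℝ, ∀ᶠ n : ℕ in atTop, K * (n:ℝ) ^ 3 ≤ s n ^ 4)
    (hst : ∀ᶠ n : ℕ in atTop, s n ^ 3 = t n * (n:ℝ) ^ 3) {δ : ℝ} (hδ : 0 < δ) :
    ∀ᶠ n in atTop, grProb n (m n) (fun A => triDensity A ≤ p ^ 3 - t n) ≤
      Real.exp (-((rateConst p - δ) * s n ^ 2)) := by
  have hp : 0 < p := by linarith
  have hc := rateConst_pos h0 h1
  set c := rateConst p with hcdef
  have hC0 : 0 ≤ C := (abs_nonneg _).trans (hm 0)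
  obtain ⟨η, hη, hη4, hηδ⟩ : ∃ η : ℝ, 0 < η ∧ η ≤ 1 / 4 ∧ 8 * η * c ≤ δ / 3 := by
    refine ⟨min (1 / 4) (δ / (24 * c)), by positivity, min_le_left _ _, ?_⟩
    have := min_le_right (1 / 4) (δ / (24 * c))
    rw [le_div_iff₀ (by positivity)] at this
    linarith
  set Λ := Real.log (1 + 2 / η) with hΛ
  have hΛ0 : 0 ≤ Λ := Real.log_nonneg (by
    have : 0 < 2 / η := by positivity
    linarith)
  obtain ⟨M, hM1, hM24, hMδ⟩ : ∃ M : ℝ, 1 ≤ M ∧ 24 ≤ c * M ^ 2 ∧ 2 * Λ / M ^ 2 ≤ δ / 6 := by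
    refine ⟨1 + 24 / c + 12 * Λ / δ, ?_, ?_, ?_⟩
    · have : 0 ≤ 24 / c + 12 * Λ / δ := by positivity
      linarith
    · set M := 1 + 24 / c + 12 * Λ / δ
      have h2 : 24 / c ≤ M := by
        have : 0 ≤ 12 * Λ / δ := by positivity
        simp only [M]; linarith
      have h3 : 1 ≤ M := by
        have : 0 ≤ 24 / c + 12 * Λ / δ := by positivity
        simp only [M]; linarith
      rw [div_le_iff₀ hc] at h2
      nlinarith
    · set M := 1 + 24 / c + 12 * Λ / δ
      have h2 : 12 * Λ / δ ≤ M := by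
        have : 0 ≤ 24 / c := by positivity
        simp only [M]; linarith
      have h3 : 1 ≤ M := by
        have : 0 ≤ 24 / c + 12 * Λ / δ := by positivity
        simp only [M]; linarith
      rw [div_le_iff₀ hδ] at h2
      rw [div_le_iff₀ (by positivity)]
      nlinarith
  have hM0 : 0 < M := by linarith
  set K₁ := Real.exp (C ^ 2 / (p * (1 - p))) * 2 with hK₁
  have hK₁0 : 0 < K₁ := by positivity
  set L := 12 * Λ / δ + 3 / δ * (2 * K₁ + 1) + 1 with hL
  have hL0 : 0 < L := by positivity
  filter_upwards [hs0, hsn 1 one_pos, hs4 (L ^ 2),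
    hs4 (c * (576 * (M ^ 4 + M ^ 2)) / η ^ 2), hs4 ((6 + 6 * C + 48) / η), hst,
    eventually_ge_atTop 3] with n hs hsn' hs4L hs4c hs4η hst' hn
  have hnr : (3:ℝ) ≤ n := by exact_mod_cast hn
  have hn0 : (0:ℝ) < n := by linarith
  rw [one_mul] at hsn'
  have hs2 : L * n ≤ s n ^ 2 := by
    refine le_of_sq_le_sq ?_ (by positivity)
    calc (L * n) ^ 2 = L ^ 2 * n ^ 2 := by ring
      _ ≤ L ^ 2 * n ^ 3 := by
        gcongr
        · linarith
        · norm_num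
      _ ≤ s n ^ 4 := hs4L
      _ = _ := by ring
  have hs3 : (6 + 6 * C + 48) / η * n ^ 2 ≤ s n ^ 3 := by
    have h2 : s n ^ 4 ≤ s n ^ 3 * n := by
      calc s n ^ 4 = s n ^ 3 * s n := by ring
        _ ≤ _ := by gcongr
    have h3 : (6 + 6 * C + 48) / η * n ^ 2 * n ≤ s n ^ 3 * n := by
      calc _ = (6 + 6 * C + 48) / η * (n:ℝ) ^ 3 := by ring
        _ ≤ _ := hs4η.trans h2
    exact le_of_mul_le_mul_right h3 hn0
  have hs3' : (6 + 6 * C + 48) * (n:ℝ) ^ 2 ≤ η * s n ^ 3 := by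
    rw [div_mul_eq_mul_div, div_le_iff₀ hη] at hs3
    linarith
  have ht1 : t n ≤ 1 := by
    have h2 : s n ^ 3 ≤ (n:ℝ) ^ 3 := by gcongr
    rw [hst'] at h2
    exact le_of_mul_le_mul_right (by linarith) (show (0:ℝ) < n ^ 3 by positivity)
  have ht0 : 0 ≤ t n := by
    have h2 : 0 < s n ^ 3 := by positivity
    rw [hst'] at h2
    exact (pos_of_mul_pos_left h2 (by positivity)).le
  have htr : -(t n * (n * (n - 1) * (n - 2))) + 6 * n * C + 3 * n ^ 2 ≤
      -((1 - η) * s n ^ 3) := by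
    have h2 : t n * (3 * (n:ℝ) ^ 2) ≤ 1 * (3 * (n:ℝ) ^ 2) :=
      mul_le_mul_of_nonneg_right ht1 (by positivity)
    have h3 : 6 * n * C ≤ 6 * (n:ℝ) ^ 2 * C := by
      have : (n:ℝ) ≤ n ^ 2 := by nlinarith
      nlinarith
    have h4 : t n * (n * (n - 1) * (n - 2)) = s n ^ 3 - t n * (3 * (n:ℝ) ^ 2) + 2 * (t n * n) := by
      rw [hst']; ring
    have h5 : 0 ≤ t n * n := by positivity
    have h6 : (6 + 6 * C + 48) * (n:ℝ) ^ 2 = 6 * n ^ 2 + 6 * n ^ 2 * C + 48 * n ^ 2 := by ring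
    have h7 : (1 - η) * s n ^ 3 = s n ^ 3 - η * s n ^ 3 := by ring
    have h8 : (0:ℝ) ≤ n ^ 2 := sq_nonneg _
    rw [h4, h7]
    rw [h6] at hs3'
    linarith
  have hexp : (n : ℝ) ^ 4 * Real.exp (-n) ≤ η / 2 * s n ^ 3 := by
    have h2 := Real.pow_div_factorial_le_exp (n:ℝ) hn0.le 4
    have h3 : (n : ℝ) ^ 4 * Real.exp (-n) ≤ 24 := by
      rw [Real.exp_neg, ← div_eq_mul_inv, div_le_iff₀ (Real.exp_pos _)]
      rw [div_le_iff₀ (by positivity)] at h2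
      norm_num [Nat.factorial] at h2
      linarith
    nlinarith [mul_nonneg hC0 (sq_nonneg (n:ℝ))]
  have hmain := bitProb_triDensity_le h0 h1 hn (hm n) hs hsn' hη (by linarith) hM1 hM24 htr hexp
  have hcard : (Fintype.card (EdgeIdx n) : ℝ) + 1 ≤ n ^ 2 := by
    rw [card_edgeIdx]; nlinarith
  have hcardpos : 0 < Fintype.card (EdgeIdx n) := by
    have : (0:ℝ) < Fintype.card (EdgeIdx n) := by
      rw [card_edgeIdx]
      have : (0:ℝ) < n - 1 := by linarith
      positivity
    exact_mod_cast this
  have hconv := grProb_le_bitProb hp h1 (m n) hcardpos (fun A => triDensity A ≤ p ^ 3 - t n) (hm n)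
  have hT : Real.exp (-(η ^ 2 * s n ^ 6 / (576 * (M ^ 4 + M ^ 2) * n ^ 3))) +
      Real.exp (-(c * (1 - 2 * η) ^ 4 * s n ^ 2) + 2 * Λ * (s n ^ 2 / M ^ 2 + n)) ≤
      2 * Real.exp (-((c - 2 * δ / 3) * s n ^ 2)) := by
    have e1 : (c - 2 * δ / 3) * s n ^ 2 ≤ η ^ 2 * s n ^ 6 / (576 * (M ^ 4 + M ^ 2) * n ^ 3) := by
      rw [le_div_iff₀ (by positivity)]
      rw [div_mul_eq_mul_div, div_le_iff₀ (by positivity)] at hs4c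
      have h2 : (c - 2 * δ / 3) * s n ^ 2 * (576 * (M ^ 4 + M ^ 2) * n ^ 3) ≤
          c * s n ^ 2 * (576 * (M ^ 4 + M ^ 2) * n ^ 3) := by
        gcongr
        linarith
      have h3 := mul_le_mul_of_nonneg_left hs4c (sq_nonneg (s n))
      linarith
    have e2 : -(c * (1 - 2 * η) ^ 4 * s n ^ 2) + 2 * Λ * (s n ^ 2 / M ^ 2 + n) ≤
        -((c - 2 * δ / 3) * s n ^ 2) := by
      have h2 : 1 - 8 * η ≤ (1 - 2 * η) ^ 4 := by
        have := one_add_mul_le_pow (show (-2:ℝ) ≤ -(2 * η) by linarith) 4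
        push_cast at this
        rw [← sub_eq_add_neg] at this
        linarith
      have h3 : c * (1 - 8 * η) * s n ^ 2 ≤ c * (1 - 2 * η) ^ 4 * s n ^ 2 := by gcongr
      have h4 : 2 * Λ / M ^ 2 * s n ^ 2 ≤ δ / 6 * s n ^ 2 := by gcongr
      have h5 : 2 * Λ * n ≤ δ / 6 * s n ^ 2 := by
        have h6 : 12 * Λ / δ * n ≤ s n ^ 2 := by
          refine le_trans (mul_le_mul_of_nonneg_right ?_ hn0.le) hs2
          have : 0 ≤ 3 / δ * (2 * K₁ + 1) := by positivity
          rw [hL]; linarith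
        rw [div_mul_eq_mul_div, div_le_iff₀ hδ] at h6
        linarith
      have h6 : 8 * η * c * s n ^ 2 ≤ δ / 3 * s n ^ 2 := by gcongr
      have h7 : 2 * Λ * (s n ^ 2 / M ^ 2 + n) = 2 * Λ / M ^ 2 * s n ^ 2 + 2 * Λ * n := by ring
      rw [h7]
      linarith
    have := Real.exp_le_exp.2 (neg_le_neg e1)
    have := Real.exp_le_exp.2 e2
    linarith
  have hpoly : (n:ℝ) ^ 2 * K₁ ≤ Real.exp (δ / 3 * s n ^ 2) := by
    have h2 : (2 * K₁ + 1) * n ≤ δ / 3 * s n ^ 2 := by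
      have h6 : 3 / δ * (2 * K₁ + 1) * n ≤ s n ^ 2 := by
        refine le_trans (mul_le_mul_of_nonneg_right ?_ hn0.le) hs2
        have : 0 ≤ 12 * Λ / δ := by positivity
        rw [hL]; linarith
      calc (2 * K₁ + 1) * n = δ / 3 * (3 / δ * (2 * K₁ + 1) * n) := by field_simp
        _ ≤ _ := by gcongr
    have h3 := Real.pow_div_factorial_le_exp (δ / 3 * s n ^ 2) (by positivity) 2
    rw [Nat.factorial_two, Nat.cast_two] at h3
    have h4 : ((2 * K₁ + 1) * n) ^ 2 ≤ (δ / 3 * s n ^ 2) ^ 2 := by gcongr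
    have h5 : 2 * K₁ * (n:ℝ) ^ 2 ≤ ((2 * K₁ + 1) * n) ^ 2 := by
      rw [mul_pow]
      gcongr
      nlinarith
    linarith
  calc _ ≤ _ := hconv
    _ ≤ (n:ℝ) ^ 2 * Real.exp (C ^ 2 / (p * (1 - p))) *
        (2 * Real.exp (-((c - 2 * δ / 3) * s n ^ 2))) := by
        have := bitProb_nonneg hp h1 (fun g : EdgeIdx n → Bool =>
          edgeCount g = m n ∧ triDensity (adjOf g) ≤ p ^ 3 - t n)
        gcongr
        exact hmain.trans hT
    _ = (n:ℝ) ^ 2 * K₁ * Real.exp (-((c - 2 * δ / 3) * s n ^ 2)) := by rw [hK₁]; ring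
    _ ≤ Real.exp (δ / 3 * s n ^ 2) * Real.exp (-((c - 2 * δ / 3) * s n ^ 2)) := by gcongr
    _ = _ := by rw [← Real.exp_add]; congr 1; ring

end UpperAsymptotics

section Stratified

variable {ι κ : Type*} [Fintype ι] [DecidableEq ι] [Fintype κ] [DecidableEq κ]

/-- The size of a class of the partition `β`. -/
def classCard (β : ι → κ) (j : κ) : ℕ := (Finset.univ.filter fun i => β i = j).card

/-- Bit strings with a prescribed number of ones in every class of the partition `β`. -/
def stratum (β : ι → κ) (a : κ → ℕ) : Finset (ι → Bool) :=
  Finset.univ.filter fun g => ∀ j, (Finset.univ.filter fun i => β i = j ∧ g i = true).card = a j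

lemma mem_stratum {β : ι → κ} {a : κ → ℕ} {g : ι → Bool} :
    g ∈ stratum β a ↔
      ∀ j, (Finset.univ.filter fun i => β i = j ∧ g i = true).card = a j := by
  simp [stratum]

lemma card_stratum (β : ι → κ) (a : κ → ℕ) :
    (stratum β a).card = ∏ j, (classCard β j).choose (a j) := by
  have h : ∏ j, (classCard β j).choose (a j) = (Fintype.piFinset fun j =>
      Finset.powersetCard (a j) (Finset.univ.filter fun i => β i = j)).card := by
    rw [Fintype.card_piFinset]
    simp [classCard]
  rw [h]
  refine Finset.card_nbij' (fun g j => Finset.univ.filter fun i => β i = j ∧ g i = true)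
    (fun T i => decide (i ∈ T (β i))) ?_ ?_ ?_ ?_
  · intro g hg
    rw [Finset.mem_coe, mem_stratum] at hg
    rw [Finset.mem_coe, Fintype.mem_piFinset]
    intro j
    rw [Finset.mem_powersetCard]
    refine ⟨fun i hi => ?_, hg j⟩
    simp only [Finset.mem_filter, Finset.mem_univ, true_and] at hi ⊢
    exact hi.1
  · intro T hT
    rw [Finset.mem_coe, Fintype.mem_piFinset] at hT
    rw [Finset.mem_coe, mem_stratum]
    intro j
    have h1 := Finset.mem_powersetCard.1 (hT j)
    rw [← h1.2]
    congr 1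
    ext i
    simp only [Finset.mem_filter, Finset.mem_univ, true_and, decide_eq_true_eq]
    constructor
    · rintro ⟨rfl, h⟩; exact h
    · intro h
      have : β i = j := by simpa using h1.1 h
      exact ⟨this, this ▸ h⟩
  · intro g _
    funext i
    simp
  · intro T hT
    rw [Finset.mem_coe, Fintype.mem_piFinset] at hT
    funext j
    ext i
    have h1 := Finset.mem_powersetCard.1 (hT j)
    simp only [Finset.mem_filter, Finset.mem_univ, true_and, decide_eq_true_eq]
    constructor
    · rintro ⟨rfl, h⟩; exact h
    · intro h
      have : β i = j := by simpa using h1.1 h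
      exact ⟨this, this ▸ h⟩

lemma card_stratum_swap (β : ι → κ) (a : κ → ℕ) (T : Finset ι) {e f : ι} (he : e ∉ T)
    (hf : f ∉ T) (hef : β e = β f) :
    ((stratum β a).filter fun g => (∀ i ∈ T, g i = true) ∧ g e = true).card =
      ((stratum β a).filter fun g => (∀ i ∈ T, g i = true) ∧ g f = true).card := by
  have hβ : ∀ i, β (Equiv.swap e f i) = β i := by
    intro i
    by_cases h1 : i = e
    · rw [h1, Equiv.swap_apply_left, hef]
    · by_cases h2 : i = f
      · rw [h2, Equiv.swap_apply_right, hef]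
      · rw [Equiv.swap_apply_of_ne_of_ne h1 h2]
  have hs : ∀ g ∈ stratum β a, (g ∘ Equiv.swap e f) ∈ stratum β a := by
    intro g hg
    rw [mem_stratum] at hg ⊢
    intro j
    rw [← hg j]
    refine Finset.card_equiv (Equiv.swap e f) fun i => ?_
    simp [hβ]
  have hT : ∀ g : ι → Bool, (∀ i ∈ T, g i = true) →
      ∀ i ∈ T, (g ∘ Equiv.swap e f) i = true := by
    intro g hg i hi
    rw [Function.comp_apply, Equiv.swap_apply_of_ne_of_ne]
    · exact hg i hi
    · rintro rfl; exact he hi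
    · rintro rfl; exact hf hi
  refine Finset.card_nbij' (fun g => g ∘ Equiv.swap e f) (fun g => g ∘ Equiv.swap e f) ?_ ?_ ?_ ?_
  · intro g hg
    simp only [Finset.coe_filter, Set.mem_ofPred_eq] at hg ⊢
    exact ⟨hs g hg.1, hT g hg.2.1, by simpa using hg.2.2⟩
  · intro g hg
    simp only [Finset.coe_filter, Set.mem_ofPred_eq] at hg ⊢
    exact ⟨hs g hg.1, hT g hg.2.1, by simpa using hg.2.2⟩
  · intro g _; funext i; simp
  · intro g _; funext i; simp

lemma card_stratum_insert_le (β : ι → κ) (a : κ → ℕ) (T : Finset ι) {e : ι} (he : e ∉ T) :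
    classCard β (β e) * ((stratum β a).filter fun g => ∀ i ∈ insert e T, g i = true).card ≤
      a (β e) * ((stratum β a).filter fun g => ∀ i ∈ T, g i = true).card := by
  set G := (stratum β a).filter fun g => ∀ i ∈ T, g i = true with hG
  have h1 : ∑ f ∈ Finset.univ.filter (fun f => β f = β e),
      (G.filter fun g => g f = true).card = a (β e) * G.card := by
    simp_rw [Finset.card_filter (fun g : ι → Bool => g _ = true)]
    rw [Finset.sum_comm]
    rw [mul_comm, ← smul_eq_mul, ← Finset.sum_const]
    refine Finset.sum_congr rfl fun g hg => ?_
    have hg' := mem_stratum.1 (Finset.mem_filter.1 hg).1 (β e)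
    rw [← Finset.card_filter, Finset.filter_filter]
    exact hg'
  rw [← h1, classCard, ← smul_eq_mul, ← Finset.sum_const]
  refine Finset.sum_le_sum fun f hf => ?_
  have hf' : β f = β e := by simpa using hf
  have h2 : ((stratum β a).filter fun g => ∀ i ∈ insert e T, g i = true) =
      (stratum β a).filter fun g => (∀ i ∈ T, g i = true) ∧ g e = true := by
    refine Finset.filter_congr fun g _ => ?_
    rw [Finset.forall_mem_insert, and_comm]
  rw [h2, hG, Finset.filter_filter]
  by_cases hfT : f ∈ T
  · refine Finset.card_le_card fun g hg => ?_
    simp only [Finset.mem_filter] at hg ⊢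
    exact ⟨hg.1, hg.2.1, hg.2.1 f hfT⟩
  · exact (card_stratum_swap β a T he hfT hf'.symm).le

/-- Negative correlation of the bits in a stratum. -/
lemma card_stratum_forall_le (β : ι → κ) (a : κ → ℕ) (hβ : ∀ j, 0 < classCard β j)
    (T : Finset ι) :
    (((stratum β a).filter fun g => ∀ i ∈ T, g i = true).card : ℝ) ≤
      (∏ i ∈ T, (a (β i) : ℝ) / classCard β (β i)) * (stratum β a).card := by
  induction T using Finset.induction_on with
  | empty => simp
  | insert e T he ih =>
    have h1 := card_stratum_insert_le β a T he
    have hpos : (0:ℝ) < classCard β (β e) := by exact_mod_cast hβ _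
    have h2 : (classCard β (β e) : ℝ) *
        ((stratum β a).filter fun g => ∀ i ∈ insert e T, g i = true).card ≤
        a (β e) * ((stratum β a).filter fun g => ∀ i ∈ T, g i = true).card := by
      exact_mod_cast h1
    rw [Finset.prod_insert he, mul_assoc, div_mul_eq_mul_div, le_div_iff₀ hpos, mul_comm]
    exact h2.trans (mul_le_mul_of_nonneg_left ih (by positivity))

end Stratified

section StratifiedGraphs

lemma choose_mul_pow_le_one {p : ℝ} (h0 : 0 ≤ p) (h1 : p ≤ 1) {N m : ℕ} (hm : m ≤ N) :
    (N.choose m : ℝ) * (p ^ m * (1 - p) ^ (N - m)) ≤ 1 := by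
  have hq : 0 ≤ 1 - p := by linarith
  have h3 : ∑ i ∈ Finset.range (N + 1), p ^ i * (1 - p) ^ (N - i) * (N.choose i : ℝ) = 1 := by
    rw [← add_pow]; simp
  have h4 := Finset.single_le_sum
    (f := fun i => p ^ i * (1 - p) ^ (N - i) * (N.choose i : ℝ)) (s := Finset.range (N + 1))
    (fun i _ => by positivity) (Finset.mem_range.2 (Nat.lt_succ_of_le hm))
  linarith

variable {n : ℕ} {p : ℝ} {κ : Type*} [Fintype κ] [DecidableEq κ]

lemma edgeCount_of_mem_stratum {β : EdgeIdx n → κ} {a : κ → ℕ} {g : EdgeIdx n → Bool}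
    (hg : g ∈ stratum β a) : edgeCount g = ∑ j, a j := by
  rw [mem_stratum] at hg
  unfold edgeCount
  rw [Finset.card_eq_sum_card_fiberwise (f := β) (t := Finset.univ) (fun _ _ => by simp)]
  refine Finset.sum_congr rfl fun j _ => ?_
  rw [← hg j, Finset.filter_filter]
  congr 1
  ext i; simp [and_comm]

/-- On average over a stratum, the triangle count is at most that of the density matrix. -/
lemma sum_trace_cube_stratum_le (β : EdgeIdx n → κ) (a : κ → ℕ)
    (hβ : ∀ j, 0 < classCard β j) :
    ∑ g ∈ stratum β a, (adjOf g * adjOf g * adjOf g).trace ≤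
      (edgeMatrix (fun e => (a (β e) : ℝ) / classCard β (β e)) *
        edgeMatrix (fun e => (a (β e) : ℝ) / classCard β (β e)) *
        edgeMatrix (fun e => (a (β e) : ℝ) / classCard β (β e))).trace * (stratum β a).card := by
  simp only [trace_cube, adjOf_eq_edgeMatrix]
  rw [Finset.sum_comm, Finset.sum_mul]
  refine Finset.sum_le_sum fun x _ => ?_
  rw [Finset.sum_comm, Finset.sum_mul]
  refine Finset.sum_le_sum fun y _ => ?_
  rw [Finset.sum_comm, Finset.sum_mul]
  refine Finset.sum_le_sum fun z _ => ?_
  rcases eq_or_ne x y with rfl | hxy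
  · simp [edgeMatrix_self]
  rcases eq_or_ne y z with rfl | hyz
  · simp [edgeMatrix_self]
  rcases eq_or_ne z x with rfl | hzx
  · simp [edgeMatrix_self]
  simp only [edgeMatrix_apply _ hxy, edgeMatrix_apply _ hyz, edgeMatrix_apply _ hzx]
  have h1 := edge_ne hxy hyz hzx
  have h2 := edge_ne hyz hzx hxy
  have h3 := edge_ne hzx hxy hyz
  have h := card_stratum_forall_le β a hβ {edge x y hxy, edge y z hyz, edge z x hzx}
  rw [Finset.prod_insert (by simp [h1, h3.symm]), Finset.prod_insert (by simp [h2]),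
    Finset.prod_singleton, ← mul_assoc] at h
  refine le_trans (le_of_eq ?_) h
  rw [Finset.card_filter, Nat.cast_sum]
  refine Finset.sum_congr rfl fun g _ => ?_
  simp only [Finset.forall_mem_insert, Finset.mem_singleton, forall_eq]
  by_cases e1 : g (edge x y hxy) = true <;> by_cases e2 : g (edge y z hyz) = true <;>
    by_cases e3 : g (edge z x hzx) = true <;> simp [e1, e2, e3]

lemma trace_cube_adjOf_nonneg (g : EdgeIdx n → Bool) :
    0 ≤ (adjOf g * adjOf g * adjOf g).trace := by
  have h : ∀ x y, 0 ≤ adjOf g x y := by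
    intro x y
    unfold adjOf
    simp only [Matrix.of_apply]
    split_ifs <;> norm_num
  rw [trace_cube]
  exact Finset.sum_nonneg fun x _ => Finset.sum_nonneg fun y _ => Finset.sum_nonneg fun z _ =>
    mul_nonneg (mul_nonneg (h x y) (h y z)) (h z x)

/-- Lower bound for a lower-tail probability through a single stratum. -/
lemma le_grProb_of_stratum (h0 : 0 < p) (h1 : p < 1) (hn : 3 ≤ n) {m : ℕ} {t : ℝ} (ht : 0 ≤ t)
    (β : EdgeIdx n → κ) (a : κ → ℕ) (hβ : ∀ j, 0 < classCard β j)
    (ha : ∀ j, a j ≤ classCard β j) (hm : ∑ j, a j = m)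
    (htr : (edgeMatrix (fun e => (a (β e) : ℝ) / classCard β (β e)) *
        edgeMatrix (fun e => (a (β e) : ℝ) / classCard β (β e)) *
        edgeMatrix (fun e => (a (β e) : ℝ) / classCard β (β e))).trace + 1 ≤
        (p ^ 3 - t) * (n * (n - 1) * (n - 2))) :
    ((n:ℝ) ^ 3)⁻¹ * ∏ j, (Real.exp (-(classCard β j * bitKL (a j / classCard β j) p)) /
      (classCard β j + 1)) ≤ grProb n m (fun A => triDensity A ≤ p ^ 3 - t) := by
  classical
  have hq : 0 < 1 - p := by linarith
  have hnr : (3:ℝ) ≤ n := by exact_mod_cast hn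
  have hpos : (0:ℝ) < n * (n - 1) * (n - 2) :=
    mul_pos (mul_pos (by linarith) (by linarith)) (by linarith)
  set W := (edgeMatrix (fun e => (a (β e) : ℝ) / classCard β (β e)) *
        edgeMatrix (fun e => (a (β e) : ℝ) / classCard β (β e)) *
        edgeMatrix (fun e => (a (β e) : ℝ) / classCard β (β e))).trace with hW
  set T := (p ^ 3 - t) * (n * (n - 1) * (n - 2)) with hT
  set S := stratum β a with hS
  set N := Fintype.card (EdgeIdx n) with hN
  have hN' : ∑ j, classCard β j = N := by
    rw [hN, ← Finset.card_univ,
      Finset.card_eq_sum_card_fiberwise (f := β) (t := Finset.univ) (fun _ _ => by simp)]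
    rfl
  have hmN : m ≤ N := by
    rw [← hm, ← hN']; exact Finset.sum_le_sum fun j _ => ha j
  have hSpos : (0:ℝ) < S.card := by
    have : 0 < S.card := by
      rw [hS, card_stratum]
      exact Finset.prod_pos fun j _ => Nat.choose_pos (ha j)
    exact_mod_cast this
  set good := S.filter fun g => (adjOf g * adjOf g * adjOf g).trace ≤ T with hgood
  set bad := S.filter fun g => ¬ (adjOf g * adjOf g * adjOf g).trace ≤ T with hbad
  have hsplit : (good.card : ℝ) + bad.card = S.card := by
    exact_mod_cast Finset.card_filter_add_card_filter_not (s := S) _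
  have hbadle : T * bad.card ≤ W * S.card := by
    refine le_trans ?_ (sum_trace_cube_stratum_le β a hβ)
    calc T * bad.card = ∑ g ∈ bad, T := by rw [Finset.sum_const, nsmul_eq_mul, mul_comm]
      _ ≤ ∑ g ∈ bad, (adjOf g * adjOf g * adjOf g).trace :=
          Finset.sum_le_sum fun g hg => (not_le.1 (Finset.mem_filter.1 hg).2).le
      _ ≤ _ := Finset.sum_le_sum_of_subset_of_nonneg (Finset.filter_subset _ _)
          fun g _ _ => trace_cube_adjOf_nonneg g
  have hTn : T ≤ (n:ℝ) ^ 3 := by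
    have hp3 : p ^ 3 - t ≤ 1 := by
      have : p ^ 3 ≤ 1 := pow_le_one₀ h0.le h1.le
      linarith
    have h2 : (n:ℝ) * (n - 1) * (n - 2) ≤ n ^ 3 := by nlinarith
    have := mul_le_mul_of_nonneg_right hp3 hpos.le
    linarith
  have hgoodge : (S.card : ℝ) ≤ n ^ 3 * good.card := by
    have e1 : T * good.card ≤ n ^ 3 * good.card :=
      mul_le_mul_of_nonneg_right hTn (by positivity)
    have e2 : T * (good.card + bad.card) = T * S.card := by rw [hsplit]
    have e3 : (W + 1) * S.card ≤ T * S.card := mul_le_mul_of_nonneg_right htr hSpos.le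
    linarith
  have hgr : (good.card : ℝ) / N.choose m ≤ grProb n m (fun A => triDensity A ≤ p ^ 3 - t) := by
    unfold grProb
    rw [card_edgeCount_eq]
    gcongr
    refine fun g hg => ?_
    rw [hgood, Finset.mem_filter] at hg
    simp only [Finset.mem_filter, Finset.mem_univ, true_and]
    refine ⟨(edgeCount_of_mem_stratum hg.1).trans hm, ?_⟩
    rw [triDensity, div_le_iff₀ hpos]
    exact hg.2
  refine le_trans ?_ hgr
  have hch : (0:ℝ) < N.choose m := by exact_mod_cast Nat.choose_pos hmN
  have hw : 0 < p ^ m * (1 - p) ^ (N - m) := by positivity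
  have hbin : (N.choose m : ℝ) * (p ^ m * (1 - p) ^ (N - m)) ≤ 1 :=
    choose_mul_pow_le_one h0.le h1.le hmN
  have hprod : ∏ j, (Real.exp (-(classCard β j * bitKL (a j / classCard β j) p)) /
      (classCard β j + 1)) ≤ S.card * (p ^ m * (1 - p) ^ (N - m)) := by
    have hNm : N - m = ∑ j, (classCard β j - a j) := by
      rw [Finset.sum_tsub_distrib _ (fun j _ => ha j), hN', hm]
    rw [hS, card_stratum, hNm, ← hm, ← Finset.prod_pow_eq_pow_sum, ← Finset.prod_pow_eq_pow_sum,
      Nat.cast_prod, ← Finset.prod_mul_distrib, ← Finset.prod_mul_distrib]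
    refine Finset.prod_le_prod (fun j _ => by positivity) fun j _ => ?_
    rw [div_le_iff₀ (by positivity)]
    refine (exp_bitKL_le_choose h0 h1 (hβ j) (ha j)).trans (le_of_eq ?_)
    ring
  have hn3 : (0:ℝ) < (n:ℝ) ^ 3 := by positivity
  rw [inv_mul_eq_div, div_le_div_iff₀ hn3 hch]
  calc _ ≤ S.card * (p ^ m * (1 - p) ^ (N - m)) * (N.choose m : ℝ) := by gcongr
    _ = S.card * (N.choose m * (p ^ m * (1 - p) ^ (N - m))) := by ring
    _ ≤ S.card * 1 := by gcongr
    _ ≤ good.card * n ^ 3 := by linarith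

end StratifiedGraphs

section Block

variable {n : ℕ}

/-- The class of an edge relative to the vertex set `{v | v < k}`: `0` inside the set, `1` across
its boundary and `2` outside. -/
def blockClass (k : ℕ) (e : EdgeIdx n) : Fin 3 :=
  if (e.1.2 : ℕ) < k then 0 else if (e.1.1 : ℕ) < k then 1 else 2

/-- The indicator of the vertex set `{v | v < k}`. -/
def blockInd (k : ℕ) (a : Fin n) : ℝ := if (a : ℕ) < k then 1 else 0

lemma sum_blockInd {k : ℕ} (hk : k ≤ n) : ∑ a : Fin n, blockInd k a = k := by
  unfold blockInd
  rw [Fin.sum_univ_eq_sum_range (fun a => if a < k then (1:ℝ) else 0) n, Finset.sum_boole]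
  congr 1
  rw [show (Finset.range n).filter (fun a => a < k) = Finset.range k by
    ext a; simp only [Finset.mem_filter, Finset.mem_range]; omega, Finset.card_range]

lemma blockInd_eq (k : ℕ) (a : Fin n) : blockInd k a = 0 ∨ blockInd k a = 1 := by
  unfold blockInd; split_ifs <;> simp

lemma edgeMatrix_block (k : ℕ) (f : Fin 3 → ℝ) (a b : Fin n) :
    edgeMatrix (fun e => f (blockClass k e)) a b =
      (blockInd k a * blockInd k b * f 0 +
        (blockInd k a * (1 - blockInd k b) + (1 - blockInd k a) * blockInd k b) * f 1 +
        (1 - blockInd k a) * (1 - blockInd k b) * f 2) * (1 - if a = b then 1 else 0) := by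
  rcases eq_or_ne a b with rfl | hab
  · simp [edgeMatrix_self]
  rw [edgeMatrix_apply _ hab, if_neg hab]
  have key : ∀ x y : Fin n, x < y → ∀ e : EdgeIdx n, e.1 = (x, y) → f (blockClass k e) =
      blockInd k x * blockInd k y * f 0 +
        (blockInd k x * (1 - blockInd k y) + (1 - blockInd k x) * blockInd k y) * f 1 +
        (1 - blockInd k x) * (1 - blockInd k y) * f 2 := by
    intro x y hxy e he
    unfold blockClass blockInd
    rw [he]
    have hxy' : (x : ℕ) < y := hxy
    by_cases h1 : (y : ℕ) < k
    · have h2 : (x : ℕ) < k := by omega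
      simp [h1, h2]
    · by_cases h2 : (x : ℕ) < k <;> simp [h1, h2]
  rcases lt_or_gt_of_ne hab with h | h
  · rw [key a b h _ (by simp [edge, h])]; ring
  · rw [key b a h _ (by simp [edge, h.not_gt])]; ring

lemma sum_row_block {k : ℕ} (hk : k ≤ n) (f : Fin 3 → ℝ) (a : Fin n) :
    ∑ b, edgeMatrix (fun e => f (blockClass k e)) a b =
      blockInd k a * ((k - 1) * f 0 + (n - k) * f 1) +
        (1 - blockInd k a) * (k * f 1 + (n - k - 1) * f 2) := by
  have h : ∀ b, edgeMatrix (fun e => f (blockClass k e)) a b =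
      (blockInd k a * f 1 + (1 - blockInd k a) * f 2) +
      (blockInd k a * f 0 - blockInd k a * f 1 + (1 - blockInd k a) * f 1
        - (1 - blockInd k a) * f 2) * blockInd k b -
      if a = b then (blockInd k a * f 0 + (1 - blockInd k a) * f 2) else 0 := by
    intro b
    rw [edgeMatrix_block]
    by_cases hab : a = b
    · subst hab
      rcases blockInd_eq k a with h | h <;> simp [h]
    · simp [hab]; ring
  simp_rw [h]
  rw [Finset.sum_sub_distrib, Finset.sum_add_distrib, ← Finset.mul_sum, sum_blockInd hk]
  simp only [Finset.sum_const, Finset.card_univ, Fintype.card_fin, nsmul_eq_mul,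
    Finset.sum_ite_eq, Finset.mem_univ, if_true]
  ring

lemma sum_blockInd_mul {k : ℕ} (hk : k ≤ n) (x y : ℝ) :
    ∑ a : Fin n, (blockInd k a * x + (1 - blockInd k a) * y) = k * x + (n - k) * y := by
  rw [Finset.sum_add_distrib, ← Finset.sum_mul, ← Finset.sum_mul, Finset.sum_sub_distrib,
    sum_blockInd hk]
  simp

lemma sum_block {k : ℕ} (hk : k ≤ n) (f : Fin 3 → ℝ) :
    ∑ a, ∑ b, edgeMatrix (n := n) (fun e => f (blockClass k e)) a b =
      k * ((k - 1) * f 0 + (n - k) * f 1) + (n - k) * (k * f 1 + (n - k - 1) * f 2) := by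
  simp_rw [sum_row_block hk]
  exact sum_blockInd_mul hk _ _

lemma sum_row_sq_block {k : ℕ} (hk : k ≤ n) (f : Fin 3 → ℝ) :
    ∑ a, (∑ b, edgeMatrix (n := n) (fun e => f (blockClass k e)) a b) ^ 2 =
      k * ((k - 1) * f 0 + (n - k) * f 1) ^ 2 +
        (n - k) * (k * f 1 + (n - k - 1) * f 2) ^ 2 := by
  simp_rw [sum_row_block hk]
  rw [← sum_blockInd_mul hk]
  refine Finset.sum_congr rfl fun a _ => ?_
  rcases blockInd_eq k a with h | h <;> simp [h]

lemma classCard_block {k : ℕ} (hk : k ≤ n) (j : Fin 3) :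
    (classCard (blockClass (n := n) k) j : ℝ) =
      ![(k:ℝ) * (k - 1) / 2, k * (n - k), (n - k) * (n - k - 1) / 2] j := by
  have h := sum_edgeMatrix (n := n) (fun e => (Pi.single j 1 : Fin 3 → ℝ) (blockClass k e))
  rw [sum_block hk] at h
  have h2 : ∑ e : EdgeIdx n, (Pi.single j 1 : Fin 3 → ℝ) (blockClass k e) =
      classCard (blockClass (n := n) k) j := by
    simp only [Pi.single_apply, Finset.sum_boole, classCard]
  rw [h2] at h
  fin_cases j <;> simp at h ⊢ <;> linarith

lemma trace_cube_block_le {k : ℕ} (hk : k ≤ n) {f : Fin 3 → ℝ} (hf0 : f 0 ≤ 0)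
    (hf2 : f 2 ≤ 0) :
    (edgeMatrix (n := n) (fun e => f (blockClass k e)) * edgeMatrix (fun e => f (blockClass k e)) *
      edgeMatrix (fun e => f (blockClass k e))).trace ≤ f 0 ^ 3 * (k ^ 3 - 3 * k ^ 2) := by
  have e0 : f 0 ^ 3 ≤ 0 := by
    rw [pow_succ]; exact mul_nonpos_of_nonneg_of_nonpos (sq_nonneg _) hf0
  have e2 : f 2 ^ 3 ≤ 0 := by
    rw [pow_succ]; exact mul_nonpos_of_nonneg_of_nonpos (sq_nonneg _) hf2
  have e3 : f 0 * f 1 ^ 2 ≤ 0 := mul_nonpos_of_nonpos_of_nonneg hf0 (sq_nonneg _)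
  have e4 : f 1 ^ 2 * f 2 ≤ 0 := mul_nonpos_of_nonneg_of_nonpos (sq_nonneg _) hf2
  set u : Fin n → ℝ := blockInd k with hu
  have hbound : ∀ a b c : Fin n, edgeMatrix (fun e => f (blockClass k e)) a b *
      edgeMatrix (fun e => f (blockClass k e)) b c * edgeMatrix (fun e => f (blockClass k e)) c a ≤
      f 0 ^ 3 * (u a * u b * u c - (if a = b then u a * u c else 0) -
        (if b = c then u a * u b else 0) - (if a = c then u a * u b else 0)) := by
    intro a b c
    have hpos : ∀ r : ℝ, r ≤ 0 → 0 ≤ f 0 ^ 3 * r := fun r hr => mul_nonneg_of_nonpos_of_nonpos e0 hr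
    have hu01 : ∀ a, 0 ≤ u a ∧ u a ≤ 1 := by
      intro a; rcases blockInd_eq k a with h | h <;> rw [← hu] at h <;> rw [h] <;> norm_num
    have hmul : ∀ a b, 0 ≤ u a * u b := fun a b => mul_nonneg (hu01 a).1 (hu01 b).1
    have hite : ∀ (P : Prop) [Decidable P] (a b : Fin n), 0 ≤ if P then u a * u b else 0 := by
      intro P _ a b; split_ifs
      · exact hmul a b
      · exact le_rfl
    have hle : ∀ a b c, u a * u b * u c ≤ u a * u b := fun a b c =>
      mul_le_of_le_one_right (hmul a b) (hu01 c).2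
    by_cases hab : a = b
    · subst hab
      rw [edgeMatrix_self, zero_mul, zero_mul, if_pos rfl]
      refine hpos _ ?_
      have h1 := hite (a = c) a a
      have h2 : u a * u a * u c ≤ u a * u c :=
        mul_le_mul_of_nonneg_right (mul_le_of_le_one_left (hu01 a).1 (hu01 a).2) (hu01 c).1
      linarith
    by_cases hbc : b = c
    · subst hbc
      rw [edgeMatrix_self, mul_zero, zero_mul, if_pos rfl, if_neg hab]
      refine hpos _ ?_
      linarith [hle a b b]
    by_cases hac : a = c
    · subst hac
      rw [edgeMatrix_self, mul_zero, if_pos rfl, if_neg hab, if_neg hbc]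
      refine hpos _ ?_
      linarith [hle a b a]
    rw [edgeMatrix_block, edgeMatrix_block, edgeMatrix_block, ← hu]
    rw [if_neg hab, if_neg hbc, if_neg hac, if_neg (Ne.symm hac), if_neg hab, if_neg hbc]
    rcases blockInd_eq k a with ha | ha <;> rcases blockInd_eq k b with hb | hb <;>
      rcases blockInd_eq k c with hc | hc <;> rw [← hu] at ha hb hc <;>
      rw [ha, hb, hc] <;> linarith
  rw [trace_cube]
  calc _ ≤ ∑ a, ∑ b, ∑ c, f 0 ^ 3 * (u a * u b * u c - (if a = b then u a * u c else 0) -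
        (if b = c then u a * u b else 0) - (if a = c then u a * u b else 0)) :=
        Finset.sum_le_sum fun a _ => Finset.sum_le_sum fun b _ => Finset.sum_le_sum fun c _ =>
          hbound a b c
    _ = _ := by
      have hs := sum_blockInd hk
      rw [← hu] at hs
      have h1 : ∑ a, ∑ b, ∑ c, u a * u b * u c = (k:ℝ) ^ 3 := by
        simp_rw [← Finset.mul_sum, hs, ← Finset.sum_mul, ← Finset.mul_sum, hs,
          ← Finset.sum_mul, hs]
        ring
      have h2 : ∑ a, ∑ b, ∑ c, (if a = b then u a * u c else 0) = (k:ℝ) ^ 2 := by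
        have : ∀ a b : Fin n, ∑ c, (if a = b then u a * u c else 0) =
            if a = b then u a * k else 0 := by
          intro a b; split_ifs
          · rw [← Finset.mul_sum, hs]
          · simp
        simp_rw [this, Finset.sum_ite_eq, Finset.mem_univ, if_true, ← Finset.sum_mul, hs]
        ring
      have h3 : ∑ a, ∑ b, ∑ c, (if b = c then u a * u b else 0) = (k:ℝ) ^ 2 := by
        simp_rw [Finset.sum_ite_eq, Finset.mem_univ, if_true, ← Finset.mul_sum, hs,
          ← Finset.sum_mul, hs]
        ring
      have h4 : ∑ a, ∑ b, ∑ c, (if a = c then u a * u b else 0) = (k:ℝ) ^ 2 := by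
        simp_rw [Finset.sum_ite_eq, Finset.mem_univ, if_true, ← Finset.mul_sum, hs,
          ← Finset.sum_mul, hs]
        ring
      have h5 : ∑ a, ∑ b, ∑ c, f 0 ^ 3 * (u a * u b * u c - (if a = b then u a * u c else 0) -
          (if b = c then u a * u b else 0) - (if a = c then u a * u b else 0)) =
          f 0 ^ 3 * ((∑ a, ∑ b, ∑ c, u a * u b * u c) -
            (∑ a, ∑ b, ∑ c, if a = b then u a * u c else 0) -
            (∑ a, ∑ b, ∑ c, if b = c then u a * u b else 0) -
            ∑ a, ∑ b, ∑ c, if a = c then u a * u b else 0) := by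
        simp only [← Finset.sum_sub_distrib, Finset.mul_sum]
      rw [h5, h1, h2, h3, h4]
      ring

end Block

section BlockProbability

variable {n : ℕ} {p : ℝ}

lemma trace_cube_density_block_le (h0 : 0 ≤ p) (h1 : p ≤ 1) {k : ℕ} (hk : 1 ≤ k) (hkn : k < n)
    (hn : 2 ≤ n) {ρ : Fin 3 → ℝ} (hρ0 : ρ 0 ≤ p) (hρ2 : ρ 2 ≤ p) {C : ℝ}
    (hrow : |(k:ℝ) * (k - 1) * (ρ 0 - p) + k * (n - k) * (ρ 1 - p)| ≤ 1)
    (hsum : |(k:ℝ) * (k - 1) / 2 * (ρ 0 - p) + k * (n - k) * (ρ 1 - p) +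
      (n - k) * (n - k - 1) / 2 * (ρ 2 - p)| ≤ C) :
    (edgeMatrix (n := n) (fun e => ρ (blockClass k e)) * edgeMatrix (fun e => ρ (blockClass k e)) *
      edgeMatrix (fun e => ρ (blockClass k e))).trace ≤
      p ^ 3 * (n * (n - 1) * (n - 2)) + 6 * C * n + 3 * (1 + (2 * C + 1) ^ 2) +
        (ρ 0 - p) ^ 3 * (k ^ 3 - 3 * k ^ 2) := by
  have hkr : (1:ℝ) ≤ k := by exact_mod_cast hk
  have hkn' : (k:ℝ) + 1 ≤ n := by exact_mod_cast hkn
  have hnr : (2:ℝ) ≤ n := by exact_mod_cast hn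
  set f : Fin 3 → ℝ := fun j => ρ j - p with hf
  have hC0 : 0 ≤ C := (abs_nonneg _).trans hsum
  have h2 := trace_cube_block_le (n := n) hkn.le (f := f) (sub_nonpos.2 hρ0) (sub_nonpos.2 hρ2)
  have h3 := sum_block (n := n) hkn.le f
  have h4 := sum_row_sq_block (n := n) hkn.le f
  have h5 : 0 ≤ ∑ a, ∑ b, edgeMatrix (n := n) (fun e => f (blockClass k e)) a b ^ 2 :=
    Finset.sum_nonneg fun _ _ => Finset.sum_nonneg fun _ _ => sq_nonneg _
  rw [trace_cube_expand _ p]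
  change _ + _ * (∑ a, ∑ b, edgeMatrix (n := n) (fun e => f (blockClass k e)) a b) + _ *
    ((∑ a, (∑ b, edgeMatrix (n := n) (fun e => f (blockClass k e)) a b) ^ 2) -
      ∑ a, ∑ b, edgeMatrix (n := n) (fun e => f (blockClass k e)) a b ^ 2) +
    (edgeMatrix (n := n) (fun e => f (blockClass k e)) *
      edgeMatrix (fun e => f (blockClass k e)) *
      edgeMatrix (fun e => f (blockClass k e))).trace ≤ _
  rw [h3, h4]
  change |(k:ℝ) * (k - 1) * f 0 + k * (n - k) * f 1| ≤ 1 at hrow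
  change |(k:ℝ) * (k - 1) / 2 * f 0 + k * (n - k) * f 1 +
      (n - k) * (n - k - 1) / 2 * f 2| ≤ C at hsum
  change _ ≤ _ + f 0 ^ 3 * _
  set r1 := ((k:ℝ) - 1) * f 0 + (n - k) * f 1 with hr1
  set r2 := (k:ℝ) * f 1 + (n - k - 1) * f 2 with hr2
  have e1 : |k * r1| ≤ 1 := by
    rw [hr1]; convert hrow using 2; ring
  have e2 : |k * r1 + (n - k) * r2| ≤ 2 * C := by
    have : k * r1 + (n - k) * r2 = 2 * ((k:ℝ) * (k - 1) / 2 * f 0 + k * (n - k) * f 1 +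
      (n - k) * (n - k - 1) / 2 * f 2) := by rw [hr1, hr2]; ring
    rw [this, abs_mul, abs_two]
    linarith
  have e3 : |(n - k) * r2| ≤ 2 * C + 1 := by
    rw [abs_le] at e1 e2 ⊢
    constructor <;> linarith
  have sq_le : ∀ (a r B : ℝ), 1 ≤ a → |a * r| ≤ B → a * r ^ 2 ≤ B ^ 2 := by
    intro a r B ha hB
    have : (a * r) ^ 2 ≤ B ^ 2 := sq_le_sq' (by linarith [(abs_le.1 hB).1]) (abs_le.1 hB).2
    have h6 : a * r ^ 2 ≤ a * (a * r ^ 2) := le_mul_of_one_le_left (by positivity) ha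
    linarith
  have f1 := sq_le k r1 1 hkr e1
  have f2 := sq_le (n - k) r2 _ (by linarith) e3
  have g1 : 3 * p ^ 2 * ((n:ℝ) - 2) * (k * r1 + (n - k) * r2) ≤ 6 * C * n := by
    have hp2 : p ^ 2 ≤ 1 := pow_le_one₀ h0 h1
    have hd : k * r1 + (n - k) * r2 ≤ 2 * C := (abs_le.1 e2).2
    calc 3 * p ^ 2 * ((n:ℝ) - 2) * (k * r1 + (n - k) * r2) ≤ 3 * p ^ 2 * ((n:ℝ) - 2) * (2 * C) :=
          mul_le_mul_of_nonneg_left hd (mul_nonneg (by positivity) (by linarith))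
      _ = p ^ 2 * (6 * C * (n - 2)) := by ring
      _ ≤ 1 * (6 * C * (n - 2)) :=
          mul_le_mul_of_nonneg_right hp2 (mul_nonneg (by positivity) (by linarith))
      _ ≤ 6 * C * n := by linarith
  have g2 : 3 * p * ((k * r1 ^ 2 + (n - k) * r2 ^ 2) -
      ∑ a, ∑ b, edgeMatrix (n := n) (fun e => f (blockClass k e)) a b ^ 2) ≤
      3 * (1 + (2 * C + 1) ^ 2) := by
    calc _ ≤ 3 * p * (1 + (2 * C + 1) ^ 2) :=
          mul_le_mul_of_nonneg_left (by linarith) (by positivity)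
      _ ≤ 3 * 1 * (1 + (2 * C + 1) ^ 2) := by gcongr
      _ = _ := by ring
  linarith

lemma pow_three_block_le {x D N k : ℝ} (hk : 4 ≤ k) (hN : N = k * (k - 1) / 2)
    (hD : 1 ≤ D * (k - 3)) (hx0 : 0 ≤ x) (hxN : D * N - 1 ≤ x * N) :
    (D * (k - 3) - 1) ^ 3 ≤ x ^ 3 * (k ^ 3 - 3 * k ^ 2) := by
  have hNpos : 0 < N := by rw [hN]; nlinarith
  have h6 : D * (k - 3) - 1 ≤ x * (k - 3) := by
    have h7 : (k - 3) * (D * N - 1) ≤ (k - 3) * (x * N) :=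
      mul_le_mul_of_nonneg_left hxN (by linarith)
    have h8 : k - 3 ≤ N := by rw [hN]; nlinarith
    have h9 : (D * (k - 3) - 1) * N ≤ x * (k - 3) * N := by linarith
    exact le_of_mul_le_mul_right h9 hNpos
  have h7 : (D * (k - 3) - 1) ^ 3 ≤ (x * (k - 3)) ^ 3 := pow_le_pow_left₀ (by linarith) h6 3
  have h8 : (k - 3) ^ 3 ≤ k ^ 3 - 3 * k ^ 2 := by nlinarith
  have h9 : x ^ 3 * (k - 3) ^ 3 ≤ x ^ 3 * (k ^ 3 - 3 * k ^ 2) :=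
    mul_le_mul_of_nonneg_left h8 (by positivity)
  rw [mul_pow] at h7
  linarith

lemma mul_bitKL_le (h0 : 0 < p) (h1 : p < 1) {M r y L B : ℝ} (hM : 0 < M) (hL : 0 < L)
    (hLM : L ≤ M) (hr0 : 0 ≤ r) (hr1 : r ≤ 1) (hy : M * (r - p) = y) (hyB : |y| ≤ B) :
    M * bitKL r p ≤ B ^ 2 / L / (p * (1 - p)) := by
  have hp1 : 0 < 1 - p := by linarith
  have e2 : y ^ 2 ≤ B ^ 2 := sq_le_sq' (by linarith [(abs_le.1 hyB).1]) (abs_le.1 hyB).2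
  calc M * bitKL r p ≤ M * ((r - p) ^ 2 / (p * (1 - p))) :=
        mul_le_mul_of_nonneg_left (bitKL_le_sq h0 h1 hr0 hr1) hM.le
    _ = y ^ 2 / M / (p * (1 - p)) := by rw [← hy]; field_simp
    _ ≤ _ := by gcongr

lemma block_error_le {k x c : ℝ} (hc : 0 < c) (hk0 : 0 < k) (hkx : 4 * k ≤ x) :
    (k ^ 2) ^ 2 / (k * x / 2) / c + (k ^ 2) ^ 2 / (x ^ 2 / 8) / c ≤ 4 * k ^ 3 / (x * c) := by
  have hx0 : 0 < x := by linarith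
  have e1 : (k ^ 2) ^ 2 / (k * x / 2) / c = 2 * k ^ 3 / (x * c) := by
    field_simp
  have e2 : (k ^ 2) ^ 2 / (x ^ 2 / 8) / c = (8 * k / x) * k ^ 3 / (x * c) := by
    field_simp
  have e3 : 8 * k / x ≤ 2 := by rw [div_le_iff₀ hx0]; linarith
  rw [e1, e2]
  calc _ ≤ 2 * k ^ 3 / (x * c) + 2 * k ^ 3 / (x * c) := by gcongr
    _ = _ := by ring

set_option maxHeartbeats 1000000 in
/-- Lower bound for the lower tail obtained from a sparse block on `k` vertices. -/
lemma le_grProb_block (h0 : 1 / 2 ≤ p) (h1 : p < 1) {q : ℝ} (hq0 : 0 < q) (hqp : q < p)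
    {k m : ℕ} {C t : ℝ} (ht : 0 ≤ t) (hk : 4 ≤ k) (hkn : 4 * k ≤ n)
    (hC : |(m : ℝ) - p * Fintype.card (EdgeIdx n)| ≤ C)
    (hN1 : C + 1 ≤ (p - q) * (k * (k - 1) / 2)) (hN2 : 2 * k ≤ (1 - p) * n)
    (hD : 1 ≤ (p - q) * (k - 3))
    (htr : t * n ^ 3 + 6 * C * n + 3 * (1 + (2 * C + 1) ^ 2) + 1 ≤ ((p - q) * (k - 3) - 1) ^ 3) :
    ((n:ℝ) ^ 9)⁻¹ * Real.exp (-((k:ℝ) ^ 2 / 2 * bitKL q p + 4 * k ^ 3 / (n * (p * (1 - p))))) ≤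
      grProb n m (fun A => triDensity A ≤ p ^ 3 - t) := by
  have hp : 0 < p := by linarith
  have hp1 : 0 < 1 - p := by linarith
  have hkr : (4:ℝ) ≤ k := by exact_mod_cast hk
  have hknr : 4 * (k:ℝ) ≤ n := by exact_mod_cast hkn
  have hkn' : k ≤ n := by omega
  have hC0 : 0 ≤ C := (abs_nonneg _).trans hC
  obtain ⟨N1, hN1def⟩ : ∃ x : ℝ, x = k * (k - 1) / 2 := ⟨_, rfl⟩
  rw [← hN1def] at hN1
  obtain ⟨N2, hN2def⟩ : ∃ x : ℝ, x = k * (n - k) := ⟨_, rfl⟩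
  obtain ⟨N3, hN3def⟩ : ∃ x : ℝ, x = (n - k) * (n - k - 1) / 2 := ⟨_, rfl⟩
  have c0 : (classCard (blockClass (n := n) k) 0 : ℝ) = N1 :=
    (classCard_block hkn' 0).trans hN1def.symm
  have c1 : (classCard (blockClass (n := n) k) 1 : ℝ) = N2 :=
    (classCard_block hkn' 1).trans hN2def.symm
  have c2 : (classCard (blockClass (n := n) k) 2 : ℝ) = N3 :=
    (classCard_block hkn' 2).trans hN3def.symm
  have hN : (Fintype.card (EdgeIdx n) : ℝ) = N1 + N2 + N3 := by
    rw [card_edgeIdx, hN1def, hN2def, hN3def]; ring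
  have bN1 : 2 * N1 ≤ (k:ℝ) ^ 2 - k := by rw [hN1def]; linarith
  have bN1' : 6 ≤ N1 := by rw [hN1def]; nlinarith
  have bN2 : (k:ℝ) * n / 2 ≤ N2 := by rw [hN2def]; nlinarith
  have bN3 : (n:ℝ) ^ 2 / 8 ≤ N3 := by
    rw [hN3def]
    have : (3 / 4 * (n:ℝ)) * (n / 2) ≤ (n - k) * (n - k - 1) :=
      mul_le_mul (by linarith) (by linarith) (by linarith) (by linarith)
    nlinarith only [this, sq_nonneg (n:ℝ)]
  have hnk : 16 * (k:ℝ) ^ 2 ≤ n ^ 2 := by nlinarith only [hkr, hknr]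
  obtain ⟨a, ha1, ha2⟩ : ∃ a : ℕ, q * N1 ≤ a ∧ (a:ℝ) ≤ q * N1 + 1 :=
    ⟨⌈q * N1⌉₊, Nat.le_ceil _,
      (Nat.ceil_lt_add_one (mul_nonneg hq0.le (by linarith))).le⟩
  set y1 := p * N1 - a with hy1
  have y1u : y1 ≤ (p - q) * N1 := by rw [hy1]; linarith
  have y1l : C ≤ y1 := by rw [hy1]; linarith
  have hpqN : (p - q) * N1 ≤ 1 * N1 := mul_le_mul_of_nonneg_right (by linarith) (by linarith)
  obtain ⟨b, hb1, hb2⟩ : ∃ b : ℕ, p * N2 + 2 * y1 ≤ b ∧ (b:ℝ) ≤ p * N2 + 2 * y1 + 1 :=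
    ⟨⌈p * N2 + 2 * y1⌉₊, Nat.le_ceil _, (Nat.ceil_lt_add_one (by
      have : 0 ≤ N2 := le_trans (by positivity) bN2
      have : 0 ≤ y1 := by linarith
      positivity)).le⟩
  obtain ⟨hm1, hm2⟩ := abs_le.1 hC
  rw [hN] at hm1 hm2
  have hpN3 : (n:ℝ) ^ 2 / 16 ≤ p * N3 := by
    have : 1 / 2 * N3 ≤ p * N3 := mul_le_mul_of_nonneg_right h0 (le_trans (by positivity) bN3)
    linarith
  have habm : a + b ≤ m := by
    have : (a:ℝ) + b ≤ m := by linarith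
    exact_mod_cast this
  obtain ⟨c, rfl⟩ := Nat.exists_eq_add_of_le habm
  push_cast at hm1 hm2
  set d := (a:ℝ) + b + c - p * (N1 + N2 + N3) with hd
  have hNpos1 : 0 < N1 := by linarith
  have hn0 : (0:ℝ) < n := by linarith
  have hNpos2 : 0 < N2 := lt_of_lt_of_le (by positivity) bN2
  have hNpos3 : 0 < N3 := lt_of_lt_of_le (by positivity) bN3
  have haN : (a:ℝ) ≤ p * N1 := by linarith
  have hbN : (b:ℝ) ≤ N2 := by
    have e1 : (k:ℝ) * k ≤ k * ((1 - p) * (n - k)) := by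
      refine mul_le_mul_of_nonneg_left ?_ (by positivity)
      have : (1 - p) * (n / 2) ≤ (1 - p) * (n - k) :=
        mul_le_mul_of_nonneg_left (by linarith) hp1.le
      linarith
    have e2 : k * ((1 - p) * (n - k)) = (1 - p) * N2 := by rw [hN2def]; ring
    rw [e2] at e1
    have e3 : (k:ℝ) * k = k ^ 2 := by ring
    linarith only [hb2, e1, e3, y1u, hpqN, bN1, hkr]
  have hcN : (c:ℝ) ≤ p * N3 := by linarith
  let α : Fin 3 → ℕ := ![a, b, c]
  have s0 : (a:ℝ) / N1 - p = -y1 / N1 := by rw [hy1]; field_simp; ring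
  have s1 : (b:ℝ) / N2 - p = (b - p * N2) / N2 := by field_simp
  have s2 : (c:ℝ) / N3 - p = (c - p * N3) / N3 := by field_simp
  have hβ : ∀ j, 0 < classCard (blockClass (n := n) k) j := by
    intro j
    have : (0:ℝ) < classCard (blockClass (n := n) k) j := by
      fin_cases j
      · exact c0 ▸ hNpos1
      · exact c1 ▸ hNpos2
      · exact c2 ▸ hNpos3
    exact_mod_cast this
  have hpN1 : p * N1 ≤ N1 := mul_le_of_le_one_left hNpos1.le h1.le
  have hpN3' : p * N3 ≤ N3 := mul_le_of_le_one_left hNpos3.le h1.le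
  have hα : ∀ j, α j ≤ classCard (blockClass (n := n) k) j := by
    intro j
    have : (α j : ℝ) ≤ classCard (blockClass (n := n) k) j := by
      fin_cases j
      · change (a:ℝ) ≤ classCard (blockClass (n := n) k) 0; rw [c0]; linarith
      · change (b:ℝ) ≤ classCard (blockClass (n := n) k) 1; rw [c1]; exact hbN
      · change (c:ℝ) ≤ classCard (blockClass (n := n) k) 2; rw [c2]; linarith
    exact_mod_cast this
  set ρ : Fin 3 → ℝ := fun j => (α j : ℝ) / classCard (blockClass (n := n) k) j with hρ
  have r0 : ρ 0 = a / N1 := by rw [← c0]; rfl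
  have r1 : ρ 1 = b / N2 := by rw [← c1]; rfl
  have r2 : ρ 2 = c / N3 := by rw [← c2]; rfl
  have m0 : N1 * (ρ 0 - p) = -y1 := by rw [r0, s0]; field_simp
  have m1 : N2 * (ρ 1 - p) = b - p * N2 := by rw [r1, s1]; field_simp
  have m2 : N3 * (ρ 2 - p) = c - p * N3 := by rw [r2, s2]; field_simp
  have htrace := trace_cube_density_block_le (n := n) (k := k) hp.le h1.le (by omega) (by omega)
    (by omega) (ρ := ρ) (C := C) (by rw [r0, div_le_iff₀ hNpos1]; linarith)
    (by rw [r2, div_le_iff₀ hNpos3]; linarith)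
    (by
      have : (k:ℝ) * (k - 1) * (ρ 0 - p) = 2 * (N1 * (ρ 0 - p)) := by rw [hN1def]; ring
      rw [this, ← hN2def, m0, m1, abs_le]
      constructor <;> linarith)
    (by
      rw [← hN1def, ← hN2def, ← hN3def, m0, m1, m2, abs_le]
      constructor <;> linarith)
  have hcube : (ρ 0 - p) ^ 3 * ((k:ℝ) ^ 3 - 3 * k ^ 2) ≤ -((p - q) * (k - 3) - 1) ^ 3 := by
    have h10 : (ρ 0 - p) ^ 3 = - (p - ρ 0) ^ 3 := by ring
    rw [h10, neg_mul, neg_le_neg_iff]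
    refine pow_three_block_le hkr hN1def hD ?_ ?_
    · rw [r0, sub_nonneg, div_le_iff₀ hNpos1]; exact haN
    · have : (p - ρ 0) * N1 = y1 := by linarith only [m0]
      rw [this, hy1]; linarith only [ha2]
  have hn3 : (n:ℝ) * (n - 1) * (n - 2) ≤ n ^ 3 := by nlinarith only [hkr, hknr]
  have htn := mul_le_mul_of_nonneg_left hn3 ht
  refine le_trans ?_ (le_grProb_of_stratum hp h1 (by omega) ht (blockClass k) α hβ hα
    (by simp [α, Fin.sum_univ_three]) (by
      change (edgeMatrix (n := n) (fun e => ρ (blockClass k e)) *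
        edgeMatrix (fun e => ρ (blockClass k e)) *
        edgeMatrix (fun e => ρ (blockClass k e))).trace + 1 ≤ _
      linarith))
  change _ ≤ _ * ∏ j, (Real.exp (-(classCard (blockClass (n := n) k) j * bitKL (ρ j) p)) /
      (classCard (blockClass (n := n) k) j + 1))
  rw [Fin.prod_univ_three, c0, c1, c2]
  have hpp : 0 < p * (1 - p) := by positivity
  have hKq : 0 ≤ bitKL q p := by
    have := bitKL_antitone hq0 hqp.le le_rfl h1
    simpa [bitKL] using this
  have K0 : N1 * bitKL (ρ 0) p ≤ k ^ 2 / 2 * bitKL q p := by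
    have := bitKL_antitone hq0 (r := ρ 0) (by rw [r0, le_div_iff₀ hNpos1]; linarith)
      (by rw [r0, div_le_iff₀ hNpos1]; linarith) h1
    calc N1 * bitKL (ρ 0) p ≤ N1 * bitKL q p := mul_le_mul_of_nonneg_left this hNpos1.le
      _ ≤ _ := mul_le_mul_of_nonneg_right (by linarith) hKq
  have K1 : N2 * bitKL (ρ 1) p ≤ (k ^ 2) ^ 2 / (k * n / 2) / (p * (1 - p)) := by
    refine mul_bitKL_le hp h1 hNpos2 (by positivity) bN2 (by rw [r1]; positivity)
      (by rw [r1, div_le_one hNpos2]; exact hbN) m1 ?_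
    rw [abs_le]; constructor <;> linarith
  have K2 : N3 * bitKL (ρ 2) p ≤ (k ^ 2) ^ 2 / (n ^ 2 / 8) / (p * (1 - p)) := by
    refine mul_bitKL_le hp h1 hNpos3 (by positivity) bN3 (by rw [r2]; positivity)
      (by rw [r2, div_le_one hNpos3]; linarith) m2 ?_
    rw [abs_le]; constructor <;> linarith
  have Ksum : ((k:ℝ) ^ 2) ^ 2 / (k * n / 2) / (p * (1 - p)) +
      (k ^ 2) ^ 2 / (n ^ 2 / 8) / (p * (1 - p)) ≤ 4 * k ^ 3 / (n * (p * (1 - p))) := by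
    exact block_error_le hpp (by linarith only [hkr]) hknr
  have b1 : N1 + 1 ≤ (n:ℝ) ^ 2 := by nlinarith only [bN1, hnk, hkr]
  have b2 : N2 + 1 ≤ (n:ℝ) ^ 2 := by rw [hN2def]; nlinarith only [hkr, hknr]
  have b3 : N3 + 1 ≤ (n:ℝ) ^ 2 := by rw [hN3def]; nlinarith only [hkr, hknr]
  calc _ ≤ ((n:ℝ) ^ 9)⁻¹ * (Real.exp (-(N1 * bitKL (ρ 0) p)) * Real.exp (-(N2 * bitKL (ρ 1) p)) *
        Real.exp (-(N3 * bitKL (ρ 2) p))) := by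
        rw [← Real.exp_add, ← Real.exp_add]
        gcongr
        linarith
    _ = ((n:ℝ) ^ 3)⁻¹ * (Real.exp (-(N1 * bitKL (ρ 0) p)) / n ^ 2 *
        (Real.exp (-(N2 * bitKL (ρ 1) p)) / n ^ 2) *
        (Real.exp (-(N3 * bitKL (ρ 2) p)) / n ^ 2)) := by
        field_simp
    _ ≤ _ := by gcongr

end BlockProbability

section LowerAsymptotics

variable {p : ℝ}

set_option maxHeartbeats 1000000 in
/-- Asymptotic lower bound for the lower-tail probability. -/
lemma eventually_le_grProb (h0 : 1 / 2 ≤ p) (h1 : p < 1) {m : ℕ → ℕ} {C : ℝ}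
    (hm : ∀ n, |(m n : ℝ) - p * Fintype.card (EdgeIdx n)| ≤ C) {s t : ℕ → ℝ}
    (ht : ∀ n, 0 ≤ t n)
    (hs0 : ∀ᶠ n in atTop, 0 < s n) (hsn : ∀ ε > 0, ∀ᶠ n : ℕ in atTop, s n ≤ ε * n)
    (hs4 : ∀ K : ℝ, ∀ᶠ n : ℕ in atTop, K * (n:ℝ) ^ 3 ≤ s n ^ 4)
    (hst : ∀ᶠ n : ℕ in atTop, s n ^ 3 = t n * (n:ℝ) ^ 3) {δ : ℝ} (hδ : 0 < δ) :
    ∀ᶠ n in atTop, Real.exp (-((rateConst p + δ) * s n ^ 2)) ≤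
      grProb n (m n) (fun A => triDensity A ≤ p ^ 3 - t n) := by
  have hp : 0 < p := by linarith
  have hp1 : 0 < 1 - p := by linarith
  obtain ⟨q, hq0, hqp, hKL⟩ := exists_bitKL_le h0 h1 (show 0 < δ / 4 by positivity)
  have hc := rateConst_pos h0 h1
  set c := rateConst p with hcdef
  have hC0 : 0 ≤ C := (abs_nonneg _).trans (hm 0)
  obtain ⟨D, hDdef⟩ : ∃ D, D = p - q := ⟨_, rfl⟩
  have hD0 : 0 < D := by linarith
  have hD1 : D ≤ 1 := by linarith
  rw [← hDdef] at hKL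
  obtain ⟨κ, hκ0, hκ1, hκδ⟩ : ∃ κ : ℝ, 0 < κ ∧ κ ≤ 1 ∧ 8 * κ * (c + δ / 4) ≤ δ / 4 := by
    refine ⟨min 1 (δ / (32 * (c + δ / 4))), by positivity, min_le_left _ _, ?_⟩
    have := min_le_right 1 (δ / (32 * (c + δ / 4)))
    rw [le_div_iff₀ (by positivity)] at this
    linarith
  obtain ⟨S, hS0, hSκ, hSC⟩ : ∃ S : ℝ, 4 ≤ S ∧ 8 ≤ κ * S ∧ C + 1 ≤ S := by
    have h8 : 0 ≤ 8 / κ := by positivity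
    refine ⟨4 + 8 / κ + (C + 1), by linarith, ?_, by linarith⟩
    have : κ * (8 / κ) = 8 := by field_simp
    nlinarith
  obtain ⟨B, hB⟩ : ∃ B : ℝ, B = 6 * C + 3 * (1 + (2 * C + 1) ^ 2) + 1 := ⟨_, rfl⟩
  have hB0 : 0 ≤ B := by rw [hB]; positivity
  filter_upwards [hs0, hsn 1 one_pos, hs4 (S ^ 4), hsn (D * (1 - p) / 12) (by positivity),
    hs4 (B / κ), hsn (δ * D ^ 3 * (p * (1 - p)) / 432) (by positivity), hs4 ((36 / δ) ^ 2), hst,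
    eventually_ge_atTop 3] with n hs hsn1 hsS hsD hsB hsδ hsL hst' hn
  have hnr : (3:ℝ) ≤ n := by exact_mod_cast hn
  have hn0 : (0:ℝ) < n := by linarith
  rw [one_mul] at hsn1
  obtain ⟨x, hx⟩ : ∃ x, x = s n := ⟨_, rfl⟩
  rw [← hx] at hs hsn1 hsS hsD hsB hsδ hsL hst' ⊢
  have hxS : S ≤ x := by
    refine le_of_pow_le_pow_left₀ four_ne_zero hs.le (le_trans ?_ hsS)
    exact le_mul_of_one_le_right (by positivity) (one_le_pow₀ (by linarith))
  have hκx : 8 ≤ κ * x := hSκ.trans (mul_le_mul_of_nonneg_left hxS hκ0.le)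
  have hxL : 9 * n ≤ δ / 4 * x ^ 2 := by
    have h2 : 36 / δ * n ≤ x ^ 2 := by
      refine le_of_sq_le_sq ?_ (by positivity)
      calc (36 / δ * n) ^ 2 = (36 / δ) ^ 2 * (n:ℝ) ^ 2 := by ring
        _ ≤ (36 / δ) ^ 2 * (n:ℝ) ^ 3 := by
          gcongr
          · linarith
          · norm_num
        _ ≤ x ^ 4 := hsL
        _ = _ := by ring
    rw [div_mul_eq_mul_div, div_le_iff₀ hδ] at h2
    linarith
  have hxB : B * n ≤ κ * x ^ 3 := by
    have h2 : x ^ 4 ≤ x ^ 3 * n := by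
      calc x ^ 4 = x ^ 3 * x := by ring
        _ ≤ _ := by gcongr
    have h3 : B / κ * n ^ 2 * n ≤ x ^ 3 * n := by
      calc _ = B / κ * (n:ℝ) ^ 3 := by ring
        _ ≤ _ := hsB.trans h2
    have h4 := le_of_mul_le_mul_right h3 hn0
    rw [div_mul_eq_mul_div, div_le_iff₀ hκ0] at h4
    have h5 : B * (n:ℝ) ≤ B * n ^ 2 := by
      gcongr
      exact le_self_pow₀ (by linarith) two_ne_zero
    linarith
  obtain ⟨k, hk1, hk2⟩ : ∃ k : ℕ, (1 + κ) * x ≤ D * k ∧ D * k ≤ (1 + κ) * x + D := by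
    refine ⟨⌈(1 + κ) * x / D⌉₊, ?_, ?_⟩
    · have := Nat.le_ceil ((1 + κ) * x / D)
      rw [div_le_iff₀ hD0] at this
      linarith
    · have := (Nat.ceil_lt_add_one (show 0 ≤ (1 + κ) * x / D by positivity)).le
      calc _ ≤ D * ((1 + κ) * x / D + 1) := by gcongr
        _ = _ := by field_simp
  have hk3 : D * k ≤ (1 + 2 * κ) * x := by linarith
  have hk4 : D * k ≤ 3 * x := by
    have : κ * x ≤ 1 * x := by gcongr
    linarith
  have hxk : x ≤ D * k := by linarith
  have hkr : (4:ℝ) ≤ k := by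
    have : D * k ≤ 1 * k := by gcongr
    linarith
  have hsD' : 12 * x ≤ D * ((1 - p) * n) := by linarith
  have hDn : D * ((1 - p) * n) ≤ D * (1 * n) := by gcongr; linarith
  have hkn : 4 * (k:ℝ) ≤ n := by
    refine le_of_mul_le_mul_left ?_ hD0
    linarith
  have hkp : 2 * (k:ℝ) ≤ (1 - p) * n := by
    refine le_of_mul_le_mul_left ?_ hD0
    linarith
  have hkk : (k:ℝ) ≤ k * (k - 1) / 2 := by nlinarith
  have hmain := le_grProb_block (n := n) h0 h1 hq0 hqp (k := k) (m := m n) (ht n)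
    (by exact_mod_cast hkr) (by exact_mod_cast hkn) (hm n)
    (by
      rw [← hDdef]
      have := mul_le_mul_of_nonneg_left hkk hD0.le
      linarith) hkp
    (by rw [← hDdef]; linarith)
    (by
      rw [← hDdef]
      have e1 : (1 + κ / 2) * x ≤ D * (k - 3) - 1 := by linarith
      have e2 : ((1 + κ / 2) * x) ^ 3 ≤ (D * (k - 3) - 1) ^ 3 :=
        pow_le_pow_left₀ (by positivity) e1 3
      have e3 : 1 + κ ≤ (1 + κ / 2) ^ 3 := by
        have : 0 ≤ κ ^ 3 := by positivity
        nlinarith [sq_nonneg κ]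
      have e4 : (1 + κ) * x ^ 3 ≤ (1 + κ / 2) ^ 3 * x ^ 3 := by gcongr
      have e5 : 6 * C * n + 3 * (1 + (2 * C + 1) ^ 2) + 1 ≤ B * n := by
        have : (3 * (1 + (2 * C + 1) ^ 2) + 1) * 1 ≤ (3 * (1 + (2 * C + 1) ^ 2) + 1) * (n:ℝ) := by
          gcongr
          linarith
        rw [hB]
        linarith
      rw [mul_pow] at e2
      linarith)
  refine le_trans ?_ hmain
  have f1 : (k:ℝ) ^ 2 / 2 * bitKL q p ≤ (c + δ / 2) * x ^ 2 := by
    calc (k:ℝ) ^ 2 / 2 * bitKL q p ≤ (k:ℝ) ^ 2 / 2 * (2 * D ^ 2 * (c + δ / 4)) := by gcongr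
      _ = (D * k) ^ 2 * (c + δ / 4) := by ring
      _ ≤ ((1 + 2 * κ) * x) ^ 2 * (c + δ / 4) := by gcongr
      _ = (1 + 2 * κ) ^ 2 * (c + δ / 4) * x ^ 2 := by ring
      _ ≤ (1 + 8 * κ) * (c + δ / 4) * x ^ 2 := by
          gcongr
          nlinarith
      _ ≤ _ := by
          gcongr
          linarith
  have f2 : 4 * (k:ℝ) ^ 3 / (n * (p * (1 - p))) ≤ δ / 4 * x ^ 2 := by
    rw [div_le_iff₀ (by positivity)]
    have g1 : (D * k) ^ 3 ≤ (3 * x) ^ 3 := by gcongr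
    have g2 : x ^ 2 * (432 * x) ≤ x ^ 2 * (δ * D ^ 3 * (p * (1 - p)) * n) := by
      refine mul_le_mul_of_nonneg_left ?_ (by positivity)
      linarith
    have g3 : D ^ 3 * (4 * (k:ℝ) ^ 3) ≤ D ^ 3 * (δ / 4 * x ^ 2 * (n * (p * (1 - p)))) := by
      linarith
    exact le_of_mul_le_mul_left g3 (by positivity)
  have f3 : Real.exp (-(9 * n)) ≤ ((n:ℝ) ^ 9)⁻¹ := by
    rw [Real.exp_neg]
    have h2 : (n:ℝ) ^ 9 ≤ Real.exp (9 * n) := by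
      have h3 : (n:ℝ) ≤ Real.exp n := by linarith [Real.add_one_le_exp (n:ℝ)]
      calc (n:ℝ) ^ 9 ≤ Real.exp n ^ 9 := by gcongr
        _ = _ := by rw [← Real.exp_nat_mul]; norm_num
    gcongr
  calc _ ≤ Real.exp (-(9 * n)) * Real.exp (-((k:ℝ) ^ 2 / 2 * bitKL q p +
        4 * k ^ 3 / (n * (p * (1 - p))))) := by
        rw [← Real.exp_add, Real.exp_le_exp]
        linarith
    _ ≤ _ := by gcongr

end LowerAsymptotics

/-- Two-sided exponential bounds identify the rate. -/
lemma tendsto_neg_log_div {P v : ℕ → ℝ} {c : ℝ} (hv : ∀ᶠ n in atTop, 0 < v n)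
    (hlo : ∀ δ > 0, ∀ᶠ n in atTop, Real.exp (-((c + δ) * v n)) ≤ P n)
    (hhi : ∀ δ > 0, ∀ᶠ n in atTop, P n ≤ Real.exp (-((c - δ) * v n))) :
    Tendsto (fun n => -Real.log (P n) / v n) atTop (𝓝 c) := by
  rw [Metric.tendsto_nhds]
  intro ε hε
  filter_upwards [hv, hlo (ε / 2) (half_pos hε), hhi (ε / 2) (half_pos hε)] with n hn h1 h2
  have hP : 0 < P n := (Real.exp_pos _).trans_le h1
  rw [← Real.le_log_iff_exp_le hP] at h1
  rw [← Real.log_le_iff_le_exp hP] at h2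
  have h3 : -Real.log (P n) / v n ≤ c + ε / 2 := by
    rw [div_le_iff₀ hn]; linarith
  have h4 : c - ε / 2 ≤ -Real.log (P n) / v n := by
    rw [le_div_iff₀ hn]; linarith
  rw [Real.dist_eq, abs_lt]
  constructor <;> linarith

/-- Theorem `thm:large-p-triangle-count`, probability asymptotics:
for `1/2 ≤ p < 1`, `|m_n - p·C(n,2)| = O(1)` and `n^{-3/4} ≪ t_n ≪ 1`,
`Pr(τ(A_n) ≤ p³ - t_n) = exp(-c_p t_n^{2/3} n² + o(t_n^{2/3} n²))`, i.e.
`-ln Pr / (t_n^{2/3} n²) → c_p` where `c_p = ln(p/(1-p))/(2(2p-1))` and `c_{1/2} = 1`. -/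
theorem lower_tail_triangle_density_large_p
    (p : ℝ) (hp₀ : 1 / 2 ≤ p) (hp₁ : p < 1)
    (m : ℕ → ℕ) (hm : ∃ C : ℝ, ∀ n : ℕ, |(m n : ℝ) - p * (n.choose 2 : ℝ)| ≤ C)
    (t : ℕ → ℝ) (htpos : ∀ n, 0 < t n)
    (ht₁ : Tendsto (fun n : ℕ => (n : ℝ) ^ ((3 : ℝ) / 4) * t n) atTop atTop)
    (ht₂ : Tendsto t atTop (nhds 0)) :
    Tendsto
      (fun n : ℕ =>
        -Real.log (grProb n (m n) (fun A => triDensity A ≤ p ^ 3 - t n)) /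
          (t n ^ ((2 : ℝ) / 3) * (n : ℝ) ^ 2))
      atTop
      (nhds (if p = 1 / 2 then 1 else Real.log (p / (1 - p)) / (2 * (2 * p - 1)))) := by
  obtain ⟨C, hC⟩ := hm
  have hm' : ∀ n, |(m n : ℝ) - p * Fintype.card (EdgeIdx n)| ≤ C := by
    intro n
    rw [card_edgeIdx, ← Nat.cast_choose_two]
    exact hC n
  set s : ℕ → ℝ := fun n => t n ^ ((1:ℝ) / 3) * n with hs
  have hpow : ∀ n (j : ℕ), (t n ^ ((1:ℝ) / 3)) ^ j = t n ^ ((j:ℝ) / 3) := by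
    intro n j
    rw [← Real.rpow_natCast, ← Real.rpow_mul (htpos n).le]
    congr 1
    ring
  have hs2 : ∀ n, s n ^ 2 = t n ^ ((2 : ℝ) / 3) * (n : ℝ) ^ 2 := by
    intro n
    simp only [hs, mul_pow, hpow]
    norm_num
  have hst : ∀ᶠ n : ℕ in atTop, s n ^ 3 = t n * (n:ℝ) ^ 3 := by
    refine Eventually.of_forall fun n => ?_
    simp only [hs, mul_pow, hpow]
    norm_num
  have hs0 : ∀ᶠ n in atTop, 0 < s n := by
    filter_upwards [eventually_gt_atTop 0] with n hn
    have h2 : (0:ℝ) < n := by exact_mod_cast hn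
    exact mul_pos (Real.rpow_pos_of_pos (htpos n) _) h2
  have hsn : ∀ ε > 0, ∀ᶠ n : ℕ in atTop, s n ≤ ε * n := by
    intro ε hε
    filter_upwards [ht₂.eventually_le_const (show (0:ℝ) < ε ^ 3 by positivity)] with n hn
    refine mul_le_mul_of_nonneg_right ?_ (Nat.cast_nonneg n)
    refine le_of_pow_le_pow_left₀ three_ne_zero hε.le ?_
    rw [hpow]
    norm_num
    exact hn
  have hs4 : ∀ K : ℝ, ∀ᶠ n : ℕ in atTop, K * (n:ℝ) ^ 3 ≤ s n ^ 4 := by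
    intro K
    have h2 := (tendsto_rpow_atTop (show (0:ℝ) < 4 / 3 by norm_num)).comp ht₁
    filter_upwards [h2.eventually_ge_atTop K] with n hn
    have hn0 : (0:ℝ) ≤ n := Nat.cast_nonneg n
    have h3 : ((n : ℝ) ^ ((3 : ℝ) / 4) * t n) ^ ((4:ℝ) / 3) = n * t n ^ ((4:ℝ) / 3) := by
      rw [Real.mul_rpow (by positivity) (htpos n).le, ← Real.rpow_mul hn0]
      norm_num
    rw [Function.comp_apply, h3] at hn
    calc K * (n:ℝ) ^ 3 ≤ n * t n ^ ((4:ℝ) / 3) * (n:ℝ) ^ 3 := by gcongr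
      _ = s n ^ 4 := by
        simp only [hs, mul_pow, hpow]
        norm_num
        ring
  simp_rw [← hs2]
  change Tendsto _ _ (𝓝 (rateConst p))
  refine tendsto_neg_log_div (hs0.mono fun n hn => by positivity) ?_ ?_
  · intro δ hδ
    exact eventually_le_grProb hp₀ hp₁ hm' (fun n => (htpos n).le) hs0 hsn hs4 hst hδ
  · intro δ hδ
    exact eventually_grProb_le hp₀ hp₁ hm' hs0 hsn hs4 hst hδ

end
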